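/- The intersection number labels connected components: let (L1, L2) and (L1', L2') be two pairs of continuous paths of Lagrangian subspaces of a real symplectic vector space (E, ω) on [a,b] with dim(L1(a)∩L2(a)) = dim(L1'(a)∩L2'(a)) =: d_a and dim(L1(b)∩L2(b)) = dim(L1'(b)∩L2'(b)) =: d_b. Then there exists a homotopy (s,t) ↦ (L1^s(t), L2^s(t)), s ∈ [0,1], through pairs of continuous paths of Lagrangian subspaces (jointly continuous in (s,t)) with (L1^0, L2^0) = (L1, L2), (L1^1, L2^1) = (L1', L2'), dim(L1^s(a)∩L2^s(a)) = d_a and dim(L1^s(b)∩L2^s(b)) = d_b for all s, if and only if [L1 : L2] = [L1' : L2']. -/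

import Mathlib

open LinearMap (BilinForm)

variable {E : Type*} [NormedAddCommGroup E] [NormedSpace ℝ E]

/-- A subspace is Lagrangian iff it equals its symplectic orthogonal. -/
def IsLagrangian (ω : BilinForm ℝ E) (L : Submodule ℝ E) : Prop :=
  LinearMap.BilinForm.orthogonal ω L = L

/-- Maximal dimension of a subspace on which the function `Q` is positive away from `0`. -/
noncomputable def posIndex {V : Type*} [AddCommGroup V] [Module ℝ V] (Q : V → ℝ) : ℕ :=
  sSup {d : ℕ | ∃ W : Submodule ℝ V, Module.finrank ℝ W = d ∧ ∀ x ∈ W, x ≠ 0 → 0 < Q x}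

/-- The quadratic form `Q(L1,L2,L3)` of a triplet of subspaces,
`Q(x1,x2,x3) = ω(x1,x2) + ω(x2,x3) + ω(x3,x1)`. -/
def tripleQ (ω : BilinForm ℝ E) (L1 L2 L3 : Submodule ℝ E) (v : L1 × L2 × L3) : ℝ :=
  ω v.1 v.2.1 + ω v.2.1 v.2.2 + ω v.2.2 v.1

/-- The signature `s(L1,L2,L3)` of a triplet of subspaces: the signature (number of positive
squares minus number of negative squares in a diagonalization) of `Q(L1,L2,L3)`. -/
noncomputable def tripleSig (ω : BilinForm ℝ E) (L1 L2 L3 : Submodule ℝ E) : ℤ :=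
  (posIndex (tripleQ ω L1 L2 L3) : ℤ) - (posIndex (fun v => - tripleQ ω L1 L2 L3 v) : ℤ)

/-- A continuous path of Lagrangian subspaces of `(E, ω)` on the interval `[a,b]`:  a family
`(L t)` of Lagrangian subspaces such that every `t0 ∈ [a,b]` has a neighbourhood `U` in `[a,b]`
on which there is a continuous family of idempotent linear maps of `E` with range `L t`. -/
structure IsLagrangianPath (ω : BilinForm ℝ E) (a b : ℝ) (L : ℝ → Submodule ℝ E) : Prop where
  lag : ∀ t ∈ Set.Icc a b, IsLagrangian ω (L t)
  locTriv : ∀ t0 ∈ Set.Icc a b, ∃ U ∈ nhdsWithin t0 (Set.Icc a b), U ⊆ Set.Icc a b ∧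
    ∃ P : ℝ → E →L[ℝ] E, ContinuousOn P U ∧
      ∀ t ∈ U, (P t).comp (P t) = P t ∧ LinearMap.range (P t : E →ₗ[ℝ] E) = L t

/-- A jointly continuous two-parameter family `(L s t)`, `s ∈ [0,1]`, `t ∈ [a,b]`, of Lagrangian
subspaces (a homotopy of paths of Lagrangian subspaces). -/
structure IsLagrangianHomotopy (ω : BilinForm ℝ E) (a b : ℝ)
    (L : ℝ → ℝ → Submodule ℝ E) : Prop where
  lag : ∀ s ∈ Set.Icc (0:ℝ) 1, ∀ t ∈ Set.Icc a b, IsLagrangian ω (L s t)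
  locTriv : ∀ p ∈ Set.Icc (0:ℝ) 1 ×ˢ Set.Icc a b,
    ∃ U ∈ nhdsWithin p (Set.Icc (0:ℝ) 1 ×ˢ Set.Icc a b),
      U ⊆ Set.Icc (0:ℝ) 1 ×ˢ Set.Icc a b ∧
      ∃ P : ℝ × ℝ → E →L[ℝ] E, ContinuousOn P U ∧
        ∀ q ∈ U, (P q).comp (P q) = P q ∧ LinearMap.range (P q : E →ₗ[ℝ] E) = L q.1 q.2

/-- Admissible data for a pair of paths of Lagrangian subspaces on `[a,b]`:  a partition
`a = t_0 ≤ t_1 ≤ … ≤ t_k = b` together with Lagrangian subspaces `M_1, …, M_k` such that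
`M_ν ∩ L_i(t) = 0` for all `t ∈ [t_{ν-1}, t_ν]`, `i = 1,2`.  (Here `M (ν+1)` plays the role
of `M_{ν+1}` for `0 ≤ ν < k`.) -/
structure AdmissibleData (ω : BilinForm ℝ E) (a b : ℝ) (L1 L2 : ℝ → Submodule ℝ E) where
  k : ℕ
  kpos : 0 < k
  t : ℕ → ℝ
  M : ℕ → Submodule ℝ E
  ht0 : t 0 = a
  htk : t k = b
  hmono : ∀ ν < k, t ν ≤ t (ν + 1)
  hlag : ∀ ν < k, IsLagrangian ω (M (ν + 1))
  htrans1 : ∀ ν < k, ∀ s ∈ Set.Icc (t ν) (t (ν + 1)), M (ν + 1) ⊓ L1 s = ⊥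
  htrans2 : ∀ ν < k, ∀ s ∈ Set.Icc (t ν) (t (ν + 1)), M (ν + 1) ⊓ L2 s = ⊥

/-- The expression `(1/2) Σ_ν ( s(L1(t_{ν-1}), L2(t_{ν-1}), M_ν) − s(L1(t_ν), L2(t_ν), M_ν) )`
computed from admissible data; by well-definedness this is the intersection number `[L1 : L2]`. -/
noncomputable def dataSum {ω : BilinForm ℝ E} {a b : ℝ} {L1 L2 : ℝ → Submodule ℝ E}
    (D : AdmissibleData ω a b L1 L2) : ℝ :=
  (1 / 2 : ℝ) * ∑ ν ∈ Finset.range D.k,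
    ((tripleSig ω (L1 (D.t ν)) (L2 (D.t ν)) (D.M (ν + 1)) : ℝ)
      - (tripleSig ω (L1 (D.t (ν + 1))) (L2 (D.t (ν + 1))) (D.M (ν + 1)) : ℝ))

/-- A continuous path of symplectic automorphisms of `(E, ω)` on `[a,b]`. -/
structure IsSymplecticPath (ω : BilinForm ℝ E) (a b : ℝ) (A : ℝ → E →L[ℝ] E) : Prop where
  bij : ∀ t ∈ Set.Icc a b, Function.Bijective (A t)
  symp : ∀ t ∈ Set.Icc a b, ∀ x y, ω (A t x) (A t y) = ω x y
  cont : ContinuousOn A (Set.Icc a b)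

/-- The symplectic form of `E × E⁻`: `((x1,x2),(y1,y2)) ↦ ω(x1,y1) − ω(x2,y2)`. -/
noncomputable def prodNegForm (ω : BilinForm ℝ E) : BilinForm ℝ (E × E) :=
  LinearMap.mk₂ ℝ (fun x y => ω x.1 y.1 - ω x.2 y.2)
    (fun x x' y => by simp only [Prod.fst_add, Prod.snd_add, map_add, LinearMap.add_apply]; ring)
    (fun c x y => by
      simp only [Prod.smul_fst, Prod.smul_snd, map_smul, LinearMap.smul_apply, smul_eq_mul]; ring)
    (fun x y y' => by simp only [Prod.fst_add, Prod.snd_add, map_add]; ring)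
    (fun c x y => by simp only [Prod.smul_fst, Prod.smul_snd, map_smul, smul_eq_mul]; ring)

/-- The graph `Γ_A = {(A x, x)}` of an endomorphism, as a subspace of `E × E`. -/
def graphSub (A : E →L[ℝ] E) : Submodule ℝ (E × E) :=
  LinearMap.range ((A : E →ₗ[ℝ] E).prod LinearMap.id)

/-- The diagonal `Δ = {(x, x)}` in `E × E`. -/
def diagSub : Submodule ℝ (E × E) :=
  LinearMap.range ((LinearMap.id : E →ₗ[ℝ] E).prod LinearMap.id)

set_option linter.unusedSectionVars false

section LinearAlgebra

/-- A symplectic form: alternating and nondegenerate. -/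
class IsSymplForm (ω : BilinForm ℝ E) : Prop where
  alt : LinearMap.IsAlt ω
  nondeg : LinearMap.BilinForm.Nondegenerate ω

open Module Submodule

variable [FiniteDimensional ℝ E] (ω : BilinForm ℝ E) [hω : IsSymplForm ω]

theorem symp_self (x : E) : ω x x = 0 := hω.alt x

theorem symp_swap (x y : E) : ω x y = - ω y x := by
  rw [← hω.alt.neg y x]

variable {ω}

theorem IsLagrangian.apply {L : Submodule ℝ E} (h : IsLagrangian ω L) {x y : E} (hx : x ∈ L)
    (hy : y ∈ L) : ω x y = 0 := by
  rw [← h] at hy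
  exact LinearMap.BilinForm.mem_orthogonal_iff.1 hy x hx

theorem IsLagrangian.mem {L : Submodule ℝ E} (h : IsLagrangian ω L) {x : E}
    (hx : ∀ n ∈ L, ω n x = 0) : x ∈ L :=
  h.le (LinearMap.BilinForm.mem_orthogonal_iff.2 hx)

theorem IsLagrangian.finrank_add_self {L : Submodule ℝ E} (h : IsLagrangian ω L) :
    finrank ℝ E = finrank ℝ L + finrank ℝ L := by
  have h1 := LinearMap.BilinForm.finrank_orthogonal hω.nondeg L
  rw [h] at h1
  have := Submodule.finrank_le L
  omega

theorem symp_eq_zero {x : E} (h : ∀ y, ω x y = 0) : x = 0 :=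
  hω.nondeg.1 x h

/-- An isotropic subspace of half the dimension is Lagrangian. -/
theorem isLagrangian_of_isotropic {L : Submodule ℝ E} (h : ∀ x ∈ L, ∀ y ∈ L, ω x y = 0)
    (hd : finrank ℝ E ≤ finrank ℝ L + finrank ℝ L) : IsLagrangian ω L := by
  have h1 := LinearMap.BilinForm.finrank_orthogonal hω.nondeg L
  refine (Submodule.eq_of_le_of_finrank_le ?_ ?_).symm
  · intro y hy
    exact LinearMap.BilinForm.mem_orthogonal_iff.2 fun x hx => h x hx y hy
  · omega

theorem IsLagrangian.finrank_eq {L M : Submodule ℝ E} (hL : IsLagrangian ω L)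
    (hM : IsLagrangian ω M) : finrank ℝ L = finrank ℝ M := by
  have := hL.finrank_add_self
  have := hM.finrank_add_self
  omega

theorem IsLagrangian.isCompl {L M : Submodule ℝ E} (hL : IsLagrangian ω L)
    (hM : IsLagrangian ω M) (h : L ⊓ M = ⊥) : IsCompl L M := by
  rw [Submodule.isCompl_iff_disjoint]
  · exact disjoint_iff.2 h
  · rw [hL.finrank_add_self, hL.finrank_eq hM]

/-- Lagrangian subspaces avoiding finitely many given Lagrangian subspaces exist. -/
theorem exists_common_transversal (S : Finset (Submodule ℝ E)) (hS : ∀ L ∈ S, IsLagrangian ω L) :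
    ∃ M, IsLagrangian ω M ∧ ∀ L ∈ S, M ⊓ L = ⊥ := by
  classical
  let P : Submodule ℝ E → Prop := fun K =>
    (∀ x ∈ K, ∀ y ∈ K, ω x y = 0) ∧ ∀ L ∈ S, K ⊓ L = ⊥
  have hP0 : P ⊥ := by
    refine ⟨?_, fun L _ => by simp⟩
    intro x hx y hy
    rw [(Submodule.mem_bot ℝ).1 hx]; simp
  obtain ⟨K, hK, hmax⟩ : ∃ K, P K ∧ ∀ K', P K' → finrank ℝ K' ≤ finrank ℝ K := by
    have hbdd : ∀ m ∈ {m | ∃ K, P K ∧ finrank ℝ K = m}, m ≤ finrank ℝ E := by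
      rintro m ⟨K, -, rfl⟩
      exact Submodule.finrank_le K
    have hne : {m | ∃ K, P K ∧ finrank ℝ K = m}.Nonempty := ⟨_, ⊥, hP0, rfl⟩
    obtain ⟨K, hK, hKe⟩ := Nat.sSup_mem hne ⟨_, hbdd⟩
    refine ⟨K, hK, fun K' hK' => ?_⟩
    rw [hKe]
    exact le_csSup ⟨_, hbdd⟩ ⟨K', hK', rfl⟩
  refine ⟨K, ?_, hK.2⟩
  by_contra hnl
  have hlt : finrank ℝ K + finrank ℝ K < finrank ℝ E := by
    by_contra hge
    exact hnl (isLagrangian_of_isotropic hK.1 (not_lt.1 hge))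
  set W := LinearMap.BilinForm.orthogonal ω K with hW
  have hWd : finrank ℝ W = finrank ℝ E - finrank ℝ K :=
    LinearMap.BilinForm.finrank_orthogonal hω.nondeg K
  have hKW : K ≤ W := fun y hy =>
    LinearMap.BilinForm.mem_orthogonal_iff.2 fun x hx => hK.1 x hx y hy
  have hmemW : ∀ y ∈ W, ∀ x ∈ K, ω x y = 0 := fun y hy =>
    LinearMap.BilinForm.mem_orthogonal_iff.1 hy
  let T : Finset (Submodule ℝ W) := insert (K.comap W.subtype)
    (S.image fun L => (K ⊔ L).comap W.subtype)
  have hT : ⊤ ∉ T := by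
    intro htop
    rcases Finset.mem_insert.1 htop with h | h
    · have h2 : W ≤ K := Submodule.comap_subtype_eq_top.1 h.symm
      have := Submodule.finrank_mono h2
      omega
    · obtain ⟨L, hL, h⟩ := Finset.mem_image.1 h
      have h2 : W ≤ K ⊔ L := Submodule.comap_subtype_eq_top.1 h
      have hiso : ∀ x ∈ W, ∀ y ∈ W, ω x y = 0 := by
        intro x hx y hy
        obtain ⟨k, hk, l, hl, rfl⟩ := Submodule.mem_sup.1 (h2 hx)
        obtain ⟨k', hk', l', hl', rfl⟩ := Submodule.mem_sup.1 (h2 hy)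
        have e1 := hmemW _ hy k hk
        have e2 := hmemW _ hx k' hk'
        have e3 := (hS L hL).apply hl hl'
        have e4 := hK.1 k hk k' hk'
        have e5 := symp_swap ω l k'
        have e6 := hK.1 k' hk' k hk
        simp only [map_add, LinearMap.add_apply] at e1 e2 ⊢
        linarith
      have hW2 : W ≤ LinearMap.BilinForm.orthogonal ω W := fun y hy =>
        LinearMap.BilinForm.mem_orthogonal_iff.2 fun x hx => hiso x hx y hy
      have h3 := Submodule.finrank_mono hW2
      rw [LinearMap.BilinForm.finrank_orthogonal hω.nondeg W] at h3
      omega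
  have hun := Subspace.biUnion_ne_univ_of_top_notMem hT
  obtain ⟨v, hv⟩ := (Set.ne_univ_iff_exists_notMem _).1 hun
  simp only [Set.mem_iUnion, not_exists] at hv
  have hvK : (v : E) ∉ K := fun h => hv _ (Finset.mem_insert_self _ _) h
  have hvL : ∀ L ∈ S, (v : E) ∉ K ⊔ L := fun L hL h =>
    hv _ (Finset.mem_insert_of_mem (Finset.mem_image_of_mem _ hL)) h
  have hPK' : P (K ⊔ span ℝ {(v : E)}) := by
    constructor
    · intro x hx y hy
      obtain ⟨k, hk, c, hc, rfl⟩ := Submodule.mem_sup.1 hx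
      obtain ⟨k', hk', c', hc', rfl⟩ := Submodule.mem_sup.1 hy
      obtain ⟨c, rfl⟩ := Submodule.mem_span_singleton.1 hc
      obtain ⟨c', rfl⟩ := Submodule.mem_span_singleton.1 hc'
      have e1 := hmemW _ v.2 k hk
      have e2 := hmemW _ v.2 k' hk'
      have e3 := symp_swap ω v k'
      have e4 := symp_self ω (v : E)
      have e5 := hK.1 k hk k' hk'
      simp [e1, e2, e3, e4, e5]
    · intro L hL
      rw [Submodule.eq_bot_iff]
      rintro x ⟨hx, hxL⟩
      obtain ⟨k, hk, c, hc, rfl⟩ := Submodule.mem_sup.1 hx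
      obtain ⟨c, rfl⟩ := Submodule.mem_span_singleton.1 hc
      by_cases hc0 : c = 0
      · subst hc0
        have : k ∈ K ⊓ L := ⟨hk, by simpa using hxL⟩
        rw [hK.2 L hL] at this
        simpa using this
      · exfalso
        apply hvL L hL
        have : (v : E) = c⁻¹ • (-k) + c⁻¹ • (k + c • (v : E)) := by
          rw [← smul_add, neg_add_cancel_left, smul_smul, inv_mul_cancel₀ hc0, one_smul]
        rw [this]
        exact Submodule.add_mem_sup (K.smul_mem _ (K.neg_mem hk)) (L.smul_mem _ hxL)
  have hlt2 : K < K ⊔ span ℝ {(v : E)} := by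
    refine lt_of_le_of_ne le_sup_left fun h => hvK ?_
    rw [h]
    exact Submodule.mem_sup_right (Submodule.mem_span_singleton_self _)
  have := hmax _ hPK'
  have := Submodule.finrank_lt_finrank_of_lt hlt2
  omega

end LinearAlgebra

section LagrangianGrassmannian

open Module Submodule Filter Topology

variable [FiniteDimensional ℝ E]

/-- The projection onto `L`, orthogonal for an auxiliary Euclidean structure. -/
noncomputable def projOp (L : Submodule ℝ E) : E →L[ℝ] E :=
  ((toEuclidean (E := E)).symm : EuclideanSpace ℝ (Fin (finrank ℝ E)) →L[ℝ] E) ∘L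
    ((L.map ((toEuclidean (E := E)).toLinearEquiv :
        E →ₗ[ℝ] EuclideanSpace ℝ (Fin (finrank ℝ E)))).starProjection ∘L
      (toEuclidean (E := E) : E →L[ℝ] EuclideanSpace ℝ (Fin (finrank ℝ E))))

/-- The adjoint for an auxiliary Euclidean structure. -/
noncomputable def adjOp (A : E →L[ℝ] E) : E →L[ℝ] E :=
  ((toEuclidean (E := E)).symm : EuclideanSpace ℝ (Fin (finrank ℝ E)) →L[ℝ] E) ∘L
    ((ContinuousLinearMap.adjoint
        ((toEuclidean (E := E) : E →L[ℝ] EuclideanSpace ℝ (Fin (finrank ℝ E))) ∘L A ∘L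
      ((toEuclidean (E := E)).symm : EuclideanSpace ℝ (Fin (finrank ℝ E)) →L[ℝ] E))) ∘L
      (toEuclidean (E := E) : E →L[ℝ] EuclideanSpace ℝ (Fin (finrank ℝ E))))

theorem projOp_mem (L : Submodule ℝ E) (x : E) : projOp L x ∈ L := by
  have h := Submodule.starProjection_apply_mem (L.map ((toEuclidean (E := E)).toLinearEquiv :
        E →ₗ[ℝ] EuclideanSpace ℝ (Fin (finrank ℝ E)))) (toEuclidean x)
  obtain ⟨y, hy, h⟩ := h
  have : projOp L x = y := by
    simp only [projOp, ContinuousLinearMap.comp_apply]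
    erw [← h]
    exact (toEuclidean (E := E)).symm_apply_apply y
  rw [this]
  exact hy

theorem projOp_of_mem {L : Submodule ℝ E} {x : E} (hx : x ∈ L) : projOp L x = x := by
  have h : (L.map ((toEuclidean (E := E)).toLinearEquiv :
        E →ₗ[ℝ] EuclideanSpace ℝ (Fin (finrank ℝ E)))).starProjection (toEuclidean x) =
        toEuclidean x :=
    Submodule.starProjection_eq_self_iff.2 ⟨x, hx, rfl⟩
  simp only [projOp, ContinuousLinearMap.comp_apply]
  erw [h]
  exact (toEuclidean (E := E)).symm_apply_apply x

theorem projOp_symm (L : Submodule ℝ E) (x y : E) :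
    inner ℝ (toEuclidean (projOp L x)) (toEuclidean y) =
      inner ℝ (toEuclidean x) (toEuclidean (projOp L y)) := by
  simp only [projOp, ContinuousLinearMap.comp_apply, ContinuousLinearEquiv.coe_coe,
    ContinuousLinearEquiv.apply_symm_apply]
  exact Submodule.inner_starProjection_left_eq_right _ _ _

theorem adjOp_inner (A : E →L[ℝ] E) (x y : E) :
    inner ℝ (toEuclidean (adjOp A x)) (toEuclidean y) =
      inner ℝ (toEuclidean x) (toEuclidean (A y)) := by
  simp only [adjOp, ContinuousLinearMap.comp_apply, ContinuousLinearEquiv.coe_coe,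
    ContinuousLinearEquiv.apply_symm_apply, ContinuousLinearMap.adjoint_inner_left,
    ContinuousLinearEquiv.symm_apply_apply]

theorem continuous_adjOp : Continuous (adjOp : (E →L[ℝ] E) → E →L[ℝ] E) := by
  unfold adjOp
  have h : Continuous (fun B : EuclideanSpace ℝ (Fin (finrank ℝ E)) →L[ℝ]
      EuclideanSpace ℝ (Fin (finrank ℝ E)) => ContinuousLinearMap.adjoint B) :=
    (ContinuousLinearMap.adjoint (𝕜 := ℝ) (E := EuclideanSpace ℝ (Fin (finrank ℝ E)))
      (F := EuclideanSpace ℝ (Fin (finrank ℝ E)))).continuous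
  refine continuous_const.clm_comp (Continuous.clm_comp (h.comp ?_) continuous_const)
  fun_prop

theorem eq_of_inner_toEuclidean {x x' : E}
    (h : ∀ y : E, inner ℝ (toEuclidean x) (toEuclidean y) =
      inner ℝ (toEuclidean x') (toEuclidean y)) : x = x' := by
  apply (toEuclidean (E := E)).injective
  refine ext_inner_right ℝ fun v => ?_
  have := h (toEuclidean.symm v)
  simpa using this

theorem isUnit_of_forall_eq_zero {A : E →L[ℝ] E} (h : ∀ x, A x = 0 → x = 0) : IsUnit A := by
  have : CompleteSpace E := FiniteDimensional.complete ℝ E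
  rw [ContinuousLinearMap.isUnit_iff_bijective]
  have hi : Function.Injective (A : E →ₗ[ℝ] E) := (injective_iff_map_eq_zero _).2 h
  exact ⟨hi, LinearMap.injective_iff_surjective.1 hi⟩

theorem continuousAt_ringInverse {A : E →L[ℝ] E} (h : IsUnit A) :
    ContinuousAt (Ring.inverse : (E →L[ℝ] E) → (E →L[ℝ] E)) A := by
  have : CompleteSpace E := FiniteDimensional.complete ℝ E
  obtain ⟨u, rfl⟩ := h
  exact NormedRing.inverse_continuousAt u

theorem isOpen_isUnit_clm : IsOpen {A : E →L[ℝ] E | IsUnit A} := by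
  have : CompleteSpace E := FiniteDimensional.complete ℝ E
  exact Units.isOpen

theorem isUnit_add_adjOp_sub_one {Q : E →L[ℝ] E} (hQ : Q * Q = Q) :
    IsUnit (Q + adjOp Q - 1) := by
  refine isUnit_of_forall_eq_zero fun x hx => ?_
  have hx' : Q x + adjOp Q x = x := by
    rwa [_root_.sub_apply, _root_.add_apply,
      one_apply_eq_self, sub_eq_zero] at hx
  have hQQ : ∀ y, Q (Q y) = Q y := fun y => by
    conv_rhs => rw [← hQ]
    rfl
  have h1 : inner ℝ (toEuclidean x) (toEuclidean (Q x)) =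
      inner ℝ (toEuclidean (Q x)) (toEuclidean (Q x)) +
        inner ℝ (toEuclidean x) (toEuclidean (Q x)) := by
    have : toEuclidean x = toEuclidean (Q x) + toEuclidean (adjOp Q x) := by rw [← map_add, hx']
    conv_lhs => rw [this]
    rw [inner_add_left, adjOp_inner, hQQ]
  have h2 : Q x = 0 := by
    have : inner ℝ (toEuclidean (Q x)) (toEuclidean (Q x)) = 0 := by linarith
    simpa using inner_self_eq_zero.1 this
  rw [h2, zero_add] at hx'
  have h3 : inner ℝ (toEuclidean x) (toEuclidean x) = 0 := by
    conv_lhs => rw [← hx']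
    rw [adjOp_inner, hx', h2]; simp
  simpa using inner_self_eq_zero.1 h3

theorem projOp_eq_of_idem {Q : E →L[ℝ] E} (hQ : Q * Q = Q) {L : Submodule ℝ E}
    (hL : LinearMap.range (Q : E →ₗ[ℝ] E) = L) :
    projOp L = Q * Ring.inverse (Q + adjOp Q - 1) := by
  have hu := isUnit_add_adjOp_sub_one hQ
  have h : projOp L * (Q + adjOp Q - 1) = Q := by
    ext x
    have e1 : projOp L (Q x) = Q x := projOp_of_mem (hL ▸ ⟨x, rfl⟩)
    have e2 : projOp L (adjOp Q x) = projOp L x := by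
      apply eq_of_inner_toEuclidean
      intro y
      rw [projOp_symm, adjOp_inner, projOp_symm]
      congr 2
      obtain ⟨z, hz⟩ : projOp L y ∈ LinearMap.range (Q : E →ₗ[ℝ] E) := hL ▸ projOp_mem L y
      rw [← hz]
      exact congrArg (fun B : E →L[ℝ] E => B z) hQ
    simp only [mul_apply_eq_comp, _root_.sub_apply,
      _root_.add_apply, one_apply_eq_self, map_sub, map_add, e1, e2]
    abel
  rw [← Ring.eq_mul_inverse_iff_mul_eq _ _ _ hu] at h
  exact h

variable (ω : BilinForm ℝ E)

/-- The Lagrangian Grassmannian. -/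
def Lag := {L : Submodule ℝ E // IsLagrangian ω L}

noncomputable instance : TopologicalSpace (Lag ω) :=
  TopologicalSpace.induced (fun L => projOp L.1) inferInstance

variable {ω}

theorem continuous_projOp : Continuous (fun L : Lag ω => projOp L.1) := continuous_induced_dom

theorem lag_continuousAt_of_idem {Y : Type*} [TopologicalSpace Y] {f : Y → Lag ω}
    {Q : Y → E →L[ℝ] E} {y : Y} (hQ : ContinuousAt Q y)
    (h : ∀ᶠ z in 𝓝 y, Q z * Q z = Q z ∧ LinearMap.range (Q z : E →ₗ[ℝ] E) = (f z).1) :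
    ContinuousAt f y := by
  rw [Topology.IsInducing.continuousAt_iff (Topology.IsInducing.mk rfl :
    Topology.IsInducing (fun L : Lag ω => projOp L.1))]
  have hy := h.self_of_nhds
  have hc : ContinuousAt (fun z => Q z * Ring.inverse (Q z + adjOp (Q z) - 1)) y := by
    refine hQ.mul (ContinuousAt.comp' (continuousAt_ringInverse
      (isUnit_add_adjOp_sub_one hy.1)) ?_)
    exact (hQ.add (continuous_adjOp.continuousAt.comp' hQ)).sub continuousAt_const
  refine hc.congr ?_
  filter_upwards [h] with z hz
  exact (projOp_eq_of_idem hz.1 hz.2).symm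

theorem projOp_range (L : Submodule ℝ E) : LinearMap.range (projOp L : E →ₗ[ℝ] E) = L := by
  ext x
  constructor
  · rintro ⟨y, rfl⟩
    exact projOp_mem L y
  · intro hx
    exact ⟨x, projOp_of_mem hx⟩

theorem projOp_idem (L : Submodule ℝ E) : projOp L * projOp L = projOp L := by
  ext x
  exact projOp_of_mem (projOp_mem L x)

/-- The projection onto `L` along `M`, if these are complementary. -/
noncomputable def chartProj (L M : Submodule ℝ E) : E →L[ℝ] E :=
  projOp L * Ring.inverse (projOp L + projOp M)

theorem isUnit_projOp_add {L M : Submodule ℝ E} (h : IsCompl L M) :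
    IsUnit (projOp L + projOp M) := by
  refine isUnit_of_forall_eq_zero fun x hx => ?_
  have hx' : projOp L x + projOp M x = 0 := hx
  have h1 : projOp L x = 0 := by
    have : projOp L x ∈ L ⊓ M := by
      refine ⟨projOp_mem L x, ?_⟩
      rw [eq_neg_of_add_eq_zero_left hx']
      exact M.neg_mem (projOp_mem M x)
    rwa [h.inf_eq_bot, Submodule.mem_bot] at this
  have h2 : projOp M x = 0 := by rwa [h1, zero_add] at hx'
  apply eq_of_inner_toEuclidean
  intro y
  obtain ⟨l, hl, m, hm, rfl⟩ := Submodule.mem_sup.1 (h.sup_eq_top ▸ Submodule.mem_top : y ∈ L ⊔ M)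
  rw [← projOp_of_mem hl, ← projOp_of_mem hm, map_add, inner_add_right, ← projOp_symm,
    ← projOp_symm, h1, h2]
  simp

theorem chartProj_of_mem_left {L M : Submodule ℝ E} (h : IsCompl L M) {x : E} (hx : x ∈ L) :
    chartProj L M x = x ∧ ∀ m ∈ M, chartProj L M m = 0 := by
  have hu := isUnit_projOp_add h
  have key : ∀ y, chartProj L M (projOp L y + projOp M y) = projOp L y := by
    intro y
    have : chartProj L M * (projOp L + projOp M) = projOp L := by
      unfold chartProj
      rw [mul_assoc, Ring.inverse_mul_cancel _ hu, mul_one]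
    exact congrArg (fun B : E →L[ℝ] E => B y) this
  have hsurj : ∀ z, ∃ y, projOp L y + projOp M y = z := by
    intro z
    refine ⟨Ring.inverse (projOp L + projOp M) z, ?_⟩
    exact congrArg (fun B : E →L[ℝ] E => B z) (Ring.mul_inverse_cancel _ hu)
  constructor
  · obtain ⟨y, hy⟩ := hsurj x
    have hk := key y
    have : projOp M y ∈ L ⊓ M := by
      refine ⟨?_, projOp_mem M y⟩
      rw [← add_sub_cancel_left (projOp L y) (projOp M y), hy]
      exact L.sub_mem hx (projOp_mem L y)
    rw [h.inf_eq_bot, Submodule.mem_bot] at this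
    rw [this, add_zero] at hy
    rwa [this, add_zero, hy] at hk
  · intro m hm
    obtain ⟨y, hy⟩ := hsurj m
    have hk := key y
    have : projOp L y ∈ L ⊓ M := by
      refine ⟨projOp_mem L y, ?_⟩
      rw [← add_sub_cancel_right (projOp L y) (projOp M y), hy]
      exact M.sub_mem hm (projOp_mem M y)
    rw [h.inf_eq_bot, Submodule.mem_bot] at this
    rwa [hy, this] at hk

theorem chartProj_left {L M : Submodule ℝ E} (h : IsCompl L M) {x : E} (hx : x ∈ L) :
    chartProj L M x = x := (chartProj_of_mem_left h hx).1

theorem chartProj_right {L M : Submodule ℝ E} (h : IsCompl L M) {x : E} (hx : x ∈ M) :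
    chartProj L M x = 0 := (chartProj_of_mem_left h L.zero_mem).2 x hx

theorem chartProj_mem {L M : Submodule ℝ E} (x : E) : chartProj L M x ∈ L := projOp_mem L _

theorem sub_chartProj_mem {L M : Submodule ℝ E} (h : IsCompl L M) (x : E) :
    x - chartProj L M x ∈ M := by
  obtain ⟨l, hl, m, hm, rfl⟩ := Submodule.mem_sup.1 (h.sup_eq_top ▸ Submodule.mem_top : x ∈ L ⊔ M)
  rw [map_add, chartProj_left h hl, chartProj_right h hm, add_zero, add_sub_cancel_left]
  exact hm

variable [hω : IsSymplForm ω]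

theorem Lag.isCompl {L M : Lag ω} (h : L.1 ⊓ M.1 = ⊥) : IsCompl L.1 M.1 := L.2.isCompl M.2 h

theorem continuousAt_chartProj {Y : Type*} [TopologicalSpace Y] {f g : Y → Lag ω} {y : Y}
    (hf : ContinuousAt f y) (hg : ContinuousAt g y) (h : (f y).1 ⊓ (g y).1 = ⊥) :
    ContinuousAt (fun z => chartProj (f z).1 (g z).1) y := by
  unfold chartProj
  have hf' := (continuous_projOp (ω := ω)).continuousAt.comp' hf
  have hg' := (continuous_projOp (ω := ω)).continuousAt.comp' hg
  exact hf'.mul (ContinuousAt.comp' (continuousAt_ringInverse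
    (isUnit_projOp_add (Lag.isCompl h))) (hf'.add hg'))

theorem transv_iff_isUnit (L M : Lag ω) : L.1 ⊓ M.1 = ⊥ ↔ IsUnit (projOp L.1 + projOp M.1) := by
  refine ⟨fun h => isUnit_projOp_add (Lag.isCompl h), fun h => ?_⟩
  have hsup : L.1 ⊔ M.1 = ⊤ := by
    rw [eq_top_iff]
    intro z _
    have : (projOp L.1 + projOp M.1) (Ring.inverse (projOp L.1 + projOp M.1) z) = z :=
      congrArg (fun B : E →L[ℝ] E => B z) (Ring.mul_inverse_cancel _ h)
    rw [← this]
    exact Submodule.add_mem_sup (projOp_mem _ _) (projOp_mem _ _)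
  have h1 := Submodule.finrank_sup_add_finrank_inf_eq L.1 M.1
  rw [hsup, finrank_top, L.2.finrank_add_self, L.2.finrank_eq M.2] at h1
  exact Submodule.finrank_eq_zero.1 (by omega)

theorem isOpen_transv : IsOpen {p : Lag ω × Lag ω | p.1.1 ⊓ p.2.1 = ⊥} := by
  have : {p : Lag ω × Lag ω | p.1.1 ⊓ p.2.1 = ⊥} =
      (fun p : Lag ω × Lag ω => projOp p.1.1 + projOp p.2.1) ⁻¹' {A | IsUnit A} := by
    ext p
    exact transv_iff_isUnit p.1 p.2
  rw [this]
  refine isOpen_isUnit_clm.preimage ?_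
  exact (continuous_projOp.comp continuous_fst).add (continuous_projOp.comp continuous_snd)

/-- The linear conditions describing the projections along `M` onto Lagrangian subspaces. -/
structure IsChartProj (ω : BilinForm ℝ E) (M : Submodule ℝ E) (A : E →L[ℝ] E) : Prop where
  map_eq_zero : ∀ m ∈ M, A m = 0
  sub_mem : ∀ x, x - A x ∈ M
  symp : ∀ x y, ω (A x) y + ω x (A y) = ω x y

theorem isChartProj_chartProj {L M : Lag ω} (h : L.1 ⊓ M.1 = ⊥) :
    IsChartProj ω M.1 (chartProj L.1 M.1) where
  map_eq_zero _ hm := chartProj_right (Lag.isCompl h) hm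
  sub_mem := sub_chartProj_mem (Lag.isCompl h)
  symp x y := by
    have e1 := M.2.apply (sub_chartProj_mem (Lag.isCompl h) x) (sub_chartProj_mem (Lag.isCompl h) y)
    have e2 := L.2.apply (chartProj_mem (L := L.1) (M := M.1) x)
      (chartProj_mem (L := L.1) (M := M.1) y)
    simp only [map_sub, LinearMap.sub_apply] at e1
    linarith

namespace IsChartProj

variable {M : Lag ω} {A B : E →L[ℝ] E}

theorem idem (h : IsChartProj ω M.1 A) : A * A = A := by
  ext x
  have := h.map_eq_zero _ (h.sub_mem x)
  rw [map_sub, sub_eq_zero] at this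
  exact this.symm

theorem ker (h : IsChartProj ω M.1 A) : LinearMap.ker (A : E →ₗ[ℝ] E) = M.1 := by
  ext x
  constructor
  · intro hx
    have := h.sub_mem x
    rwa [show A x = 0 from hx, sub_zero] at this
  · exact h.map_eq_zero x

theorem isLagrangian (h : IsChartProj ω M.1 A) :
    IsLagrangian ω (LinearMap.range (A : E →ₗ[ℝ] E)) := by
  apply isLagrangian_of_isotropic
  · rintro _ ⟨x, rfl⟩ _ ⟨y, rfl⟩
    have e := h.symp (A x) (A y)
    have i := fun z => congrArg (fun B : E →L[ℝ] E => B z) h.idem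
    simp only [mul_apply_eq_comp] at i
    rw [i, i] at e
    change ω (A x) (A y) = 0
    linarith
  · have h1 := LinearMap.finrank_range_add_finrank_ker (A : E →ₗ[ℝ] E)
    rw [h.ker] at h1
    have := M.2.finrank_add_self
    omega

theorem range_inf (h : IsChartProj ω M.1 A) : LinearMap.range (A : E →ₗ[ℝ] E) ⊓ M.1 = ⊥ := by
  rw [Submodule.eq_bot_iff]
  rintro _ ⟨⟨x, rfl⟩, hx⟩
  have i := congrArg (fun B : E →L[ℝ] E => B x) h.idem
  exact i.symm.trans (h.map_eq_zero _ hx)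

theorem combo (hA : IsChartProj ω M.1 A) (hB : IsChartProj ω M.1 B) (s : ℝ) :
    IsChartProj ω M.1 ((1 - s) • A + s • B) where
  map_eq_zero m hm := by simp [hA.map_eq_zero m hm, hB.map_eq_zero m hm]
  sub_mem x := by
    have : x - ((1 - s) • A + s • B) x = (1 - s) • (x - A x) + s • (x - B x) := by
      simp only [_root_.add_apply, _root_.smul_apply]
      module
    rw [this]
    exact M.1.add_mem (M.1.smul_mem _ (hA.sub_mem x)) (M.1.smul_mem _ (hB.sub_mem x))
  symp x y := by
    have e1 := hA.symp x y
    have e2 := hB.symp x y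
    simp only [_root_.add_apply, _root_.smul_apply, map_add, map_smul,
      LinearMap.add_apply, LinearMap.smul_apply, smul_eq_mul]
    linear_combination (1 - s) * e1 + s * e2

/-- The Lagrangian subspace with a given chart projection. -/
def lag (h : IsChartProj ω M.1 A) : Lag ω := ⟨_, h.isLagrangian⟩

theorem lag_inf (h : IsChartProj ω M.1 A) : h.lag.1 ⊓ M.1 = ⊥ := h.range_inf

end IsChartProj

theorem chartProj_range {L M : Lag ω} (h : L.1 ⊓ M.1 = ⊥) :
    LinearMap.range (chartProj L.1 M.1 : E →ₗ[ℝ] E) = L.1 := by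
  ext x
  constructor
  · rintro ⟨y, rfl⟩
    exact chartProj_mem y
  · intro hx
    exact ⟨x, chartProj_left (Lag.isCompl h) hx⟩

theorem exists_transv (S : Finset (Lag ω)) : ∃ M : Lag ω, ∀ L ∈ S, M.1 ⊓ L.1 = ⊥ := by
  classical
  obtain ⟨M, hM, h⟩ := exists_common_transversal (ω := ω) (S.image Subtype.val) (by
    intro L hL
    obtain ⟨L', -, rfl⟩ := Finset.mem_image.1 hL
    exact L'.2)
  exact ⟨⟨M, hM⟩, fun L hL => h _ (Finset.mem_image_of_mem _ hL)⟩

/-- Linear symplectic maps. -/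
def IsSymp (ω : BilinForm ℝ E) (g : E →L[ℝ] E) : Prop := ∀ x y, ω (g x) (g y) = ω x y

theorem IsSymp.isUnit {g : E →L[ℝ] E} (hg : IsSymp ω g) : IsUnit g := by
  refine isUnit_of_forall_eq_zero fun x hx => symp_eq_zero (ω := ω) fun y => ?_
  rw [← hg x y, hx]; simp

theorem IsSymp.injective {g : E →L[ℝ] E} (hg : IsSymp ω g) : Function.Injective g := by
  have : CompleteSpace E := FiniteDimensional.complete ℝ E
  exact (ContinuousLinearMap.isUnit_iff_bijective.1 hg.isUnit).1

/-- The image of a Lagrangian subspace under a symplectic map. -/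
def IsSymp.act {g : E →L[ℝ] E} (hg : IsSymp ω g) (L : Lag ω) : Lag ω :=
  ⟨L.1.map (g : E →ₗ[ℝ] E), by
    apply isLagrangian_of_isotropic
    · rintro _ ⟨x, hx, rfl⟩ _ ⟨y, hy, rfl⟩
      exact (hg x y).trans (L.2.apply hx hy)
    · rw [← (Submodule.equivMapOfInjective (g : E →ₗ[ℝ] E) hg.injective L.1).finrank_eq,
        L.2.finrank_add_self]⟩

theorem continuous_act {Y : Type*} [TopologicalSpace Y] {g : Y → E →L[ℝ] E}
    (hgc : Continuous g) (hg : ∀ y, IsSymp ω (g y)) {f : Y → Lag ω} (hf : Continuous f) :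
    Continuous fun y => (hg y).act (f y) := by
  rw [continuous_iff_continuousAt]
  intro y
  refine lag_continuousAt_of_idem (Q := fun y => g y * projOp (f y).1 * Ring.inverse (g y)) ?_ ?_
  · exact (hgc.continuousAt.mul (continuous_projOp.comp hf).continuousAt).mul
      (ContinuousAt.comp' (continuousAt_ringInverse (hg y).isUnit) hgc.continuousAt)
  · refine Eventually.of_forall fun z => ⟨?_, ?_⟩
    · have e := Ring.inverse_mul_cancel _ (hg z).isUnit
      calc g z * projOp (f z).1 * Ring.inverse (g z) * (g z * projOp (f z).1 * Ring.inverse (g z))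
          = g z * projOp (f z).1 * (Ring.inverse (g z) * g z) * projOp (f z).1 *
              Ring.inverse (g z) := by simp only [mul_assoc]
        _ = g z * (projOp (f z).1 * projOp (f z).1) * Ring.inverse (g z) := by
            rw [e]; simp only [mul_assoc, one_mul]
        _ = _ := by rw [projOp_idem]
    · ext x
      constructor
      · rintro ⟨w, rfl⟩
        exact ⟨_, projOp_mem (f z).1 (Ring.inverse (g z) w), rfl⟩
      · rintro ⟨w, hw, rfl⟩
        refine ⟨g z w, ?_⟩
        change g z (projOp (f z).1 (Ring.inverse (g z) (g z w))) = g z w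
        have : Ring.inverse (g z) (g z w) = w :=
          congrArg (fun B : E →L[ℝ] E => B w) (Ring.inverse_mul_cancel _ (hg z).isUnit)
        rw [this, projOp_of_mem hw]

theorem IsSymp.act_inf {g : E →L[ℝ] E} (hg : IsSymp ω g) (L M : Lag ω) :
    (hg.act L).1 ⊓ (hg.act M).1 = (L.1 ⊓ M.1).map (g : E →ₗ[ℝ] E) :=
  (Submodule.map_inf _ hg.injective).symm

theorem IsSymp.finrank_act_inf {g : E →L[ℝ] E} (hg : IsSymp ω g) (L M : Lag ω) :
    finrank ℝ ↥((hg.act L).1 ⊓ (hg.act M).1) = finrank ℝ ↥(L.1 ⊓ M.1) := by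
  rw [hg.act_inf, ← (Submodule.equivMapOfInjective (g : E →ₗ[ℝ] E) hg.injective _).finrank_eq]

theorem IsSymp.act_transv {g : E →L[ℝ] E} (hg : IsSymp ω g) {L M : Lag ω} (h : L.1 ⊓ M.1 = ⊥) :
    (hg.act L).1 ⊓ (hg.act M).1 = ⊥ := by
  rw [hg.act_inf, h, Submodule.map_bot]

end LagrangianGrassmannian

section Signature

open Module Submodule Filter Topology QuadraticForm QuadraticMap

section Forms

variable {V W : Type*} [AddCommGroup V] [Module ℝ V] [FiniteDimensional ℝ V]
  [AddCommGroup W] [Module ℝ W] [FiniteDimensional ℝ W]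

/-- The signature of a real quadratic form. -/
noncomputable def qsig (Q : QuadraticForm ℝ V) : ℤ := sigPos Q - sigNeg Q

theorem posIndex_eq_sigPos (Q : QuadraticForm ℝ V) : posIndex Q = sigPos Q := by
  have h := sigPos_isGreatest Q
  have hset : {d : ℕ | ∃ W : Submodule ℝ V, Module.finrank ℝ W = d ∧ ∀ x ∈ W, x ≠ 0 → 0 < Q x} =
      {r | ∃ V' : Submodule ℝ V, Module.finrank ℝ V' = r ∧ (Q.restrict V').PosDef} := by
    ext d
    refine exists_congr fun U => and_congr_right fun _ => ?_
    constructor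
    · intro hU x hx
      exact hU x x.2 (by simpa using hx)
    · intro hU x hx hx0
      exact hU ⟨x, hx⟩ (by simpa using hx0)
  unfold posIndex
  rw [hset]
  exact h.csSup_eq

theorem le_sigPos {Q : QuadraticForm ℝ V} {U : Submodule ℝ V}
    (h : ∀ x ∈ U, x ≠ 0 → 0 < Q x) : finrank ℝ U ≤ sigPos Q :=
  le_sigPos_of_posDef Q fun x hx => h x x.2 (by simpa using hx)

theorem exists_sigPos (Q : QuadraticForm ℝ V) :
    ∃ U : Submodule ℝ V, finrank ℝ U = sigPos Q ∧ ∀ x ∈ U, x ≠ 0 → 0 < Q x := by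
  obtain ⟨U, h, hU⟩ := exists_finrank_eq_sigPos_and_posDef Q
  exact ⟨U, h, fun x hx hx0 => hU ⟨x, hx⟩ (by simpa using hx0)⟩

theorem sigPos_comp (Q : QuadraticForm ℝ W) {f : V →ₗ[ℝ] W} (hf : Function.Surjective f) :
    sigPos (Q.comp f) = sigPos Q := by
  apply le_antisymm
  · obtain ⟨U, h, hU⟩ := exists_sigPos (Q.comp f)
    have hinj : Function.Injective (f.domRestrict U) := by
      rw [injective_iff_map_eq_zero]
      intro x hx
      by_contra hne
      have := hU x x.2 (by simpa using hne)
      rw [QuadraticMap.comp_apply, show f x = 0 from hx] at this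
      simp at this
    rw [← h, ← LinearMap.finrank_range_of_inj hinj]
    apply le_sigPos
    rintro _ ⟨x, rfl⟩ hx0
    refine hU x x.2 fun h0 => hx0 ?_
    rw [LinearMap.domRestrict_apply, h0, map_zero]
  · obtain ⟨U, h, hU⟩ := exists_sigPos Q
    obtain ⟨g, hg⟩ := f.exists_rightInverse_of_surjective (LinearMap.range_eq_top.2 hf)
    have hfg : ∀ x, f (g x) = x := fun x => congrArg (fun l => l x) hg
    have hgi : Function.Injective g := Function.LeftInverse.injective hfg
    rw [← h, (Submodule.equivMapOfInjective g hgi U).finrank_eq]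
    apply le_sigPos
    rintro _ ⟨x, hx, rfl⟩ hx0
    rw [QuadraticMap.comp_apply, hfg]
    exact hU x hx fun h0 => hx0 (by rw [h0, map_zero])

theorem sigNeg_comp (Q : QuadraticForm ℝ W) {f : V →ₗ[ℝ] W} (hf : Function.Surjective f) :
    sigNeg (Q.comp f) = sigNeg Q := by
  rw [← sigPos_neg, ← sigPos_neg, ← sigPos_comp (-Q) hf]
  rfl

theorem qsig_comp (Q : QuadraticForm ℝ W) {f : V →ₗ[ℝ] W} (hf : Function.Surjective f) :
    qsig (Q.comp f) = qsig Q := by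
  rw [qsig, qsig, sigPos_comp Q hf, sigNeg_comp Q hf]

theorem qsig_neg (Q : QuadraticForm ℝ V) : qsig (-Q) = - qsig Q := by
  rw [qsig, qsig, sigPos_neg, sigNeg_neg]; ring

theorem finrank_submodule_prod (U : Submodule ℝ V) (U' : Submodule ℝ W) :
    finrank ℝ (U.prod U') = finrank ℝ U + finrank ℝ U' := by
  have h : LinearMap.range (U.subtype.prodMap U'.subtype) = U.prod U' := by
    rw [LinearMap.range_prodMap, Submodule.range_subtype, Submodule.range_subtype]
  rw [← h, LinearMap.finrank_range_of_inj, Module.finrank_prod]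
  exact Function.Injective.prodMap U.injective_subtype U'.injective_subtype

theorem sigPos_prod_ge (Q : QuadraticForm ℝ V) (R : QuadraticForm ℝ W) :
    sigPos Q + sigPos R ≤ sigPos (Q.prod R) := by
  obtain ⟨U, h, hU⟩ := exists_sigPos Q
  obtain ⟨U', h', hU'⟩ := exists_sigPos R
  rw [← h, ← h', ← finrank_submodule_prod]
  apply le_sigPos
  rintro ⟨x, y⟩ ⟨hx, hy⟩ hne
  rw [QuadraticMap.prod_apply]
  by_cases hx0 : x = 0
  · by_cases hy0 : y = 0
    · exact absurd (by rw [hx0, hy0]; rfl) hne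
    · simpa [hx0] using hU' y hy hy0
  · by_cases hy0 : y = 0
    · simpa [hy0] using hU x hx hx0
    · exact add_pos (hU x hx hx0) (hU' y hy hy0)

theorem qsig_prod (Q : QuadraticForm ℝ V) (R : QuadraticForm ℝ W) :
    qsig (Q.prod R) = qsig Q + qsig R := by
  have h1 := sigPos_prod_ge Q R
  have h2 := sigPos_prod_ge (-Q) (-R)
  have h3 : (-Q).prod (-R) = -(Q.prod R) := by
    ext x; simp; ring
  rw [h3, sigPos_neg, sigPos_neg, sigPos_neg] at h2
  have e1 := sigPos_add_sigNeg_add_radical (Q := Q)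
  have e2 := sigPos_add_sigNeg_add_radical (Q := R)
  have e3 := sigPos_add_sigNeg_add_radical (Q := Q.prod R)
  have h4 : finrank ℝ Q.radical + finrank ℝ R.radical ≤ finrank ℝ (Q.prod R).radical := by
    rw [← finrank_submodule_prod]
    apply Submodule.finrank_mono
    rintro ⟨x, y⟩ ⟨hx, hy⟩
    rw [SetLike.mem_coe, mem_radical_iff'] at hx hy
    rw [mem_radical_iff']
    refine ⟨by simp [hx.1, hy.1], ?_⟩
    rintro ⟨z, w⟩
    simp [hx.2, hy.2]
  rw [Module.finrank_prod] at e3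
  unfold qsig
  omega

theorem finrank_le_of_eventually_pos {Y : Type*} [TopologicalSpace Y] {V : Type*}
    [NormedAddCommGroup V] [NormedSpace ℝ V] [FiniteDimensional ℝ V]
    {Q : Y → QuadraticForm ℝ V} {y : Y}
    (hQ : ∀ v, ContinuousAt (fun p : Y × V => Q p.1 p.2) (y, v)) :
    ∀ᶠ z in 𝓝 y, sigPos (Q y) ≤ sigPos (Q z) := by
  obtain ⟨U, h, hU⟩ := exists_sigPos (Q y)
  have hK : IsCompact ((U : Set V) ∩ Metric.sphere 0 1) :=
    (isCompact_sphere (0 : V) 1).inter_left U.closed_of_finiteDimensional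
  have hev : ∀ᶠ z in 𝓝 y, ∀ v ∈ (U : Set V) ∩ Metric.sphere 0 1, 0 < Q z v := by
    apply hK.eventually_forall_of_forall_eventually
    rintro v ⟨hvU, hv⟩
    have hv0 : v ≠ 0 := by
      rintro rfl
      simp at hv
    exact (hQ v).eventually (lt_mem_nhds (hU v hvU hv0))
  filter_upwards [hev] with z hz
  rw [← h]
  apply le_sigPos
  intro x hx hx0
  have hn : ‖x‖ ≠ 0 := norm_ne_zero_iff.2 hx0
  have h1 := hz (‖x‖⁻¹ • x) ⟨U.smul_mem _ hx, by simp [norm_smul, hn]⟩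
  rw [QuadraticMap.map_smul, smul_eq_mul] at h1
  exact pos_of_mul_pos_right h1 (mul_self_nonneg _)

theorem qsig_eventually_eq {Y : Type*} [TopologicalSpace Y] {V : Type*}
    [NormedAddCommGroup V] [NormedSpace ℝ V] [FiniteDimensional ℝ V]
    {Q : Y → QuadraticForm ℝ V} {y : Y} (hQ : ∀ v, ContinuousAt (fun p : Y × V => Q p.1 p.2) (y, v))
    (hr : ∀ᶠ z in 𝓝 y, sigPos (Q z) + sigNeg (Q z) = sigPos (Q y) + sigNeg (Q y)) :
    ∀ᶠ z in 𝓝 y, qsig (Q z) = qsig (Q y) := by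
  have h2 := finrank_le_of_eventually_pos (Q := fun y => - Q y) (y := y) fun v => (hQ v).neg
  filter_upwards [finrank_le_of_eventually_pos hQ, h2, hr] with z h1 h2 h3
  rw [sigPos_neg, sigPos_neg] at h2
  unfold qsig
  omega

end Forms

variable [FiniteDimensional ℝ E] (ω : BilinForm ℝ E)

/-- The bilinear form on `L1 × L2 × L3` underlying `tripleQ`. -/
noncomputable def tripleBilin (L1 L2 L3 : Submodule ℝ E) : BilinForm ℝ (L1 × L2 × L3) :=
  LinearMap.mk₂ ℝ (fun x y => ω x.1 y.2.1 + ω x.2.1 y.2.2 + ω x.2.2 y.1)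
    (fun x x' y => by simp; ring) (fun c x y => by simp; ring)
    (fun x y y' => by simp; ring) (fun c x y => by simp; ring)

/-- `tripleQ` as a quadratic form. -/
noncomputable def tripleForm (L1 L2 L3 : Submodule ℝ E) : QuadraticForm ℝ (L1 × L2 × L3) :=
  LinearMap.BilinMap.toQuadraticMap (tripleBilin ω L1 L2 L3)

theorem tripleForm_apply (L1 L2 L3 : Submodule ℝ E) (v : L1 × L2 × L3) :
    tripleForm ω L1 L2 L3 v = ω v.1 v.2.1 + ω v.2.1 v.2.2 + ω v.2.2 v.1 := rfl

theorem tripleSig_eq_qsig (L1 L2 L3 : Submodule ℝ E) :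
    tripleSig ω L1 L2 L3 = qsig (tripleForm ω L1 L2 L3) := by
  unfold tripleSig qsig
  rw [← posIndex_eq_sigPos, ← sigPos_neg, ← posIndex_eq_sigPos]
  rfl

variable {ω} [hω : IsSymplForm ω]

theorem tripleForm_rank (L1 L2 L3 : Lag ω) :
    sigPos (tripleForm ω L1.1 L2.1 L3.1) + sigNeg (tripleForm ω L1.1 L2.1 L3.1) +
      (finrank ℝ ↥(L1.1 ⊓ L2.1) + finrank ℝ ↥(L2.1 ⊓ L3.1) + finrank ℝ ↥(L3.1 ⊓ L1.1)) =
      finrank ℝ L1.1 + finrank ℝ L2.1 + finrank ℝ L3.1 := by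
  have key := sigPos_add_sigNeg_add_radical (Q := tripleForm ω L1.1 L2.1 L3.1)
  let f : (↥(L1.1 ⊓ L2.1) × ↥(L2.1 ⊓ L3.1) × ↥(L3.1 ⊓ L1.1)) →ₗ[ℝ] (L1.1 × L2.1 × L3.1) :=
    { toFun := fun p => (⟨p.1 + p.2.2, L1.1.add_mem p.1.2.1 p.2.2.2.2⟩,
        ⟨p.1 + p.2.1, L2.1.add_mem p.1.2.2 p.2.1.2.1⟩,
        ⟨p.2.1 + p.2.2, L3.1.add_mem p.2.1.2.2 p.2.2.2.1⟩)
      map_add' := fun p q => by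
        refine Prod.ext ?_ (Prod.ext ?_ ?_) <;> apply Subtype.ext <;> simp <;> abel
      map_smul' := fun c p => by
        refine Prod.ext ?_ (Prod.ext ?_ ?_) <;> apply Subtype.ext <;> simp }
  have hinj : Function.Injective f := by
    rw [injective_iff_map_eq_zero]
    rintro ⟨a, b, c⟩ h
    have h1 : (a : E) + c = 0 := congrArg (fun v : L1.1 × L2.1 × L3.1 => (v.1 : E)) h
    have h2 : (a : E) + b = 0 := congrArg (fun v : L1.1 × L2.1 × L3.1 => (v.2.1 : E)) h
    have h3 : (b : E) + c = 0 := congrArg (fun v : L1.1 × L2.1 × L3.1 => (v.2.2 : E)) h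
    have ha : (a : E) = 0 := by
      have : (2 : ℝ) • (a : E) = (a + c) + (a + b) - (b + c) := by module
      rw [h1, h2, h3] at this
      simpa using this
    rw [ha, zero_add] at h1 h2
    exact Prod.ext (Subtype.ext ha) (Prod.ext (Subtype.ext h2) (Subtype.ext h1))
  have hrange : LinearMap.range f = (tripleForm ω L1.1 L2.1 L3.1).radical := by
    rw [radical_eq_ker_polarBilin]
    have hpol : ∀ x y, (tripleForm ω L1.1 L2.1 L3.1).polarBilin x y =
        ω x.1 y.2.1 + ω x.2.1 y.2.2 + ω x.2.2 y.1 +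
          (ω y.1 x.2.1 + ω y.2.1 x.2.2 + ω y.2.2 x.1) := by
      intro x y
      simp only [polarBilin_apply_apply, QuadraticMap.polar, tripleForm_apply, Prod.fst_add,
        Prod.snd_add, Submodule.coe_add, map_add, LinearMap.add_apply]
      ring
    ext x
    constructor
    · rintro ⟨⟨a, b, c⟩, rfl⟩
      rw [LinearMap.mem_ker]
      refine LinearMap.ext fun y => ?_
      rw [hpol, LinearMap.zero_apply]
      have e1 := L2.2.apply a.2.2 y.2.1.2
      have e2 := L3.2.apply b.2.2 y.2.2.2
      have e3 := L1.2.apply c.2.2 y.1.2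
      have e4 := L1.2.apply y.1.2 a.2.1
      have e5 := L2.2.apply y.2.1.2 b.2.1
      have e6 := L3.2.apply y.2.2.2 c.2.1
      have e7 := symp_swap ω a y.2.2
      have e8 := symp_swap ω b y.1
      have e9 := symp_swap ω c y.2.1
      simp only [f, LinearMap.coe_mk, AddHom.coe_mk, map_add, LinearMap.add_apply]
      linarith
    · intro hx
      have hx' : ∀ y : L1.1 × L2.1 × L3.1, ω x.1 y.2.1 + ω x.2.1 y.2.2 + ω x.2.2 y.1 +
          (ω y.1 x.2.1 + ω y.2.1 x.2.2 + ω y.2.2 x.1) = 0 := fun y => by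
        rw [← hpol x y]
        exact congrArg (fun l => l y) hx
      have m1 : (x.2.1 : E) - x.2.2 ∈ L1.1 := by
        refine L1.2.mem fun n hn => ?_
        have := hx' (⟨n, hn⟩, 0, 0)
        simp [symp_swap ω x.2.2 n] at this ⊢
        linarith
      have m2 : (x.2.2 : E) - x.1 ∈ L2.1 := by
        refine L2.2.mem fun n hn => ?_
        have := hx' (0, ⟨n, hn⟩, 0)
        simp [symp_swap ω x.1 n] at this ⊢
        linarith
      have m3 : (x.1 : E) - x.2.1 ∈ L3.1 := by
        refine L3.2.mem fun n hn => ?_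
        have := hx' (0, 0, ⟨n, hn⟩)
        simp [symp_swap ω x.2.1 n] at this ⊢
        linarith
      have n1 : (x.1 : E) + x.2.1 - x.2.2 ∈ L1.1 ⊓ L2.1 := by
        refine ⟨?_, ?_⟩
        · rw [add_sub_assoc]
          exact L1.1.add_mem x.1.2 m1
        · have e : (x.1 : E) + x.2.1 - x.2.2 = x.2.1 - (x.2.2 - x.1) := by abel
          exact e ▸ L2.1.sub_mem x.2.1.2 m2
      have n2 : (x.2.1 : E) + x.2.2 - x.1 ∈ L2.1 ⊓ L3.1 := by
        refine ⟨?_, ?_⟩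
        · rw [add_sub_assoc]
          exact L2.1.add_mem x.2.1.2 m2
        · have e : (x.2.1 : E) + x.2.2 - x.1 = x.2.2 - (x.1 - x.2.1) := by abel
          exact e ▸ L3.1.sub_mem x.2.2.2 m3
      have n3 : (x.2.2 : E) + x.1 - x.2.1 ∈ L3.1 ⊓ L1.1 := by
        refine ⟨?_, ?_⟩
        · rw [add_sub_assoc]
          exact L3.1.add_mem x.2.2.2 m3
        · have e : (x.2.2 : E) + x.1 - x.2.1 = x.1 - (x.2.1 - x.2.2) := by abel
          exact e ▸ L1.1.sub_mem x.1.2 m1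
      refine ⟨((2⁻¹ : ℝ) • ⟨_, n1⟩, (2⁻¹ : ℝ) • ⟨_, n2⟩, (2⁻¹ : ℝ) • ⟨_, n3⟩), ?_⟩
      refine Prod.ext ?_ (Prod.ext ?_ ?_) <;> apply Subtype.ext <;>
        simp only [f, LinearMap.coe_mk, AddHom.coe_mk, Submodule.coe_smul] <;> module
  have h3 := LinearMap.finrank_range_of_inj hinj
  rw [hrange] at h3
  simp only [Module.finrank_prod] at h3 key
  omega

/-- The symmetric form comparing two Lagrangian subspaces in the chart transversal to `M`. -/
noncomputable def chartForm (M A B : Lag ω) : QuadraticForm ℝ E :=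
  LinearMap.BilinMap.toQuadraticMap
    (ω.compl₂ (chartProj B.1 M.1 - chartProj A.1 M.1 : E →ₗ[ℝ] E))

theorem chartForm_apply (M A B : Lag ω) (x : E) :
    chartForm M A B x = ω x (chartProj B.1 M.1 x) - ω x (chartProj A.1 M.1 x) := by
  rw [← map_sub]; rfl

theorem chartForm_swap (M A B : Lag ω) : chartForm M B A = - chartForm M A B := by
  ext x
  rw [neg_apply, chartForm_apply, chartForm_apply]
  ring

theorem tripleSig_eq_chart {M A B C : Lag ω} (hA : M.1 ⊓ A.1 = ⊥) (hB : M.1 ⊓ B.1 = ⊥)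
    (hC : M.1 ⊓ C.1 = ⊥) : tripleSig ω A.1 B.1 C.1 =
      qsig (chartForm M A B) + qsig (chartForm M B C) + qsig (chartForm M C A) := by
  rw [inf_comm] at hA hB hC
  rw [add_assoc, ← qsig_prod, ← qsig_prod, tripleSig_eq_qsig]
  let pr (X : Lag ω) : E →ₗ[ℝ] X.1 := LinearMap.codRestrict X.1
    (chartProj X.1 M.1 : E →ₗ[ℝ] E) fun x => chartProj_mem x
  let f : (E × E × E) →ₗ[ℝ] (A.1 × B.1 × C.1) :=
    ((pr A).comp (LinearMap.snd ℝ E E ∘ₗ LinearMap.snd ℝ E (E × E) + LinearMap.fst ℝ E (E × E))).prod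
    (((pr B).comp (LinearMap.fst ℝ E E ∘ₗ LinearMap.snd ℝ E (E × E) +
        LinearMap.fst ℝ E (E × E))).prod
      ((pr C).comp (LinearMap.fst ℝ E E ∘ₗ LinearMap.snd ℝ E (E × E) +
        LinearMap.snd ℝ E E ∘ₗ LinearMap.snd ℝ E (E × E))))
  have hpr : ∀ (X : Lag ω) (_ : X.1 ⊓ M.1 = ⊥) (x : X.1), pr X x = x := fun X hX x =>
    Subtype.ext (chartProj_left (Lag.isCompl hX) x.2)
  have hf : Function.Surjective f := by
    rintro ⟨x, y, z⟩
    refine ⟨((2⁻¹ : ℝ) • ((x : E) + y - z), (2⁻¹ : ℝ) • ((y : E) + z - x),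
      (2⁻¹ : ℝ) • ((x : E) + z - y)), ?_⟩
    refine Prod.ext ?_ (Prod.ext ?_ ?_)
    · refine Eq.trans (congrArg (pr A) ?_) (hpr A hA x)
      simp; module
    · refine Eq.trans (congrArg (pr B) ?_) (hpr B hB y)
      simp; module
    · refine Eq.trans (congrArg (pr C) ?_) (hpr C hC z)
      simp; module
  rw [← qsig_comp _ hf]
  congr 1
  ext ⟨c, a, b⟩
  have key : ∀ (X Y : Lag ω) (_ : X.1 ⊓ M.1 = ⊥) (_ : Y.1 ⊓ M.1 = ⊥) (x y : E),
      ω (pr X x) (pr Y y) = ω x (chartProj Y.1 M.1 y) - ω x (chartProj X.1 M.1 y) := by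
    intro X Y hX hY x y
    have e1 := X.2.apply (chartProj_mem (L := X.1) (M := M.1) x)
      (chartProj_mem (L := X.1) (M := M.1) y)
    have e2 := M.2.apply (sub_chartProj_mem (Lag.isCompl hX) x)
      (sub_mem (sub_chartProj_mem (Lag.isCompl hX) y) (sub_chartProj_mem (Lag.isCompl hY) y))
    simp only [map_sub, LinearMap.sub_apply] at e2
    change ω (chartProj X.1 M.1 x) (chartProj Y.1 M.1 y) = _
    linarith
  have sym : ∀ (X : Lag ω) (_ : X.1 ⊓ M.1 = ⊥) (x y : E),
      ω x (chartProj X.1 M.1 y) - ω y (chartProj X.1 M.1 x) = ω x y := by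
    intro X hX x y
    have e1 := (isChartProj_chartProj hX).symp x y
    rw [symp_swap ω _ y] at e1
    linarith
  change ω (pr A (b + c)) (pr B (a + c)) + ω (pr B (a + c)) (pr C (a + b)) +
    ω (pr C (a + b)) (pr A (b + c)) = _
  rw [key A B hA hB, key B C hB hC, key C A hC hA]
  simp only [QuadraticMap.prod_apply, chartForm_apply, map_add, LinearMap.add_apply]
  linarith [sym A hA a b, sym A hA a c, sym A hA b c, sym B hB a b, sym B hB a c, sym B hB b c,
    sym C hC a b, sym C hC a c, sym C hC b c]

theorem tripleSig_cocycle (A B C D : Lag ω) :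
    tripleSig ω A.1 B.1 C.1 - tripleSig ω A.1 B.1 D.1 =
      tripleSig ω B.1 C.1 D.1 - tripleSig ω A.1 C.1 D.1 := by
  classical
  obtain ⟨M, hM⟩ := exists_transv {A, B, C, D}
  have hA := hM A (by simp)
  have hB := hM B (by simp)
  have hC := hM C (by simp)
  have hD := hM D (by simp)
  rw [tripleSig_eq_chart hA hB hC, tripleSig_eq_chart hA hB hD, tripleSig_eq_chart hB hC hD,
    tripleSig_eq_chart hA hC hD, chartForm_swap M A C, chartForm_swap M A D,
    chartForm_swap M B D, qsig_neg, qsig_neg, qsig_neg]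
  ring

theorem tripleSig_locally_const {Y : Type*} [TopologicalSpace Y] {A B C : Y → Lag ω} {y : Y}
    (hA : ContinuousAt A y) (hB : ContinuousAt B y) (hC : ContinuousAt C y)
    (hAB : ∀ᶠ z in 𝓝 y, finrank ℝ ↥((A z).1 ⊓ (B z).1) = finrank ℝ ↥((A y).1 ⊓ (B y).1))
    (hBC : ∀ᶠ z in 𝓝 y, finrank ℝ ↥((B z).1 ⊓ (C z).1) = finrank ℝ ↥((B y).1 ⊓ (C y).1))
    (hCA : ∀ᶠ z in 𝓝 y, finrank ℝ ↥((C z).1 ⊓ (A z).1) = finrank ℝ ↥((C y).1 ⊓ (A y).1)) :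
    ∀ᶠ z in 𝓝 y, tripleSig ω (A z).1 (B z).1 (C z).1 = tripleSig ω (A y).1 (B y).1 (C y).1 := by
  let pr (X : Lag ω) : E →ₗ[ℝ] X.1 := LinearMap.codRestrict X.1
    (projOp X.1 : E →ₗ[ℝ] E) fun x => projOp_mem _ x
  have hpr : ∀ X, Function.Surjective (pr X) := fun X x =>
    ⟨x, Subtype.ext (projOp_of_mem x.2)⟩
  let f (z : Y) : (E × E × E) →ₗ[ℝ] ((A z).1 × (B z).1 × (C z).1) :=
    (pr (A z)).prodMap ((pr (B z)).prodMap (pr (C z)))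
  have hf : ∀ z, Function.Surjective (f z) := fun z =>
    (hpr _).prodMap ((hpr _).prodMap (hpr _))
  let Q (z : Y) : QuadraticForm ℝ (E × E × E) := (tripleForm ω (A z).1 (B z).1 (C z).1).comp (f z)
  have hQs : ∀ z, tripleSig ω (A z).1 (B z).1 (C z).1 = qsig (Q z) := fun z => by
    rw [tripleSig_eq_qsig, qsig_comp _ (hf z)]
  simp only [hQs]
  apply qsig_eventually_eq
  · rintro v
    have hω2 : Continuous fun p : E × E => ω p.1 p.2 := by
      have : Continuous fun p : E × E => (LinearMap.toContinuousLinearMap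
          ((LinearMap.toContinuousLinearMap : (E →ₗ[ℝ] ℝ) ≃ₗ[ℝ] (E →L[ℝ] ℝ)).toLinearMap ∘ₗ ω))
            p.1 p.2 := by fun_prop
      exact this
    have hp : ∀ {X : Y → Lag ω} (_ : ContinuousAt X y) {g : Y × (E × E × E) → E}
        (_ : Continuous g), ContinuousAt (fun p => projOp (X p.1).1 (g p)) (y, v) := by
      intro X hX g hg
      have h1 : ContinuousAt (fun p : Y × (E × E × E) => projOp (X p.1).1) (y, v) :=
        ContinuousAt.comp' (f := fun p : Y × (E × E × E) => X p.1)
          continuous_projOp.continuousAt (ContinuousAt.comp' hX continuousAt_fst)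
      exact h1.clm_apply hg.continuousAt
    have hA' := hp hA (g := fun p => p.2.1) (by fun_prop)
    have hB' := hp hB (g := fun p => p.2.2.1) (by fun_prop)
    have hC' := hp hC (g := fun p => p.2.2.2) (by fun_prop)
    exact ((hω2.continuousAt.comp' (hA'.prodMk hB')).add
      (hω2.continuousAt.comp' (hB'.prodMk hC'))).add (hω2.continuousAt.comp' (hC'.prodMk hA'))
  · filter_upwards [hAB, hBC, hCA] with z h1 h2 h3
    have e1 := tripleForm_rank (A z) (B z) (C z)
    have e2 := tripleForm_rank (A y) (B y) (C y)
    rw [sigPos_comp _ (hf z), sigNeg_comp _ (hf z), sigPos_comp _ (hf y), sigNeg_comp _ (hf y)]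
    have := (A z).2.finrank_eq (A y).2
    have := (B z).2.finrank_eq (B y).2
    have := (C z).2.finrank_eq (C y).2
    omega

end Signature

section Primitive

open Filter Topology Set

/-- A locally constant integral Čech cocycle that is the coboundary of arbitrary functions `f i`
has a primitive on a simply connected space. -/
theorem exists_cech_primitive {ι Y : Type*} [TopologicalSpace Y] [SimplyConnectedSpace Y]
    [LocallyPathConnectedSpace Y] (U : ι → Set Y) (hU : ∀ i, IsOpen (U i))
    (hcov : ∀ y, ∃ i, y ∈ U i) (f : ι → Y → ℤ)
    (hf : ∀ i j y, y ∈ U i → y ∈ U j → ∀ᶠ z in 𝓝 y, f i z - f j z = f i y - f j y) :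
    ∃ φ : Y → ℤ, ∀ i y, y ∈ U i → ∀ᶠ z in 𝓝 y, φ z - f i z = φ y - f i y := by
  choose idx hidx using hcov
  let Z : FiberBundleCore ι Y ℤ :=
    { baseSet := U
      isOpen_baseSet := hU
      indexAt := idx
      mem_baseSet_at := hidx
      coordChange := fun i j y v => v + (f i y - f j y)
      coordChange_self := by intros; simp
      continuousOn_coordChange := by
        rintro i j ⟨y, v⟩ ⟨⟨hi, hj⟩, -⟩
        refine ContinuousAt.continuousWithinAt (ContinuousAt.add continuousAt_snd ?_)
        have h1 : ContinuousAt (fun z => f i z - f j z) y := by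
          refine (continuousAt_const (y := f i y - f j y)).congr ?_
          filter_upwards [hf i j y hi hj] with z hz using hz.symm
        exact ContinuousAt.comp (f := Prod.fst) (g := fun z => f i z - f j z) h1 continuousAt_fst
      coordChange_comp := by intros; ring }
  have hc : IsCoveringMap Z.proj :=
    IsCoveringMap.mk Z.proj (fun _ => ℤ) (fun y => Z.localTriv (idx y)) (fun y => hidx y)
  obtain ⟨y0⟩ : Nonempty Y := inferInstance
  obtain ⟨σ, ⟨-, hσ⟩, -⟩ := hc.existsUnique_continuousMap_lifts (ContinuousMap.id Y) y0
    (⟨y0, (0 : ℤ)⟩ : Z.TotalSpace) rfl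
  have hσ' : ∀ y, (σ y).1 = y := fun y => congrFun hσ y
  let val (p : Z.TotalSpace) : ℤ := p.2
  refine ⟨fun y => val (σ y) + f (idx y) y, fun i y hy => ?_⟩
  have h1 : ContinuousAt (fun z => (Z.localTriv i (σ z)).2) y := by
    have h2 : ContinuousAt (Z.localTriv i) (σ y) := by
      apply (Z.localTriv i).toOpenPartialHomeomorph.continuousAt
      refine (Z.localTriv i).mem_source.2 ?_
      change (σ y).1 ∈ U i
      rwa [hσ']
    exact continuousAt_snd.comp (h2.comp σ.continuous.continuousAt)
  have h3 : ∀ z, (Z.localTriv i (σ z)).2 = val (σ z) + (f (idx z) z - f i z) := by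
    intro z
    have h4 : (Z.localTriv i (σ z)).2 =
      val (σ z) + (f (idx (σ z).1) (σ z).1 - f i (σ z).1) := rfl
    rw [h4, hσ' z]
  have h5 := h1.eventually (IsOpen.mem_nhds (isOpen_discrete {(Z.localTriv i (σ y)).2}) rfl)
  filter_upwards [h5] with z hz
  have hz : (Z.localTriv i (σ z)).2 = (Z.localTriv i (σ y)).2 := hz
  rw [h3, h3] at hz
  linarith

variable [FiniteDimensional ℝ E] {ω : BilinForm ℝ E} [hω : IsSymplForm ω]
variable {Y Y' : Type*} [TopologicalSpace Y'] [TopologicalSpace Y]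

/-- `φ` is a Maslov primitive of the family of pairs `(A, B)`: it differs by a locally constant
function from `s(A, B, M)`, wherever `M` is transversal to `A` and `B`. -/
def IsMaslovPrim (A B : Y → Lag ω) (φ : Y → ℤ) : Prop :=
  ∀ (M : Lag ω) (y : Y), M.1 ⊓ (A y).1 = ⊥ → M.1 ⊓ (B y).1 = ⊥ →
    ∀ᶠ z in 𝓝 y, φ z - tripleSig ω (A z).1 (B z).1 M.1 = φ y - tripleSig ω (A y).1 (B y).1 M.1

theorem eventually_transv {A B : Y → Lag ω} {y : Y} (hA : ContinuousAt A y)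
    (hB : ContinuousAt B y) (h : (A y).1 ⊓ (B y).1 = ⊥) :
    ∀ᶠ z in 𝓝 y, (A z).1 ⊓ (B z).1 = ⊥ :=
  (hA.prodMk hB).eventually (isOpen_transv.mem_nhds h)

theorem eventually_finrank_transv {A B : Y → Lag ω} {y : Y} (hA : ContinuousAt A y)
    (hB : ContinuousAt B y) (h : (A y).1 ⊓ (B y).1 = ⊥) :
    ∀ᶠ z in 𝓝 y, Module.finrank ℝ ↥((A z).1 ⊓ (B z).1) =
      Module.finrank ℝ ↥((A y).1 ⊓ (B y).1) := by
  filter_upwards [eventually_transv hA hB h] with z hz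
  rw [hz, h]

theorem exists_isMaslovPrim [SimplyConnectedSpace Y] [LocallyPathConnectedSpace Y]
    {A B : Y → Lag ω} (hA : Continuous A) (hB : Continuous B) :
    ∃ φ : Y → ℤ, IsMaslovPrim A B φ := by
  classical
  obtain ⟨φ, hφ⟩ := exists_cech_primitive
    (U := fun (M : Lag ω) => {y : Y | M.1 ⊓ (A y).1 = ⊥ ∧ M.1 ⊓ (B y).1 = ⊥})
    (fun M => (isOpen_transv.preimage (continuous_const.prodMk hA)).inter
      (isOpen_transv.preimage (continuous_const.prodMk hB)))
    (fun y => by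
      obtain ⟨M, hM⟩ := exists_transv {A y, B y}
      exact ⟨M, hM _ (by simp), hM _ (by simp)⟩)
    (fun M y => tripleSig ω (A y).1 (B y).1 M.1) (by
      rintro M N y ⟨h1, h2⟩ ⟨h3, h4⟩
      have hc (K : Lag ω) : ContinuousAt (fun _ : Y => K) y := continuousAt_const
      have e1 := tripleSig_locally_const hB.continuousAt (hc M) (hc N)
        (eventually_finrank_transv hB.continuousAt (hc M) (by rw [inf_comm]; exact h2))
        (Eventually.of_forall fun _ => rfl)
        (eventually_finrank_transv (hc N) hB.continuousAt h4)
      have e2 := tripleSig_locally_const hA.continuousAt (hc M) (hc N)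
        (eventually_finrank_transv hA.continuousAt (hc M) (by rw [inf_comm]; exact h1))
        (Eventually.of_forall fun _ => rfl)
        (eventually_finrank_transv (hc N) hA.continuousAt h3)
      filter_upwards [e1, e2] with z h1 h2
      rw [tripleSig_cocycle, tripleSig_cocycle, h1, h2])
  exact ⟨φ, fun M y h1 h2 => hφ M y ⟨h1, h2⟩⟩

theorem IsMaslovPrim.comp {A B : Y → Lag ω} {φ : Y → ℤ} (h : IsMaslovPrim A B φ) {g : Y' → Y}
    (hg : Continuous g) : IsMaslovPrim (A ∘ g) (B ∘ g) (φ ∘ g) :=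
  fun M y h1 h2 => hg.continuousAt.eventually (h M (g y) h1 h2)

theorem IsMaslovPrim.sub_eq [PreconnectedSpace Y] {A B : Y → Lag ω} {φ ψ : Y → ℤ}
    (h : IsMaslovPrim A B φ) (h' : IsMaslovPrim A B ψ) (y z : Y) :
    φ y - φ z = ψ y - ψ z := by
  classical
  have hl : IsLocallyConstant fun y => φ y - ψ y := by
    rw [IsLocallyConstant.iff_eventually_eq]
    intro y
    obtain ⟨M, hM⟩ := exists_transv {A y, B y}
    filter_upwards [h M y (hM _ (by simp)) (hM _ (by simp)),
      h' M y (hM _ (by simp)) (hM _ (by simp))] with z h1 h2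
    linarith
  have := hl.apply_eq_of_isPreconnected isPreconnected_univ (mem_univ y) (mem_univ z)
  linarith

theorem IsMaslovPrim.const_of_finrank [PreconnectedSpace Y] {A B : Y → Lag ω} {φ : Y → ℤ}
    (h : IsMaslovPrim A B φ) (hA : Continuous A) (hB : Continuous B) {d : ℕ}
    (hd : ∀ y, Module.finrank ℝ ↥((A y).1 ⊓ (B y).1) = d) (y z : Y) : φ y = φ z := by
  classical
  have hl : IsLocallyConstant φ := by
    rw [IsLocallyConstant.iff_eventually_eq]
    intro y
    obtain ⟨M, hM⟩ := exists_transv {A y, B y}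
    have hMA : M.1 ⊓ (A y).1 = ⊥ := hM _ (by simp)
    have hMB : M.1 ⊓ (B y).1 = ⊥ := hM _ (by simp)
    filter_upwards [h M y hMA hMB, tripleSig_locally_const hA.continuousAt hB.continuousAt
      (continuousAt_const (y := M)) (Eventually.of_forall fun z => by rw [hd, hd])
      (eventually_finrank_transv hB.continuousAt continuousAt_const (by rwa [inf_comm]))
      (eventually_finrank_transv continuousAt_const hA.continuousAt hMA)] with z h1 h2
    linarith
  exact hl.apply_eq_of_isPreconnected isPreconnected_univ (mem_univ y) (mem_univ z)

theorem IsMaslovPrim.sub_eq_of_transv {A B : Y → Lag ω} {φ : Y → ℤ} (h : IsMaslovPrim A B φ)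
    (M : Lag ω) {S : Set Y} (hS : IsPreconnected S)
    (hMA : ∀ y ∈ S, M.1 ⊓ (A y).1 = ⊥) (hMB : ∀ y ∈ S, M.1 ⊓ (B y).1 = ⊥) {y z : Y}
    (hy : y ∈ S) (hz : z ∈ S) :
    φ y - φ z = tripleSig ω (A y).1 (B y).1 M.1 - tripleSig ω (A z).1 (B z).1 M.1 := by
  have hl : IsLocallyConstant
      fun x : S => φ x - tripleSig ω (A x).1 (B x).1 M.1 := by
    rw [IsLocallyConstant.iff_eventually_eq]
    exact fun x => continuous_subtype_val.continuousAt.eventually (h M x (hMA x x.2) (hMB x x.2))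
  have : PreconnectedSpace S := isPreconnected_iff_preconnectedSpace.1 hS
  have := hl.apply_eq_of_isPreconnected isPreconnected_univ (mem_univ ⟨y, hy⟩)
    (mem_univ ⟨z, hz⟩)
  simp only at this
  linarith

/-- The intersection number computed from admissible data is the variation of any primitive. -/
theorem dataSum_eq_prim {A B : ℝ → Lag ω} {φ : ℝ → ℤ} (h : IsMaslovPrim A B φ) {a b : ℝ}
    {L1 L2 : ℝ → Submodule ℝ E} (hA : ∀ t ∈ Icc a b, (A t).1 = L1 t)
    (hB : ∀ t ∈ Icc a b, (B t).1 = L2 t) (D : AdmissibleData ω a b L1 L2) :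
    dataSum D = (1 / 2 : ℝ) * ((φ a - φ b : ℤ) : ℝ) := by
  have hmono : ∀ i j, i ≤ j → j ≤ D.k → D.t i ≤ D.t j := by
    intro i j hij
    induction j, hij using Nat.le_induction with
    | base => exact fun _ => le_rfl
    | succ j _ ih => exact fun hj => (ih (by omega)).trans (D.hmono j (by omega))
  have hsum : ∀ m ≤ D.k, ∑ ν ∈ Finset.range m,
      ((tripleSig ω (L1 (D.t ν)) (L2 (D.t ν)) (D.M (ν + 1)) : ℝ)
      - (tripleSig ω (L1 (D.t (ν + 1))) (L2 (D.t (ν + 1))) (D.M (ν + 1)) : ℝ)) =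
      ((φ a - φ (D.t m) : ℤ) : ℝ) := by
    intro m
    induction m with
    | zero => intro _; simp [D.ht0]
    | succ m ih =>
      intro hm
      rw [Finset.sum_range_succ, ih (by omega)]
      have hsub : Icc (D.t m) (D.t (m + 1)) ⊆ Icc a b := by
        refine Icc_subset_Icc ?_ ?_
        · exact D.ht0.symm.trans_le (hmono _ _ (by omega) (by omega))
        · exact (hmono _ _ hm le_rfl).trans_eq D.htk
      have hm0 : D.t m ∈ Icc (D.t m) (D.t (m + 1)) := left_mem_Icc.2 (D.hmono m (by omega))
      have hm1 : D.t (m + 1) ∈ Icc (D.t m) (D.t (m + 1)) :=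
        right_mem_Icc.2 (D.hmono m (by omega))
      have key := h.sub_eq_of_transv ⟨D.M (m + 1), D.hlag m (by omega)⟩ isPreconnected_Icc
        (fun y hy => by rw [hA y (hsub hy)]; exact D.htrans1 m (by omega) y hy)
        (fun y hy => by rw [hB y (hsub hy)]; exact D.htrans2 m (by omega) y hy) hm0 hm1
      rw [hA _ (hsub hm0), hA _ (hsub hm1), hB _ (hsub hm0), hB _ (hsub hm1)] at key
      rw [← Int.cast_sub, ← key]
      push_cast
      ring
  unfold dataSum
  rw [hsum _ le_rfl, D.htk]

theorem exists_admissibleData {A B : ℝ → Lag ω} (hAc : Continuous A) (hBc : Continuous B)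
    {a b : ℝ} (hab : a ≤ b) {L1 L2 : ℝ → Submodule ℝ E} (hA : ∀ t ∈ Icc a b, (A t).1 = L1 t)
    (hB : ∀ t ∈ Icc a b, (B t).1 = L2 t) : Nonempty (AdmissibleData ω a b L1 L2) := by
  classical
  obtain ⟨t, ht0, hm, ⟨m, hmb⟩, hM⟩ := exists_monotone_Icc_subset_open_cover_Icc hab
    (c := fun (M : Lag ω) => {y : Icc a b | M.1 ⊓ (A y).1 = ⊥ ∧ M.1 ⊓ (B y).1 = ⊥})
    (fun M => (isOpen_transv.preimage
      (continuous_const.prodMk (hAc.comp continuous_subtype_val))).inter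
      (isOpen_transv.preimage (continuous_const.prodMk (hBc.comp continuous_subtype_val))))
    (fun y _ => by
      obtain ⟨M, hM⟩ := exists_transv {A y, B y}
      exact mem_iUnion.2 ⟨M, hM _ (by simp), hM _ (by simp)⟩)
  choose M hM using hM
  have hs : ∀ n, ∀ s ∈ Icc (t n : ℝ) (t (n + 1)), s ∈ Icc a b := fun n s hs =>
    ⟨(t n).2.1.trans hs.1, hs.2.trans (t (n + 1)).2.2⟩
  refine ⟨⟨m + 1, by omega, fun n => t n, fun n => (M (n - 1)).1, ht0,
    hmb (m + 1) (by omega), fun n _ => hm (Nat.le_succ n),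
    fun n _ => (M n).2, fun n _ s h => ?_, fun n _ s h => ?_⟩⟩
  · rw [← hA s (hs n s h)]
    exact (hM n (show (⟨s, hs n s h⟩ : Icc a b) ∈ Icc (t n) (t (n + 1)) from h)).1
  · rw [← hB s (hs n s h)]
    exact (hM n (show (⟨s, hs n s h⟩ : Icc a b) ∈ Icc (t n) (t (n + 1)) from h)).2

end Primitive

section Families

open Filter Topology Set

variable [FiniteDimensional ℝ E] {ω : BilinForm ℝ E} [hω : IsSymplForm ω]
variable {Y : Type*} [TopologicalSpace Y]

/-- A locally trivial family of Lagrangian subspaces is a continuous map to `Lag ω`. -/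
theorem exists_continuous_lag {S : Set Y} {L : Y → Submodule ℝ E}
    (hlag : ∀ y ∈ S, IsLagrangian ω (L y))
    (hloc : ∀ y ∈ S, ∃ U ∈ 𝓝[S] y, U ⊆ S ∧ ∃ P : Y → E →L[ℝ] E, ContinuousOn P U ∧
      ∀ z ∈ U, (P z).comp (P z) = P z ∧ LinearMap.range (P z : E →ₗ[ℝ] E) = L z) :
    ∃ A : S → Lag ω, Continuous A ∧ ∀ y : S, (A y).1 = L y := by
  let A (y : S) : Lag ω := ⟨L y, hlag y y.2⟩
  refine ⟨A, continuous_iff_continuousAt.2 fun y => ?_, fun _ => rfl⟩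
  obtain ⟨U, hU, hUS, P, hP, hPU⟩ := hloc y y.2
  have hU' : ∀ᶠ z : S in 𝓝 y, (z : Y) ∈ U := by
    rw [nhds_subtype_eq_comap_nhdsWithin]
    exact preimage_mem_comap hU
  refine lag_continuousAt_of_idem (Q := fun z : S => P z) ?_ ?_
  · have h1 : ContinuousWithinAt P U y := hP y (mem_of_mem_nhdsWithin y.2 hU)
    have h2 : Tendsto (fun z : S => (z : Y)) (𝓝 y) (𝓝[U] y) :=
      tendsto_nhdsWithin_iff.2 ⟨continuous_subtype_val.continuousAt, hU'⟩
    exact h1.tendsto.comp h2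
  · filter_upwards [hU'] with z hz using ⟨(hPU z hz).1, (hPU z hz).2⟩

theorem locTriv_of_continuous {S : Set Y} {L : Y → Submodule ℝ E} {A : Y → Lag ω}
    (hA : Continuous A) (h : ∀ y ∈ S, (A y).1 = L y) (y : Y) :
    ∃ U ∈ 𝓝[S] y, U ⊆ S ∧ ∃ P : Y → E →L[ℝ] E, ContinuousOn P U ∧
      ∀ z ∈ U, (P z).comp (P z) = P z ∧ LinearMap.range (P z : E →ₗ[ℝ] E) = L z :=
  ⟨S, self_mem_nhdsWithin, subset_rfl, fun y => projOp (A y).1,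
    (continuous_projOp.comp hA).continuousOn, fun z hz =>
      ⟨projOp_idem _, (projOp_range _).trans (h z hz)⟩⟩

theorem IsLagrangianPath.exists_continuous {a b : ℝ} (hab : a ≤ b) {L : ℝ → Submodule ℝ E}
    (h : IsLagrangianPath ω a b L) :
    ∃ A : ℝ → Lag ω, Continuous A ∧ ∀ t ∈ Icc a b, (A t).1 = L t := by
  obtain ⟨A, hA, hAL⟩ := exists_continuous_lag h.lag h.locTriv
  refine ⟨fun t => A (projIcc a b hab t), hA.comp continuous_projIcc, fun t ht => ?_⟩
  rw [hAL, projIcc_of_mem hab ht]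

theorem IsLagrangianHomotopy.exists_continuous {a b : ℝ} (hab : a ≤ b)
    {L : ℝ → ℝ → Submodule ℝ E} (h : IsLagrangianHomotopy ω a b L) :
    ∃ A : ℝ × ℝ → Lag ω, Continuous A ∧
      ∀ s ∈ Icc (0 : ℝ) 1, ∀ t ∈ Icc a b, (A (s, t)).1 = L s t := by
  obtain ⟨A, hA, hAL⟩ := exists_continuous_lag (L := fun p : ℝ × ℝ => L p.1 p.2)
    (S := Icc (0 : ℝ) 1 ×ˢ Icc a b) (fun y hy => h.lag y.1 hy.1 y.2 hy.2) h.locTriv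
  refine ⟨fun p => A ⟨(projIcc 0 1 zero_le_one p.1, projIcc a b hab p.2), by
      exact ⟨Subtype.coe_prop _, Subtype.coe_prop _⟩⟩, hA.comp ?_, fun s hs t ht => ?_⟩
  · refine Continuous.subtype_mk ?_ _
    exact (continuous_subtype_val.comp (continuous_projIcc.comp continuous_fst)).prodMk
      (continuous_subtype_val.comp (continuous_projIcc.comp continuous_snd))
  · rw [hAL]
    simp only [projIcc_of_mem hab ht, projIcc_of_mem zero_le_one hs]

theorem isLagrangianPath_of_continuous {a b : ℝ} {L : ℝ → Submodule ℝ E} {A : ℝ → Lag ω}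
    (hA : Continuous A) (h : ∀ t ∈ Icc a b, (A t).1 = L t) : IsLagrangianPath ω a b L :=
  ⟨fun t ht => h t ht ▸ (A t).2, fun t _ => locTriv_of_continuous hA h t⟩

theorem isLagrangianHomotopy_of_continuous {a b : ℝ} {L : ℝ → ℝ → Submodule ℝ E}
    {A : ℝ × ℝ → Lag ω} (hA : Continuous A)
    (h : ∀ s ∈ Icc (0 : ℝ) 1, ∀ t ∈ Icc a b, (A (s, t)).1 = L s t) :
    IsLagrangianHomotopy ω a b L :=
  ⟨fun s hs t ht => h s hs t ht ▸ (A (s, t)).2, fun p _ =>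
    locTriv_of_continuous (L := fun p : ℝ × ℝ => L p.1 p.2) hA
      (fun y hy => h y.1 hy.1 y.2 hy.2) p⟩

/-- The intersection number is invariant under homotopies fixing the endpoint dimensions. -/
theorem dataSum_eq_of_homotopy {a b : ℝ} (hab : a ≤ b) {H1 H2 : ℝ → ℝ → Submodule ℝ E}
    (h1 : IsLagrangianHomotopy ω a b H1) (h2 : IsLagrangianHomotopy ω a b H2) {da db : ℕ}
    (hda : ∀ s ∈ Icc (0 : ℝ) 1, Module.finrank ℝ ↥(H1 s a ⊓ H2 s a) = da)
    (hdb : ∀ s ∈ Icc (0 : ℝ) 1, Module.finrank ℝ ↥(H1 s b ⊓ H2 s b) = db)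
    (D : AdmissibleData ω a b (H1 0) (H2 0)) (D' : AdmissibleData ω a b (H1 1) (H2 1)) :
    dataSum D = dataSum D' := by
  obtain ⟨A, hA, hAL⟩ := h1.exists_continuous hab
  obtain ⟨B, hB, hBL⟩ := h2.exists_continuous hab
  obtain ⟨φ, hφ⟩ := exists_isMaslovPrim hA hB
  have h0 : (0 : ℝ) ∈ Icc (0 : ℝ) 1 := ⟨le_rfl, zero_le_one⟩
  have h1 : (1 : ℝ) ∈ Icc (0 : ℝ) 1 := ⟨zero_le_one, le_rfl⟩
  have hside : ∀ t ∈ Icc a b, ∀ d, (∀ s ∈ Icc (0 : ℝ) 1,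
      Module.finrank ℝ ↥(H1 s t ⊓ H2 s t) = d) → φ (0, t) = φ (1, t) := by
    intro t ht d hd
    have hg : Continuous fun s : Icc (0 : ℝ) 1 => ((s : ℝ), t) := by fun_prop
    have : PreconnectedSpace (Icc (0 : ℝ) 1) := isPreconnected_iff_preconnectedSpace.1
      isPreconnected_Icc
    refine (hφ.comp hg).const_of_finrank (hA.comp hg) (hB.comp hg) (d := d) (fun s => ?_)
      ⟨0, h0⟩ ⟨1, h1⟩
    rw [← hd s s.2, ← hAL s s.2 t ht, ← hBL s s.2 t ht]
    rfl
  have hrow (s : ℝ) : Continuous fun t : ℝ => (s, t) := by fun_prop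
  rw [dataSum_eq_prim (hφ.comp (hrow 0)) (hAL 0 h0) (hBL 0 h0) D,
    dataSum_eq_prim (hφ.comp (hrow 1)) (hAL 1 h1) (hBL 1 h1) D']
  simp only [Function.comp_apply]
  rw [hside a (left_mem_Icc.2 hab) da hda, hside b (right_mem_Icc.2 hab) db hdb]

end Families

section PathClass

open Topology unitInterval Path.Homotopic

variable {X C C' : Type*} [TopologicalSpace X] [TopologicalSpace C] [TopologicalSpace C']

namespace Path.Homotopic.Quotient

open Path

variable {x y z : X}

theorem symm_trans_cancel (p : Homotopic.Quotient x y) (q : Homotopic.Quotient y z) :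
    p.symm.trans (p.trans q) = q := by
  rw [← trans_assoc, symm_trans, refl_trans]

theorem trans_symm_cancel (p : Homotopic.Quotient y x) (q : Homotopic.Quotient y z) :
    p.trans (p.symm.trans q) = q := by
  rw [← trans_assoc, trans_symm, refl_trans]

theorem symm_eq_of_trans_eq_refl {p : Homotopic.Quotient x y} {q : Homotopic.Quotient y x}
    (h : p.trans q = refl x) : p.symm = q := by
  rw [← symm_trans_cancel p q, h, trans_refl]

/-- Induction over a subdivision: a property of path classes closed under composition and
satisfied by the pieces of a subdivision of `p` is satisfied by `p`. -/
theorem induction_subdivision (P : ∀ a b : X, Homotopic.Quotient a b → Prop)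
    (htrans : ∀ a b c (q : Homotopic.Quotient a b) (r : Homotopic.Quotient b c),
      P a b q → P b c r → P a c (q.trans r))
    (p : Path x y) (t : ℕ → I) (m : ℕ) (ht0 : t 0 = 0) (htm : t (m + 1) = 1)
    (h : ∀ n ≤ m, P _ _ (mk (p.subpath (t n) (t (n + 1))))) : P x y (mk p) := by
  have key : ∀ n ≤ m, P _ _ (mk (p.subpath (t 0) (t (n + 1)))) := by
    intro n
    induction n with
    | zero => exact h 0
    | succ n ih =>
      intro hn
      have := htrans _ _ _ _ _ (ih (by omega)) (h (n + 1) hn)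
      rwa [← mk_trans, Quotient.eq.2 ⟨Path.Homotopy.subpathTransSubpath p _ _ _⟩] at this
  have := key m le_rfl
  rw [ht0, htm, Path.subpath_zero_one, mk_cast] at this
  generalize_proofs h0 h1 at this
  revert this
  generalize mk p = q
  generalize p 0 = x' at *
  generalize p 1 = y' at *
  subst h0 h1
  rw [cast_rfl_rfl]
  exact id

end Path.Homotopic.Quotient

open Path.Homotopic.Quotient (mk)

section Simply

variable [SimplyConnectedSpace C'] [SimplyConnectedSpace C]

/-- The path class in `X` between images of two points of a simply connected space. -/
noncomputable def simplyCls (f : C(C, X)) (c c' : C) {x y : X} (hx : f c = x) (hy : f c' = y) :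
    Path.Homotopic.Quotient x y :=
  mk (((PathConnectedSpace.somePath c c').map f.continuous).cast hx.symm hy.symm)

theorem mk_eq_simplyCls (f : C(C, X)) {c c' : C} {x y : X} (hx : f c = x) (hy : f c' = y)
    (p : Path x y) (g : C(I, C)) (h : ∀ t, f (g t) = p t) (h0 : g 0 = c) (h1 : g 1 = c') :
    mk p = simplyCls f c c' hx hy := by
  subst hx hy
  have hp : p = (Path.map ⟨g, h0, h1⟩ f.continuous : Path (f c) (f c')) := by
    ext t
    exact (h t).symm
  rw [hp]
  exact Path.Homotopic.Quotient.eq.2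
    ((SimplyConnectedSpace.paths_homotopic _ (PathConnectedSpace.somePath c c')).map f)

theorem simplyCls_self (f : C(C, X)) (c : C) {x : X} (hx : f c = x) :
    simplyCls f c c hx hx = Path.Homotopic.Quotient.refl x :=
  (mk_eq_simplyCls f hx hx (Path.refl x) (ContinuousMap.const _ c) (fun _ => hx) rfl rfl).symm

theorem simplyCls_trans (f : C(C, X)) (c c' c'' : C) {x y z : X} (hx : f c = x) (hy : f c' = y)
    (hz : f c'' = z) : (simplyCls f c c' hx hy).trans (simplyCls f c' c'' hy hz) =
      simplyCls f c c'' hx hz := by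
  subst hx hy hz
  refine mk_eq_simplyCls f _ _ _ ((PathConnectedSpace.somePath c c').trans
    (PathConnectedSpace.somePath c' c'')).toContinuousMap (fun t => ?_) (Path.source _)
    (Path.target _)
  have := congrArg (fun p => p t) (Path.map_trans (PathConnectedSpace.somePath c c')
    (PathConnectedSpace.somePath c' c'') f.continuous)
  exact this

theorem simplyCls_symm (f : C(C, X)) (c c' : C) {x y : X} (hx : f c = x) (hy : f c' = y) :
    (simplyCls f c c' hx hy).symm = simplyCls f c' c hy hx :=
  Path.Homotopic.Quotient.symm_eq_of_trans_eq_refl (by rw [simplyCls_trans, simplyCls_self])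

theorem simplyCls_comp (f : C(C, X)) (g : C(C', C)) (c c' : C') {x y : X} (hx : f (g c) = x)
    (hy : f (g c') = y) : simplyCls (f.comp g) c c' hx hy = simplyCls f (g c) (g c') hx hy :=
  mk_eq_simplyCls f hx hy _ (g.comp (PathConnectedSpace.somePath c c').toContinuousMap)
    (fun _ => rfl) (by simp) (by simp)

end Simply

instance : SimplyConnectedSpace I :=
  have : ContractibleSpace I := (convex_Icc (0 : ℝ) 1).contractibleSpace ⟨0, by simp⟩
  inferInstance

instance : SimplyConnectedSpace (I × I) :=
  have : ContractibleSpace I := (convex_Icc (0 : ℝ) 1).contractibleSpace ⟨0, by simp⟩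
  inferInstance

theorem mk_square (F : C(I × I, X)) {a b c d : X} (p : Path a b) (q : Path b d) (r : Path a c)
    (s : Path c d) (hp : ∀ t, F (0, t) = p t) (hq : ∀ t, F (t, 1) = q t)
    (hr : ∀ t, F (t, 0) = r t) (hs : ∀ t, F (1, t) = s t) :
    (mk p).trans (mk q) = (mk r).trans (mk s) := by
  have ha : F (0, 0) = a := (hp 0).trans p.source
  have hb : F (0, 1) = b := (hp 1).trans p.target
  have hc : F (1, 0) = c := (hs 0).trans s.source
  have hd : F (1, 1) = d := (hs 1).trans s.target
  rw [mk_eq_simplyCls F ha hb p ⟨fun t => (0, t), by fun_prop⟩ hp rfl rfl,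
    mk_eq_simplyCls F hb hd q ⟨fun t => (t, 1), by fun_prop⟩ hq rfl rfl,
    mk_eq_simplyCls F ha hc r ⟨fun t => (t, 0), by fun_prop⟩ hr rfl rfl,
    mk_eq_simplyCls F hc hd s ⟨fun t => (1, t), by fun_prop⟩ hs rfl rfl,
    simplyCls_trans, simplyCls_trans]

theorem exists_continuous_extension {x y x' y' : X} (γ' : Path x' y') (p : Path x x')
    (q : Path y y') : ∃ W : C(ℝ, X), (∀ t : I, W (t - 1) = p t) ∧ (∀ t : I, W t = γ' t) ∧
      ∀ t : I, W (2 - t) = q t := by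
  refine ⟨⟨fun u => if u ≤ 0 then p.extend (1 + u) else if u ≤ 1 then γ'.extend u
    else q.extend (2 - u), ?_⟩, fun t => ?_, fun t => ?_, fun t => ?_⟩
  · refine Continuous.if_le (by fun_prop) (Continuous.if_le (by fun_prop) (by fun_prop)
      continuous_id continuous_const ?_) continuous_id continuous_const ?_
    · rintro u rfl
      norm_num
    · rintro u rfl
      simp
  · have := t.2.2
    simp [show (t : ℝ) - 1 ≤ 0 by linarith]
  · have h0 := t.2.1
    have h1 := t.2.2
    by_cases h : (t : ℝ) ≤ 0
    · obtain rfl : t = 0 := Subtype.ext (le_antisymm h h0)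
      simp
    · simp [h, h1]
  · have h1 := t.2.2
    by_cases h : (2 : ℝ) - t ≤ 1
    · obtain rfl : t = 1 := Subtype.ext (by linarith [show ((1 : I) : ℝ) = 1 from rfl])
      norm_num
    · simp [h, show ¬ (2 : ℝ) - t ≤ 0 by linarith]

/-- If two path classes differ by composition with paths in `S` and `T`, the paths are freely
homotopic with endpoints moving in `S` and `T`. -/
theorem homotopicWith_of_trans_eq {x y x' y' : X} (γ : Path x y) (γ' : Path x' y')
    (p : Path x x') (q : Path y y') {S T : Set X} (hp : ∀ t, p t ∈ S) (hq : ∀ t, q t ∈ T)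
    (h : mk γ = ((mk p).trans (mk γ')).trans (mk q).symm) :
    ContinuousMap.HomotopicWith γ.toContinuousMap γ'.toContinuousMap
      (fun f => f 0 ∈ S ∧ f 1 ∈ T) := by
  obtain ⟨W, hWp, hWγ, hWq⟩ := exists_continuous_extension γ' p q
  have e1 : W (-1) = x := by simpa using hWp 0
  have e2 : W 0 = x' := by simpa using hWp 1
  have e3 : W 1 = y' := by simpa using hWγ 1
  have e4 : W 2 = y := by simpa using hWq 0
  let δ : Path x y := ⟨W.comp ⟨fun t : I => -1 + 3 * (t : ℝ), by fun_prop⟩, by simpa using e1, by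
    simp only [ContinuousMap.toFun_eq_coe, ContinuousMap.comp_apply, ContinuousMap.coe_mk,
      Set.Icc.coe_one]
    norm_num
    exact e4⟩
  have hδ : mk γ = mk δ := by
    rw [h, mk_eq_simplyCls W e1 e4 δ ⟨fun t : I => -1 + 3 * (t : ℝ), by fun_prop⟩ (fun _ => rfl)
        (by simp) (by simp; norm_num),
      mk_eq_simplyCls W e1 e2 p ⟨fun t : I => (t : ℝ) - 1, by fun_prop⟩ hWp (by simp) (by simp),
      mk_eq_simplyCls W e2 e3 γ' ⟨fun t : I => (t : ℝ), by fun_prop⟩ hWγ (by simp) (by simp),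
      mk_eq_simplyCls W e4 e3 q ⟨fun t : I => 2 - (t : ℝ), by fun_prop⟩ hWq (by simp)
        (by simp; norm_num), simplyCls_trans, simplyCls_symm, simplyCls_trans]
  obtain ⟨K⟩ := Path.Homotopic.Quotient.eq.1 hδ
  have hx : x ∈ S := p.source ▸ hp 0
  have hy : y ∈ T := q.source ▸ hq 0
  refine ContinuousMap.HomotopicWith.trans (g := δ.toContinuousMap)
    ⟨⟨K.toHomotopy, fun s => ⟨?_, ?_⟩⟩⟩ ⟨⟨⟨W.comp ⟨fun z : I × I =>
      -(1 - (z.1 : ℝ)) + z.2 * (1 + 2 * (1 - z.1)), by fun_prop⟩, fun t => ?_, fun t => ?_⟩,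
      fun s => ⟨?_, ?_⟩⟩⟩
  · have : K (s, 0) = x := K.source s
    exact this.symm ▸ hx
  · have : K (s, 1) = y := K.target s
    exact this.symm ▸ hy
  · change W _ = W _
    congr 1
    simp
    ring
  · change W _ = γ' t
    rw [← hWγ]
    congr 1
    simp
  · change W _ ∈ S
    convert hp s using 1
    rw [← hWp]
    congr 1
    simp
  · change W _ ∈ T
    convert hq s using 1
    rw [← hWq]
    congr 1
    simp
    ring

end PathClass

section ChartSpace

open Filter Topology Module unitInterval
open Path.Homotopic (Quotient.mk)
open Path.Homotopic.Quotient

variable [FiniteDimensional ℝ E] {ω : BilinForm ℝ E} [hω : IsSymplForm ω]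

/-- The Lagrangian subspaces transversal to a given one. -/
abbrev Chart (M : Lag ω) := {A : Lag ω // M.1 ⊓ A.1 = ⊥}

theorem Chart.isChartProj {M : Lag ω} (A : Chart M) : IsChartProj ω M.1 (chartProj A.1.1 M.1) :=
  isChartProj_chartProj (inf_comm M.1 A.1.1 ▸ A.2)

/-- The straight line homotopy in a chart. -/
noncomputable def Chart.line {M : Lag ω} (A B : Chart M) (s : ℝ) : Chart M :=
  ⟨(A.isChartProj.combo B.isChartProj s).lag,
    inf_comm M.1 _ ▸ (A.isChartProj.combo B.isChartProj s).lag_inf⟩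

theorem Chart.continuous_line {M : Lag ω} (B : Chart M) :
    Continuous fun p : I × Chart M => p.2.line B p.1 := by
  refine Continuous.subtype_mk ?_ _
  rw [continuous_iff_continuousAt]
  intro p
  refine lag_continuousAt_of_idem (Q := fun p : I × Chart M =>
    (1 - (p.1 : ℝ)) • chartProj p.2.1.1 M.1 + (p.1 : ℝ) • chartProj B.1.1 M.1) ?_
    (Eventually.of_forall fun q => ⟨(q.2.isChartProj.combo B.isChartProj _).idem, rfl⟩)
  have h := continuousAt_chartProj (f := fun p : I × Chart M => p.2.1) (g := fun _ => M) (y := p)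
    (by fun_prop) (by fun_prop) (inf_comm M.1 p.2.1.1 ▸ p.2.2)
  have hs : ContinuousAt (fun p : I × Chart M => (p.1 : ℝ)) p := by fun_prop
  exact ((continuousAt_const.sub hs).smul h).add (hs.smul continuousAt_const)

theorem Chart.line_zero {M : Lag ω} (A B : Chart M) : A.line B 0 = A := by
  apply Subtype.ext; apply Subtype.ext
  change LinearMap.range (((1 - (0 : ℝ)) • chartProj A.1.1 M.1 + (0 : ℝ) • chartProj B.1.1 M.1 :
    E →L[ℝ] E) : E →ₗ[ℝ] E) = _
  rw [sub_zero, one_smul, zero_smul, add_zero, chartProj_range (inf_comm M.1 A.1.1 ▸ A.2)]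

theorem Chart.line_one {M : Lag ω} (A B : Chart M) : A.line B 1 = B := by
  apply Subtype.ext; apply Subtype.ext
  change LinearMap.range (((1 - (1 : ℝ)) • chartProj A.1.1 M.1 + (1 : ℝ) • chartProj B.1.1 M.1 :
    E →L[ℝ] E) : E →ₗ[ℝ] E) = _
  rw [sub_self, one_smul, zero_smul, zero_add, chartProj_range (inf_comm M.1 B.1.1 ▸ B.2)]

instance (M : Lag ω) : ContractibleSpace (Chart M) := by
  rw [contractible_iff_id_nullhomotopic]
  obtain ⟨B, hB⟩ := exists_transv {M}
  let B₀ : Chart M := ⟨B, inf_comm B.1 M.1 ▸ hB M (by simp)⟩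
  exact ⟨B₀, ⟨⟨⟨_, B₀.continuous_line⟩, fun A => A.line_zero B₀, fun A => A.line_one B₀⟩⟩⟩

/-- The class of the paths from `A` to `B` in a chart. -/
noncomputable def chartCls (M : Lag ω) {A B : Lag ω} (hA : M.1 ⊓ A.1 = ⊥) (hB : M.1 ⊓ B.1 = ⊥) :
    Path.Homotopic.Quotient A B :=
  simplyCls (⟨Subtype.val, continuous_subtype_val⟩ : C(Chart M, Lag ω)) ⟨A, hA⟩ ⟨B, hB⟩ rfl rfl

theorem mk_eq_chartCls {M A B : Lag ω} (hA : M.1 ⊓ A.1 = ⊥) (hB : M.1 ⊓ B.1 = ⊥)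
    (p : Path A B) (h : ∀ t, M.1 ⊓ (p t).1 = ⊥) : mk p = chartCls M hA hB :=
  mk_eq_simplyCls _ _ _ p ⟨fun t => ⟨p t, h t⟩, by fun_prop⟩ (fun _ => rfl)
    (Subtype.ext p.source) (Subtype.ext p.target)

theorem exists_chart_path {M A B : Lag ω} (hA : M.1 ⊓ A.1 = ⊥) (hB : M.1 ⊓ B.1 = ⊥) :
    ∃ p : Path A B, ∀ t, M.1 ⊓ (p t).1 = ⊥ := by
  let p := PathConnectedSpace.somePath (⟨A, hA⟩ : Chart M) ⟨B, hB⟩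
  exact ⟨p.map continuous_subtype_val, fun t => (p t).2⟩

theorem chartCls_self {M A : Lag ω} (hA : M.1 ⊓ A.1 = ⊥) :
    chartCls M hA hA = Path.Homotopic.Quotient.refl A := simplyCls_self _ _ _

theorem chartCls_trans {M A B C : Lag ω} (hA : M.1 ⊓ A.1 = ⊥) (hB : M.1 ⊓ B.1 = ⊥)
    (hC : M.1 ⊓ C.1 = ⊥) : (chartCls M hA hB).trans (chartCls M hB hC) = chartCls M hA hC :=
  simplyCls_trans _ _ _ _ _ _ _

theorem chartCls_symm {M A B : Lag ω} (hA : M.1 ⊓ A.1 = ⊥) (hB : M.1 ⊓ B.1 = ⊥) :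
    (chartCls M hA hB).symm = chartCls M hB hA := simplyCls_symm _ _ _ _ _

variable (ω) in
/-- Paths of symplectic maps starting at the identity. -/
structure SympPath where
  ofFun ::
  /-- the path -/
  toFun : I → E →L[ℝ] E
  cont : Continuous toFun
  symp : ∀ t, IsSymp ω (toFun t)
  zero : toFun 0 = 1

namespace SympPath

variable (v : SympPath ω)

/-- The action on Lagrangian subspaces. -/
def act (t : I) (L : Lag ω) : Lag ω := (v.symp t).act L

theorem mem_act {t : I} {L : Lag ω} {x : E} : x ∈ (v.act t L).1 ↔ ∃ y ∈ L.1, v.toFun t y = x :=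
  Iff.rfl

theorem act_zero (L : Lag ω) : v.act 0 L = L := by
  apply Subtype.ext
  ext x
  rw [mem_act]
  simp [v.zero]

theorem act_eq_self {t : I} {L : Lag ω} (h : ∀ x ∈ L.1, v.toFun t x = x) : v.act t L = L := by
  apply Subtype.ext
  ext x
  rw [mem_act]
  exact ⟨fun ⟨y, hy, e⟩ => e ▸ (h y hy).symm ▸ hy, fun hx => ⟨x, hx, h x hx⟩⟩

theorem continuous_act : Continuous fun p : I × Lag ω => v.act p.1 p.2 :=
  _root_.continuous_act (g := fun p : I × Lag ω => v.toFun p.1) (v.cont.comp continuous_fst)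
    (fun p => v.symp p.1) continuous_snd

theorem finrank_act_inf (t : I) (L M : Lag ω) :
    finrank ℝ ↥((v.act t L).1 ⊓ (v.act t M).1) = finrank ℝ ↥(L.1 ⊓ M.1) :=
  (v.symp t).finrank_act_inf L M

theorem act_transv (t : I) {L M : Lag ω} (h : L.1 ⊓ M.1 = ⊥) :
    (v.act t L).1 ⊓ (v.act t M).1 = ⊥ := (v.symp t).act_transv h

/-- The path of a single subspace. -/
noncomputable def path (L : Lag ω) {L' : Lag ω} (h : v.act 1 L = L') : Path L L' where
  toFun t := v.act t L
  continuous_toFun := v.continuous_act.comp (f := fun t : I => (t, L)) (by fun_prop)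
  source' := v.act_zero L
  target' := h

theorem path_apply {L L' : Lag ω} (h : v.act 1 L = L') (t : I) : v.path L h t = v.act t L := rfl

/-- The image of a path under the endpoint. -/
noncomputable def mapPath {A B A' B' : Lag ω} (p : Path A B) (hA : v.act 1 A = A')
    (hB : v.act 1 B = B') :
    Path A' B' where
  toFun t := v.act 1 (p t)
  continuous_toFun := v.continuous_act.comp (f := fun t : I => ((1 : I), p t)) (by fun_prop)
  source' := by rw [p.source, hA]
  target' := by rw [p.target, hB]

theorem mk_mapPath {A B A' B' : Lag ω} (p : Path A B) (hA : v.act 1 A = A')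
    (hB : v.act 1 B = B') :
    (mk p).trans (mk (v.path B hB)) = (mk (v.path A hA)).trans (mk (v.mapPath p hA hB)) := by
  refine mk_square ⟨fun q => v.act q.1 (p q.2),
    v.continuous_act.comp (f := fun q : I × I => (q.1, p q.2)) (by fun_prop)⟩ _ _ _ _
    (fun t => v.act_zero _) (fun t => ?_) (fun t => ?_) (fun t => rfl)
  · simp [path_apply]
  · simp [path_apply]

theorem mk_mapPath' {A B A' B' : Lag ω} (p : Path A B) (hA : v.act 1 A = A')
    (hB : v.act 1 B = B') :
    mk p = ((mk (v.path A hA)).trans (mk (v.mapPath p hA hB))).trans (mk (v.path B hB)).symm := by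
  rw [← mk_mapPath, trans_assoc, trans_symm, trans_refl]

theorem isSymp_shear {M L L' : Lag ω} (hL : M.1 ⊓ L.1 = ⊥) (hL' : M.1 ⊓ L'.1 = ⊥) (t : ℝ) :
    IsSymp ω (1 + t • (chartProj L'.1 M.1 - chartProj L.1 M.1)) := by
  have h := isChartProj_chartProj (inf_comm M.1 L.1 ▸ hL)
  have h' := isChartProj_chartProj (inf_comm M.1 L'.1 ▸ hL')
  intro x y
  have hm : ∀ x, (chartProj L'.1 M.1 - chartProj L.1 M.1) x ∈ M.1 := fun x => by
    have e : (chartProj L'.1 M.1 - chartProj L.1 M.1) x =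
        (x - chartProj L.1 M.1 x) - (x - chartProj L'.1 M.1 x) := by
      rw [_root_.sub_apply]; abel
    exact e ▸ M.1.sub_mem (h.sub_mem x) (h'.sub_mem x)
  have e0 := M.2.apply (hm x) (hm y)
  have e1 := h.symp x y
  have e2 := h'.symp x y
  simp only [_root_.add_apply, _root_.smul_apply, _root_.sub_apply, one_apply_eq_self, map_add,
    map_smul, map_sub, LinearMap.add_apply, LinearMap.sub_apply, LinearMap.smul_apply,
    smul_eq_mul] at e0 ⊢
  linear_combination t ^ 2 * e0 + t * (e2 - e1)

/-- The shear along `M` from `L` to `L'`. -/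
noncomputable def shear {M L L' : Lag ω} (hL : M.1 ⊓ L.1 = ⊥) (hL' : M.1 ⊓ L'.1 = ⊥) :
    SympPath ω where
  toFun t := 1 + (t : ℝ) • (chartProj L'.1 M.1 - chartProj L.1 M.1)
  cont := by fun_prop
  symp t := isSymp_shear hL hL' t
  zero := by simp

theorem shear_fix {M L L' : Lag ω} (hL : M.1 ⊓ L.1 = ⊥) (hL' : M.1 ⊓ L'.1 = ⊥) (t : I) :
    (shear hL hL').act t M = M := by
  refine act_eq_self _ fun x hx => ?_
  change (1 + (t : ℝ) • (chartProj L'.1 M.1 - chartProj L.1 M.1)) x = x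
  have e1 := (isChartProj_chartProj (inf_comm M.1 L.1 ▸ hL)).map_eq_zero x hx
  have e2 := (isChartProj_chartProj (inf_comm M.1 L'.1 ▸ hL')).map_eq_zero x hx
  simp [e1, e2]

theorem shear_one {M L L' : Lag ω} (hL : M.1 ⊓ L.1 = ⊥) (hL' : M.1 ⊓ L'.1 = ⊥) :
    (shear hL hL').act 1 L = L' := by
  apply Subtype.ext
  refine Submodule.eq_of_le_of_finrank_eq ?_ ?_
  · rintro _ ⟨x, hx, rfl⟩
    change (1 + ((1 : I) : ℝ) • (chartProj L'.1 M.1 - chartProj L.1 M.1)) x ∈ L'.1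
    have e1 : chartProj L.1 M.1 x = x := chartProj_left (Lag.isCompl (inf_comm M.1 L.1 ▸ hL)) hx
    simp only [Set.Icc.coe_one, one_smul, _root_.add_apply, one_apply_eq_self, _root_.sub_apply, e1,
      add_sub_cancel]
    exact chartProj_mem x
  · exact ((shear hL hL').act 1 L).2.finrank_eq L'.2

end SympPath

end ChartSpace

section PathIndex

open Filter Topology Module unitInterval
open Path.Homotopic (Quotient.mk)
open Path.Homotopic.Quotient

variable [FiniteDimensional ℝ E] {ω : BilinForm ℝ E} [hω : IsSymplForm ω]

instance : LocallyPathConnectedSpace I :=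
  (isQuotientMap_projIcc (h := zero_le_one (α := ℝ))).locallyPathConnectedSpace

/-- The dimension of the intersection of two Lagrangian subspaces. -/
noncomputable def interDim (L M : Lag ω) : ℕ := finrank ℝ ↥(L.1 ⊓ M.1)

theorem interDim_eq_zero {L M : Lag ω} (h : L.1 ⊓ M.1 = ⊥) : interDim L M = 0 := by
  unfold interDim
  rw [h, finrank_bot]

theorem SympPath.interDim_act (v : SympPath ω) (t : I) (L M : Lag ω) :
    interDim (v.act t L) (v.act t M) = interDim L M := v.finrank_act_inf t L M

/-- The Maslov type index of a path of pairs of Lagrangian subspaces. -/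
noncomputable def pathInd {x y : Lag ω × Lag ω} (γ : Path x y) : ℤ :=
  (exists_isMaslovPrim γ.continuous.fst γ.continuous.snd).choose 0 -
    (exists_isMaslovPrim γ.continuous.fst γ.continuous.snd).choose 1

theorem pathInd_eq {x y : Lag ω × Lag ω} (γ : Path x y) {φ : I → ℤ}
    (h : IsMaslovPrim (fun t => (γ t).1) (fun t => (γ t).2) φ) : pathInd γ = φ 0 - φ 1 :=
  (exists_isMaslovPrim γ.continuous.fst γ.continuous.snd).choose_spec.sub_eq h 0 1

theorem pathInd_eq_of_comp {Y : Type*} [TopologicalSpace Y] {A B : Y → Lag ω} {φ : Y → ℤ}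
    (h : IsMaslovPrim A B φ) {x y : Lag ω × Lag ω} (γ : Path x y) {g : I → Y} (hg : Continuous g)
    (hγ : ∀ t, γ t = (A (g t), B (g t))) : pathInd γ = φ (g 0) - φ (g 1) := by
  have := h.comp hg
  refine pathInd_eq γ (φ := φ ∘ g) ?_
  convert this using 1
  · ext1 t; rw [hγ]; rfl
  · ext1 t; rw [hγ]; rfl

theorem pathInd_eq_zero {x y : Lag ω × Lag ω} (γ : Path x y) {d : ℕ}
    (h : ∀ t, interDim (γ t).1 (γ t).2 = d) : pathInd γ = 0 := by
  obtain ⟨φ, hφ⟩ := exists_isMaslovPrim γ.continuous.fst γ.continuous.snd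
  rw [pathInd_eq γ hφ, hφ.const_of_finrank γ.continuous.fst γ.continuous.snd h 0 1, sub_self]

theorem pathInd_homotopic {x y : Lag ω × Lag ω} {γ δ : Path x y} (h : γ.Homotopic δ) :
    pathInd γ = pathInd δ := by
  obtain ⟨F⟩ := h
  obtain ⟨φ, hφ⟩ := exists_isMaslovPrim (A := fun q : I × I => (F q).1)
    (B := fun q : I × I => (F q).2) (by fun_prop) (by fun_prop)
  rw [pathInd_eq_of_comp hφ γ (g := fun t => (0, t)) (by fun_prop) (fun t => by simp),
    pathInd_eq_of_comp hφ δ (g := fun t => (1, t)) (by fun_prop) (fun t => by simp)]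
  have h0 : φ (0, 0) = φ (1, 0) := (hφ.comp (g := fun s : I => (s, (0 : I))) (by fun_prop)
    ).const_of_finrank (by fun_prop) (by fun_prop) (d := interDim x.1 x.2)
    (fun s => congrArg (fun z : Lag ω × Lag ω => interDim z.1 z.2) (F.source s)) 0 1
  have h1 : φ (0, 1) = φ (1, 1) := (hφ.comp (g := fun s : I => (s, (1 : I))) (by fun_prop)
    ).const_of_finrank (by fun_prop) (by fun_prop) (d := interDim y.1 y.2)
    (fun s => congrArg (fun z : Lag ω × Lag ω => interDim z.1 z.2) (F.target s)) 0 1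
  rw [h0, h1]

/-- The index of a path class. -/
noncomputable def clsInd {x y : Lag ω × Lag ω} : Path.Homotopic.Quotient x y → ℤ :=
  _root_.Quotient.lift pathInd fun _ _ h => pathInd_homotopic h

theorem clsInd_mk {x y : Lag ω × Lag ω} (γ : Path x y) : clsInd (mk γ) = pathInd γ := rfl

theorem clsInd_trans {x y z : Lag ω × Lag ω} (p : Path.Homotopic.Quotient x y)
    (q : Path.Homotopic.Quotient y z) : clsInd (p.trans q) = clsInd p + clsInd q := by
  induction p using Path.Homotopic.Quotient.ind with | _ p
  induction q using Path.Homotopic.Quotient.ind with | _ q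
  rw [← mk_trans, clsInd_mk, clsInd_mk, clsInd_mk]
  obtain ⟨φ, hφ⟩ := exists_isMaslovPrim (p.trans q).continuous.fst (p.trans q).continuous.snd
  let g : I → I := fun t => ⟨(t : ℝ) / 2, by linarith [t.2.1], by linarith [t.2.2]⟩
  let g' : I → I := fun t => ⟨((t : ℝ) + 1) / 2, by linarith [t.2.1], by linarith [t.2.2]⟩
  have e1 := pathInd_eq_of_comp hφ p (g := g) (by fun_prop) (fun t => by
    have : (p.trans q) (g t) = p t := by
      rw [Path.trans_apply, dif_pos (by simp only [g]; linarith [t.2.2])]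
      congr 1
      ext
      simp only [g]; ring
    rw [this])
  have e2 := pathInd_eq_of_comp hφ q (g := g') (by fun_prop) (fun t => by
    have : (p.trans q) (g' t) = q t := by
      rw [Path.trans_apply]
      split_ifs with h
      · have : t = 0 := by
          exact Subtype.ext (le_antisymm (by simp only [g'] at h; simp; linarith) t.2.1)
        subst this
        have : p ⟨2 * (g' 0 : ℝ), by simp [g']⟩ = p 1 := by congr 1; ext; simp [g']
        rw [this]; simp
      · congr 1
        ext
        simp only [g']; ring
    rw [this])
  have e0 : g 0 = 0 := by ext; simp [g]
  have e : g 1 = g' 0 := by ext; simp [g, g']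
  have e1' : g' 1 = 1 := by ext; simp [g']
  rw [pathInd_eq _ hφ, e1, e2, e0, e, e1']
  ring

theorem clsInd_refl (x : Lag ω × Lag ω) : clsInd (Path.Homotopic.Quotient.refl x) = 0 := by
  have := clsInd_trans (Path.Homotopic.Quotient.refl x) (Path.Homotopic.Quotient.refl x)
  rw [refl_trans] at this
  omega

theorem clsInd_symm {x y : Lag ω × Lag ω} (p : Path.Homotopic.Quotient x y) :
    clsInd p.symm = - clsInd p := by
  have := clsInd_trans p p.symm
  rw [trans_symm, clsInd_refl] at this
  omega

end PathIndex

section Frame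

open Filter Topology Module unitInterval Matrix

/-- Symplectic coordinates. -/
structure SympFrame (ω : BilinForm ℝ E) (n : ℕ) where
  ofCoord ::
  /-- the coordinates -/
  coord : E ≃L[ℝ] (Fin n → ℝ) × (Fin n → ℝ)
  form : ∀ x y, ω x y = (coord x).1 ⬝ᵥ (coord y).2 - (coord x).2 ⬝ᵥ (coord y).1

variable [FiniteDimensional ℝ E] {ω : BilinForm ℝ E} [hω : IsSymplForm ω] {n : ℕ}

theorem exists_sympFrame {L M : Lag ω} (h : L.1 ⊓ M.1 = ⊥) (hn : finrank ℝ L.1 = n) :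
    ∃ Ψ : SympFrame ω n, (∀ x, x ∈ L.1 ↔ (Ψ.coord x).2 = 0) ∧
      ∀ x, x ∈ M.1 ↔ (Ψ.coord x).1 = 0 := by
  subst hn
  let e := finBasis ℝ L.1
  let π : E →ₗ[ℝ] L.1 := LinearMap.codRestrict L.1 (chartProj L.1 M.1 : E →ₗ[ℝ] E)
    (fun x => chartProj_mem x)
  have hc := Lag.isCompl h
  have hπ0 : ∀ x, π x = 0 ↔ x ∈ M.1 := fun x => by
    constructor
    · intro hx
      have := sub_chartProj_mem hc x
      rwa [show chartProj L.1 M.1 x = 0 from congrArg Subtype.val hx, sub_zero] at this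
    · exact fun hx => Subtype.ext (chartProj_right hc hx)
  have hsum : ∀ l : L.1, ∑ i, e.equivFun l i • (e i : E) = l := fun l => by
    have := congrArg (Subtype.val) (e.sum_equivFun l)
    simpa only [Submodule.coe_sum, Submodule.coe_smul] using this
  have hq : ∀ x, (∀ i, ω (e i : E) x = 0) ↔ x ∈ L.1 := fun x => by
    constructor
    · intro hx
      refine L.2.mem fun y hy => ?_
      have e1 := hsum ⟨y, hy⟩
      dsimp only at e1
      rw [← e1, map_sum, LinearMap.sum_apply]
      simp [hx]
    · exact fun hx i => L.2.apply (e i).2 hx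
  let Φ : E →ₗ[ℝ] (Fin (finrank ℝ L.1) → ℝ) × (Fin (finrank ℝ L.1) → ℝ) :=
    ((e.equivFun : L.1 →ₗ[ℝ] _) ∘ₗ π).prod (LinearMap.pi fun i => ω (e i : E))
  have h1 : ∀ x, (Φ x).1 = 0 ↔ x ∈ M.1 := fun x => by
    rw [← hπ0]
    exact e.equivFun.map_eq_zero_iff
  have h2 : ∀ x, (Φ x).2 = 0 ↔ x ∈ L.1 := fun x => by
    rw [← hq]
    exact funext_iff
  have hinj : Function.Injective Φ := by
    refine (injective_iff_map_eq_zero _).2 fun x hx => ?_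
    have : x ∈ L.1 ⊓ M.1 := ⟨(h2 x).1 (by rw [hx]; rfl), (h1 x).1 (by rw [hx]; rfl)⟩
    rwa [h] at this
  let Ψ := (LinearEquiv.ofInjectiveOfFinrankEq Φ hinj (by
    rw [L.2.finrank_add_self]; simp)).toContinuousLinearEquiv
  have hΨ : ∀ x, Ψ x = Φ x := fun x => rfl
  refine ⟨⟨Ψ, fun x y => ?_⟩, fun x => by rw [hΨ, h2], fun x => by rw [hΨ, h1]⟩
  have key : ∀ x y, (Φ x).1 ⬝ᵥ (Φ y).2 = ω (π x) y := fun x y => by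
    rw [← hsum (π x), map_sum, LinearMap.sum_apply]
    simp [dotProduct, Φ]
  rw [hΨ, hΨ, key, dotProduct_comm, key]
  have e1 := M.2.apply (sub_chartProj_mem hc x) (sub_chartProj_mem hc y)
  have e2 := L.2.apply (π x).2 (π y).2
  change ω (x - π x) (y - π y) = 0 at e1
  simp only [map_sub, LinearMap.sub_apply] at e1
  rw [symp_swap ω (π y : E) x]
  linear_combination e1 - e2

namespace SympFrame

variable (Ψ : SympFrame ω n)

/-- Transport of an endomorphism. -/
noncomputable def conj (A : (Fin n → ℝ) × (Fin n → ℝ) →L[ℝ] (Fin n → ℝ) × (Fin n → ℝ)) :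
    E →L[ℝ] E :=
  (Ψ.coord.symm : (Fin n → ℝ) × (Fin n → ℝ) →L[ℝ] E) ∘L A ∘L
    (Ψ.coord : E →L[ℝ] (Fin n → ℝ) × (Fin n → ℝ))

theorem coord_conj (A : (Fin n → ℝ) × (Fin n → ℝ) →L[ℝ] (Fin n → ℝ) × (Fin n → ℝ)) (x : E) :
    Ψ.coord (Ψ.conj A x) = A (Ψ.coord x) := by simp [conj]

theorem isSymp_conj {A : (Fin n → ℝ) × (Fin n → ℝ) →L[ℝ] (Fin n → ℝ) × (Fin n → ℝ)}
    (h : ∀ x y, (A x).1 ⬝ᵥ (A y).2 - (A x).2 ⬝ᵥ (A y).1 = x.1 ⬝ᵥ y.2 - x.2 ⬝ᵥ y.1) :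
    IsSymp ω (Ψ.conj A) := fun x y => by
  rw [Ψ.form, coord_conj, coord_conj, h, ← Ψ.form]

/-- The subspace `q = 0`. -/
noncomputable def base : Lag ω :=
  ⟨LinearMap.ker (LinearMap.snd ℝ (Fin n → ℝ) (Fin n → ℝ) ∘ₗ (Ψ.coord : E →ₗ[ℝ] _)), by
    apply isLagrangian_of_isotropic
    · intro x hx y hy
      have hx : (Ψ.coord x).2 = 0 := hx
      have hy : (Ψ.coord y).2 = 0 := hy
      rw [Ψ.form, hx, hy]; simp
    · have e1 := LinearMap.finrank_range_add_finrank_ker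
        (LinearMap.snd ℝ (Fin n → ℝ) (Fin n → ℝ) ∘ₗ (Ψ.coord : E →ₗ[ℝ] _))
      rw [LinearMap.range_eq_top.2 (by
        exact Prod.snd_surjective.comp Ψ.coord.surjective), finrank_top] at e1
      have e2 := Ψ.coord.toLinearEquiv.finrank_eq
      simp at e1 e2
      omega⟩

theorem mem_base {x : E} : x ∈ Ψ.base.1 ↔ (Ψ.coord x).2 = 0 := Iff.rfl

/-- Rotation in each coordinate plane. -/
noncomputable def rotAux (θ : Fin n → ℝ) :
    (Fin n → ℝ) × (Fin n → ℝ) →L[ℝ] (Fin n → ℝ) × (Fin n → ℝ) :=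
  LinearMap.toContinuousLinearMap
    { toFun := fun x => (fun i => Real.cos (θ i) * x.1 i - Real.sin (θ i) * x.2 i,
        fun i => Real.sin (θ i) * x.1 i + Real.cos (θ i) * x.2 i)
      map_add' := fun x y => by ext i <;> simp <;> ring
      map_smul' := fun c x => by ext i <;> simp <;> ring }

theorem rotAux_apply (θ : Fin n → ℝ) (x : (Fin n → ℝ) × (Fin n → ℝ)) : rotAux θ x =
    (fun i => Real.cos (θ i) * x.1 i - Real.sin (θ i) * x.2 i,
        fun i => Real.sin (θ i) * x.1 i + Real.cos (θ i) * x.2 i) := rfl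

/-- Rotation in each coordinate plane. -/
noncomputable def rot (θ : Fin n → ℝ) : E →L[ℝ] E := Ψ.conj (rotAux θ)

theorem isSymp_rot (θ : Fin n → ℝ) : IsSymp ω (Ψ.rot θ) := by
  refine Ψ.isSymp_conj fun x y => ?_
  simp only [rotAux_apply, dotProduct]
  rw [← Finset.sum_sub_distrib, ← Finset.sum_sub_distrib]
  refine Finset.sum_congr rfl fun i _ => ?_
  linear_combination (x.1 i * y.2 i - x.2 i * y.1 i) * Real.sin_sq_add_cos_sq (θ i)

theorem continuous_rot : Continuous Ψ.rot := by
  refine continuous_const.clm_comp (Continuous.clm_comp ?_ continuous_const)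
  rw [continuous_clm_apply]
  intro x
  simp only [rotAux_apply]
  fun_prop

/-- The torus of Lagrangian subspaces. -/
noncomputable def torus (θ : Fin n → ℝ) : Lag ω := (Ψ.isSymp_rot θ).act Ψ.base

theorem continuous_torus : Continuous Ψ.torus :=
  continuous_act Ψ.continuous_rot Ψ.isSymp_rot continuous_const

theorem mem_torus {θ : Fin n → ℝ} {x : E} : x ∈ (Ψ.torus θ).1 ↔
    ∀ i, Real.cos (θ i) * (Ψ.coord x).2 i = Real.sin (θ i) * (Ψ.coord x).1 i := by
  constructor
  · rintro ⟨y, hy, rfl⟩ i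
    have hy : (Ψ.coord y).2 = 0 := hy
    change Real.cos (θ i) * (Ψ.coord (Ψ.conj _ y)).2 i = Real.sin (θ i) * (Ψ.coord (Ψ.conj _ y)).1 i
    rw [coord_conj, rotAux_apply, hy]
    simp; ring
  · intro h
    refine ⟨Ψ.coord.symm (fun i => Real.cos (θ i) * (Ψ.coord x).1 i +
      Real.sin (θ i) * (Ψ.coord x).2 i, 0), by simp [mem_base], ?_⟩
    apply Ψ.coord.injective
    change Ψ.coord (Ψ.conj _ _) = _
    rw [coord_conj, rotAux_apply]
    ext i
    · simp only [ContinuousLinearEquiv.apply_symm_apply, Pi.zero_apply]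
      linear_combination Real.sin (θ i) * h i + (Ψ.coord x).1 i * Real.sin_sq_add_cos_sq (θ i)
    · simp only [ContinuousLinearEquiv.apply_symm_apply, Pi.zero_apply]
      linear_combination -Real.cos (θ i) * h i + (Ψ.coord x).2 i * Real.sin_sq_add_cos_sq (θ i)

theorem lag_ext {L M : Lag ω} (h : ∀ x, x ∈ L.1 ↔ x ∈ M.1) : L = M :=
  Subtype.ext (Submodule.ext h)

theorem torus_zero : Ψ.torus 0 = Ψ.base := lag_ext fun x => by
  rw [mem_torus, mem_base]
  simp [funext_iff]

/-- The subspace `p = 0`. -/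
noncomputable def cobase : Lag ω := Ψ.torus fun _ => Real.pi / 2

theorem mem_cobase {x : E} : x ∈ Ψ.cobase.1 ↔ (Ψ.coord x).1 = 0 := by
  rw [cobase, mem_torus]
  simp [funext_iff, eq_comm]

theorem torus_add_pi (θ : Fin n → ℝ) (k : Fin n → ℤ) :
    Ψ.torus (fun i => θ i + k i * Real.pi) = Ψ.torus θ := lag_ext fun x => by
  rw [mem_torus, mem_torus]
  refine forall_congr' fun i => ?_
  rw [Real.cos_add_int_mul_pi, Real.sin_add_int_mul_pi, mul_assoc, mul_assoc]
  rcases Int.even_or_odd (k i) with h | h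
  · rw [h.neg_one_zpow, one_mul, one_mul]
  · rw [h.neg_one_zpow, neg_one_mul, neg_one_mul, neg_inj]

theorem rot_torus (θ η : Fin n → ℝ) : (Ψ.isSymp_rot θ).act (Ψ.torus η) = Ψ.torus (θ + η) := by
  apply lag_ext
  have key : ∀ y, Ψ.rot θ (Ψ.rot η y) = Ψ.rot (θ + η) y := fun y => by
    apply Ψ.coord.injective
    change Ψ.coord (Ψ.conj _ (Ψ.conj _ _)) = Ψ.coord (Ψ.conj _ _)
    rw [coord_conj, coord_conj, coord_conj]
    ext i
    · simp only [rotAux_apply, Pi.add_apply, Real.cos_add, Real.sin_add]; ring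
    · simp only [rotAux_apply, Pi.add_apply, Real.cos_add, Real.sin_add]; ring
  intro x
  constructor
  · rintro ⟨_, ⟨y, hy, rfl⟩, rfl⟩
    exact ⟨y, hy, (key y).symm⟩
  · rintro ⟨y, hy, rfl⟩
    exact ⟨_, ⟨y, hy, rfl⟩, key y⟩

theorem torus_inf_torus {θ η : Fin n → ℝ} (h : ∀ i, Real.sin (θ i - η i) ≠ 0) :
    (Ψ.torus θ).1 ⊓ (Ψ.torus η).1 = ⊥ := by
  rw [Submodule.eq_bot_iff]
  rintro x ⟨hx, hy⟩
  rw [SetLike.mem_coe, mem_torus] at hx hy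
  apply Ψ.coord.injective
  rw [map_zero]
  ext i
  · apply (mul_eq_zero.1 (?_ : Real.sin (θ i - η i) * _ = 0)).resolve_left (h i)
    rw [Real.sin_sub]
    linear_combination Real.cos (θ i) * hy i - Real.cos (η i) * hx i
  · apply (mul_eq_zero.1 (?_ : Real.sin (θ i - η i) * _ = 0)).resolve_left (h i)
    rw [Real.sin_sub]
    linear_combination Real.sin (θ i) * hy i - Real.sin (η i) * hx i

theorem base_inf_torus {θ : Fin n → ℝ} (h : ∀ i, Real.sin (θ i) ≠ 0) :
    Ψ.base.1 ⊓ (Ψ.torus θ).1 = ⊥ := by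
  rw [← torus_zero]
  exact Ψ.torus_inf_torus fun i => by simpa using h i

theorem cobase_inf_torus {θ : Fin n → ℝ} (h : ∀ i, Real.cos (θ i) ≠ 0) :
    Ψ.cobase.1 ⊓ (Ψ.torus θ).1 = ⊥ :=
  Ψ.torus_inf_torus fun i => by rw [Real.sin_pi_div_two_sub]; exact h i

theorem cobase_inf_base : Ψ.cobase.1 ⊓ Ψ.base.1 = ⊥ := by
  rw [← torus_zero]
  exact Ψ.cobase_inf_torus fun i => by simp

theorem interDim_base_torus (θ : Fin n → ℝ) :
    interDim Ψ.base (Ψ.torus θ) = Fintype.card {i // Real.sin (θ i) = 0} := by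
  let f : ({i // Real.sin (θ i) = 0} → ℝ) →ₗ[ℝ] E :=
    (Ψ.coord.symm : (Fin n → ℝ) × (Fin n → ℝ) →ₗ[ℝ] E) ∘ₗ LinearMap.inl ℝ _ _ ∘ₗ
      Function.ExtendByZero.linearMap ℝ Subtype.val
  have hf1 : ∀ u, Ψ.coord (f u) = (Function.extend Subtype.val u 0, 0) := fun u =>
    Ψ.coord.apply_symm_apply _
  have hf : Function.Injective f := by
    intro u v huv
    have h1 := congrArg Ψ.coord huv
    rw [hf1, hf1] at h1
    ext i
    have := congrFun (congrArg Prod.fst h1) i.1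
    simpa only [Subtype.val_injective.extend_apply] using this
  have hr : LinearMap.range f = Ψ.base.1 ⊓ (Ψ.torus θ).1 := by
    ext x
    constructor
    · rintro ⟨u, rfl⟩
      refine ⟨?_, ?_⟩
      · rw [SetLike.mem_coe, mem_base, hf1]
      · rw [SetLike.mem_coe, mem_torus, hf1]
        intro i
        by_cases h : Real.sin (θ i) = 0
        · simp [h]
        · have : ¬ ∃ a : {i // Real.sin (θ i) = 0}, a.1 = i := fun ⟨a, ha⟩ => h (ha ▸ a.2)
          simp [Function.extend_apply' _ _ _ this]
    · rintro ⟨h1, h2⟩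
      rw [SetLike.mem_coe, mem_base] at h1
      rw [SetLike.mem_coe, mem_torus] at h2
      refine ⟨fun i => (Ψ.coord x).1 i, ?_⟩
      apply Ψ.coord.injective
      rw [hf1]
      refine Prod.ext ?_ h1.symm
      ext i
      by_cases h : Real.sin (θ i) = 0
      · have := Subtype.val_injective.extend_apply
          (fun i : {i // Real.sin (θ i) = 0} => (Ψ.coord x).1 i) 0 ⟨i, h⟩
        exact this
      · have h0 := h2 i
        rw [h1, Pi.zero_apply, mul_zero, eq_comm, mul_eq_zero, or_iff_right h] at h0
        have : ¬ ∃ a : {i // Real.sin (θ i) = 0}, a.1 = i := fun ⟨a, ha⟩ => h (ha ▸ a.2)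
        simp [Function.extend_apply' _ _ _ this, h0]
  unfold interDim
  rw [← hr, LinearMap.finrank_range_of_inj hf, finrank_fintype_fun_eq_card]

end SympFrame

end Frame

section LinearGroup

open Filter Topology Module unitInterval Matrix

theorem exists_path_to_sign {n : ℕ} (A : Matrix (Fin n) (Fin n) ℝ) (hA : A.det ≠ 0) :
    ∃ s : Fin n → ℝ, (∀ i, s i * s i = 1) ∧
      JoinedIn {B : Matrix (Fin n) (Fin n) ℝ | B.det ≠ 0} A (diagonal s) := by
  have hmul : ∀ {A A' B B' : Matrix (Fin n) (Fin n) ℝ}, JoinedIn {B | B.det ≠ 0} A A' →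
      JoinedIn {B | B.det ≠ 0} B B' → JoinedIn {B | B.det ≠ 0} (A * B) (A' * B') := by
    rintro A A' B B' ⟨γ, hγ⟩ ⟨δ, hδ⟩
    refine ⟨⟨⟨fun t => γ t * δ t, γ.continuous.matrix_mul δ.continuous⟩, by simp, by simp⟩,
      fun t => ?_⟩
    change (γ t * δ t).det ≠ 0
    rw [det_mul]
    exact mul_ne_zero (hγ t) (hδ t)
  refine diagonal_transvection_induction_of_det_ne_zero (fun A => ∃ s : Fin n → ℝ,
    (∀ i, s i * s i = 1) ∧ JoinedIn {B : Matrix (Fin n) (Fin n) ℝ | B.det ≠ 0} A (diagonal s))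
    A hA ?_ ?_ ?_
  · intro D hD
    rw [det_diagonal, Finset.prod_ne_zero_iff] at hD
    have hs : ∀ i, D i / |D i| * (D i / |D i|) = 1 := fun i => by
      have := abs_ne_zero.2 (hD i (Finset.mem_univ i))
      field_simp
      exact (sq_abs _).symm
    refine ⟨fun i => D i / |D i|, hs, ⟨⟨fun t => diagonal fun i =>
      D i * ((1 - (t : ℝ)) + t * |D i|⁻¹), ?_⟩, ?_, ?_⟩, fun t => ?_⟩
    · exact Continuous.matrix_diagonal (by fun_prop)
    · simp
    · simp [div_eq_mul_inv]
    · change (diagonal fun i => D i * ((1 - (t : ℝ)) + t * |D i|⁻¹)).det ≠ 0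
      rw [det_diagonal, Finset.prod_ne_zero_iff]
      intro i hi
      refine mul_ne_zero (hD i hi) (ne_of_gt ?_)
      have h1 : 0 < |D i|⁻¹ := inv_pos.2 (abs_pos.2 (hD i hi))
      have h2 := t.2.1
      have h3 := t.2.2
      rcases eq_or_lt_of_le h2 with h | h
      · rw [← h]; norm_num
      · have := mul_pos h h1
        linarith
  · intro t
    refine ⟨fun _ => 1, fun _ => by norm_num, ⟨⟨fun u => transvection t.i t.j
      ((1 - (u : ℝ)) * t.c), ?_⟩, ?_, ?_⟩, fun u => ?_⟩
    · unfold transvection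
      refine continuous_const.add ?_
      refine continuous_matrix fun i j => ?_
      simp only [single_apply]
      split_ifs <;> fun_prop
    · simp [TransvectionStruct.toMatrix]
    · simp
    · change (transvection t.i t.j ((1 - (u : ℝ)) * t.c)).det ≠ 0
      rw [det_transvection_of_ne _ _ t.hij]
      exact one_ne_zero
  · rintro A B - - ⟨s, hs, h⟩ ⟨s', hs', h'⟩
    refine ⟨fun i => s i * s' i, fun i => ?_, ?_⟩
    · linear_combination (s' i * s' i) * hs i + hs' i
    · rw [← diagonal_mul_diagonal]
      exact hmul h h'

variable [FiniteDimensional ℝ E] {ω : BilinForm ℝ E} [hω : IsSymplForm ω] {n : ℕ}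

theorem lag_finrank_eq (L M : Lag ω) : finrank ℝ L.1 = finrank ℝ M.1 := L.2.finrank_eq M.2

namespace SympFrame

variable (Ψ : SympFrame ω n)

/-- A pair of matrices acting on the two blocks of coordinates. -/
noncomputable def blockAux (A B : Matrix (Fin n) (Fin n) ℝ) :
    (Fin n → ℝ) × (Fin n → ℝ) →L[ℝ] (Fin n → ℝ) × (Fin n → ℝ) :=
  LinearMap.toContinuousLinearMap (A.mulVecLin.prodMap B.mulVecLin)

theorem blockAux_apply (A B : Matrix (Fin n) (Fin n) ℝ) (x : (Fin n → ℝ) × (Fin n → ℝ)) :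
    blockAux A B x = (A *ᵥ x.1, B *ᵥ x.2) := rfl

theorem isSymp_block {A B : Matrix (Fin n) (Fin n) ℝ} (h : Aᵀ * B = 1) :
    IsSymp ω (Ψ.conj (blockAux A B)) := by
  refine Ψ.isSymp_conj fun x y => ?_
  have key : ∀ u v : Fin n → ℝ, (A *ᵥ u) ⬝ᵥ (B *ᵥ v) = u ⬝ᵥ v := fun u v => by
    rw [← vecMul_transpose, ← dotProduct_mulVec, mulVec_mulVec, h, one_mulVec]
  simp only [blockAux_apply]
  rw [key, dotProduct_comm (B *ᵥ x.2), key, dotProduct_comm y.1]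

theorem act_block_base {A B : Matrix (Fin n) (Fin n) ℝ} (h : Aᵀ * B = 1) :
    (Ψ.isSymp_block h).act Ψ.base = Ψ.base := by
  apply Subtype.ext
  refine Submodule.eq_of_le_of_finrank_eq ?_ (lag_finrank_eq _ _)
  rintro _ ⟨y, hy, rfl⟩
  rw [SetLike.mem_coe, mem_base] at hy
  rw [mem_base]
  change (Ψ.coord (Ψ.conj _ y)).2 = 0
  rw [coord_conj, blockAux_apply, hy, mulVec_zero]

theorem act_block_cobase {A B : Matrix (Fin n) (Fin n) ℝ} (h : Aᵀ * B = 1) :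
    (Ψ.isSymp_block h).act Ψ.cobase = Ψ.cobase := by
  apply Subtype.ext
  refine Submodule.eq_of_le_of_finrank_eq ?_ (lag_finrank_eq _ _)
  rintro _ ⟨y, hy, rfl⟩
  rw [SetLike.mem_coe, mem_cobase] at hy
  rw [mem_cobase]
  change (Ψ.coord (Ψ.conj _ y)).1 = 0
  rw [coord_conj, blockAux_apply, hy, mulVec_zero]

theorem exists_orthogonal_path {A : Matrix (Fin n) (Fin n) ℝ} (hA : A * Aᵀ = 1) :
    ∃ v : SympPath ω, (∀ t, v.act t Ψ.base = Ψ.base) ∧ (∀ t, v.act t Ψ.cobase = Ψ.cobase) ∧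
      ∃ s : Fin n → ℝ, (∀ i, s i * s i = 1) ∧ ∀ x, Ψ.coord (v.toFun 1 x) =
        (fun i => s i * (A *ᵥ (Ψ.coord x).1) i, fun i => s i * (A *ᵥ (Ψ.coord x).2) i) := by
  have hA' : Aᵀ * A = 1 := mul_eq_one_comm.1 hA
  have hdet : Aᵀ.det ≠ 0 := fun h => by
    have := congrArg det hA'
    rw [det_mul, h, zero_mul, det_one] at this
    exact zero_ne_one this
  obtain ⟨s, hs, γ, hγ⟩ := exists_path_to_sign _ hdet
  have hγ : ∀ t, (γ t).det ≠ 0 := hγ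
  have hu : ∀ t, IsUnit (γ t * A).det := fun t => by
    rw [det_mul]
    refine (mul_ne_zero (hγ t) ?_).isUnit
    rwa [det_transpose] at hdet
  have hinv : ∀ t, (γ t * A)ᵀ * ((γ t * A)⁻¹)ᵀ = 1 := fun t => by
    rw [← transpose_mul, nonsing_inv_mul _ (hu t), transpose_one]
  have hcA : Continuous fun t => γ t * A := γ.continuous.matrix_mul continuous_const
  have hcB : Continuous fun t => ((γ t * A)⁻¹)ᵀ := by
    refine Continuous.matrix_transpose ?_
    simp only [inv_def, Ring.inverse_eq_inv']
    refine Continuous.smul (hcA.matrix_det.inv₀ fun t => (hu t).ne_zero) hcA.matrix_adjugate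
  have hD : (diagonal s * A)⁻¹ᵀ = diagonal s * A := by
    rw [inv_eq_right_inv (B := Aᵀ * diagonal s)]
    · simp
    · rw [mul_assoc, ← mul_assoc A, hA, one_mul, diagonal_mul_diagonal]
      simp [hs]
  refine ⟨⟨fun t => Ψ.conj (blockAux (γ t * A) ((γ t * A)⁻¹)ᵀ), ?_, fun t =>
    Ψ.isSymp_block (hinv t), ?_⟩, fun t => Ψ.act_block_base (hinv t),
    fun t => Ψ.act_block_cobase (hinv t), s, hs, fun x => ?_⟩
  · refine continuous_const.clm_comp (Continuous.clm_comp ?_ continuous_const)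
    rw [continuous_clm_apply]
    intro x
    simp only [blockAux_apply]
    exact (hcA.matrix_mulVec continuous_const).prodMk (hcB.matrix_mulVec continuous_const)
  · ext1 x
    apply Ψ.coord.injective
    rw [coord_conj, blockAux_apply, γ.source, hA', inv_one, transpose_one, one_mulVec, one_mulVec]
    rfl
  · change Ψ.coord (Ψ.conj _ x) = _
    rw [coord_conj, blockAux_apply, γ.target, hD]
    simp only [← mulVec_mulVec]
    ext i <;> simp [mulVec_diagonal]

theorem exists_perm_path (τ : Equiv.Perm (Fin n)) :
    ∃ v : SympPath ω, (∀ t, v.act t Ψ.base = Ψ.base) ∧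
      ∀ θ, v.act 1 (Ψ.torus θ) = Ψ.torus (θ ∘ τ) := by
  obtain ⟨v, hv, -, s, hs, h⟩ := Ψ.exists_orthogonal_path (A := τ.permMatrix ℝ) (by
    rw [transpose_permMatrix, ← permMatrix_mul]; simp)
  refine ⟨v, hv, fun θ => ?_⟩
  apply Subtype.ext
  refine Submodule.eq_of_le_of_finrank_eq ?_ (lag_finrank_eq _ _)
  rintro _ ⟨y, hy, rfl⟩
  rw [SetLike.mem_coe, mem_torus] at hy
  rw [mem_torus]
  intro i
  change _ * (Ψ.coord (v.toFun 1 y)).2 i = _ * (Ψ.coord (v.toFun 1 y)).1 i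
  rw [h]
  simp only [permMatrix_mulVec, Function.comp_apply]
  linear_combination s i * hy (τ i)

theorem exists_graph {N : Lag ω} (hN : Ψ.cobase.1 ⊓ N.1 = ⊥) :
    ∃ S : Matrix (Fin n) (Fin n) ℝ, S.IsHermitian ∧
      ∀ x ∈ N.1, (Ψ.coord x).2 = S *ᵥ (Ψ.coord x).1 := by
  have hc := Lag.isCompl (inf_comm Ψ.cobase.1 N.1 ▸ hN)
  let g : (Fin n → ℝ) → E := fun p => chartProj N.1 Ψ.cobase.1 (Ψ.coord.symm (p, 0))
  have hg : ∀ p, g p ∈ N.1 := fun p => chartProj_mem _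
  have hg1 : ∀ p, (Ψ.coord (g p)).1 = p := fun p => by
    have := sub_chartProj_mem hc (Ψ.coord.symm (p, 0))
    rw [mem_cobase, map_sub, Prod.fst_sub, sub_eq_zero] at this
    rw [← this]; simp
  let f : (Fin n → ℝ) →ₗ[ℝ] (Fin n → ℝ) :=
    LinearMap.snd ℝ (Fin n → ℝ) (Fin n → ℝ) ∘ₗ
      (Ψ.coord : E →ₗ[ℝ] (Fin n → ℝ) × (Fin n → ℝ)) ∘ₗ
      (chartProj N.1 Ψ.cobase.1 : E →ₗ[ℝ] E) ∘ₗ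
      (Ψ.coord.symm : (Fin n → ℝ) × (Fin n → ℝ) →ₗ[ℝ] E) ∘ₗ
      LinearMap.inl ℝ (Fin n → ℝ) (Fin n → ℝ)
  have hf : ∀ p, f p = (Ψ.coord (g p)).2 := fun p => rfl
  have hS : ∀ p, LinearMap.toMatrix' f *ᵥ p = f p := fun p => by
    rw [← LinearMap.toMatrix'_mulVec]
  refine ⟨LinearMap.toMatrix' f, ?_, fun x hx => ?_⟩
  · ext i j
    have e := N.2.apply (hg (Pi.single i 1)) (hg (Pi.single j 1))
    rw [Ψ.form, hg1, hg1, ← hf, ← hf] at e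
    rw [single_dotProduct, dotProduct_single] at e
    simp only [conjTranspose_apply, LinearMap.toMatrix'_apply, star_trivial]
    linarith
  · rw [hS, hf]
    have : x - g (Ψ.coord x).1 ∈ N.1 ⊓ Ψ.cobase.1 := by
      refine ⟨N.1.sub_mem hx (hg _), ?_⟩
      rw [SetLike.mem_coe, mem_cobase, map_sub, Prod.fst_sub, hg1, sub_self]
    rw [inf_comm, hN, Submodule.mem_bot, sub_eq_zero] at this
    rw [← this]

theorem exists_torus_path {N : Lag ω} (hN : Ψ.cobase.1 ⊓ N.1 = ⊥) :
    ∃ v : SympPath ω, (∀ t, v.act t Ψ.base = Ψ.base) ∧ (∀ t, v.act t Ψ.cobase = Ψ.cobase) ∧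
      ∃ θ : Fin n → ℝ, (∀ i, θ i ∈ Set.Ioo (-(Real.pi / 2)) (Real.pi / 2)) ∧
        v.act 1 N = Ψ.torus θ := by
  obtain ⟨S, hS, hNS⟩ := Ψ.exists_graph hN
  let U : Matrix (Fin n) (Fin n) ℝ := hS.eigenvectorUnitary
  have hU : Uᵀ * Uᵀᵀ = 1 := by
    rw [transpose_transpose]
    exact Unitary.coe_star_mul_self hS.eigenvectorUnitary
  have hU' : U * Uᵀ = 1 := Unitary.coe_mul_star_self hS.eigenvectorUnitary
  have hdiag : Uᵀ * S = diagonal hS.eigenvalues * Uᵀ := by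
    have h : Uᵀ * S * U = diagonal hS.eigenvalues := by
      have := hS.conjStarAlgAut_star_eigenvectorUnitary
      rw [Unitary.conjStarAlgAut_star_apply] at this
      exact this
    rw [← h, mul_assoc (Uᵀ * S), hU', mul_one]
  obtain ⟨v, hv, hv', s, hs, h⟩ := Ψ.exists_orthogonal_path hU
  refine ⟨v, hv, hv', fun i => Real.arctan (hS.eigenvalues i), fun i =>
    Real.arctan_mem_Ioo _, ?_⟩
  apply Subtype.ext
  refine Submodule.eq_of_le_of_finrank_eq ?_ (lag_finrank_eq _ _)
  rintro _ ⟨y, hy, rfl⟩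
  rw [mem_torus]
  intro i
  change _ * (Ψ.coord (v.toFun 1 y)).2 i = _ * (Ψ.coord (v.toFun 1 y)).1 i
  have hsin : Real.sin (Real.arctan (hS.eigenvalues i)) =
      hS.eigenvalues i * Real.cos (Real.arctan (hS.eigenvalues i)) := by
    rw [Real.sin_arctan, Real.cos_arctan]; ring
  rw [h, hNS y hy, mulVec_mulVec, hdiag, ← mulVec_mulVec, hsin]
  simp only [mulVec_diagonal]
  ring

end SympFrame

end LinearGroup

section Strata

open Filter Topology Module unitInterval

variable [FiniteDimensional ℝ E] {ω : BilinForm ℝ E} [hω : IsSymplForm ω] {n : ℕ}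

theorem SympPath.joinedIn (v : SympPath ω) {L : Lag ω} (hL : ∀ t, v.act t L = L) (N : Lag ω) :
    JoinedIn {N' | interDim L N' = interDim L N} N (v.act 1 N) := by
  refine ⟨v.path N rfl, fun t => ?_⟩
  have := v.interDim_act t L N
  rw [hL] at this
  exact this

theorem SympPath.joinedIn_pair (v : SympPath ω) (A B : Lag ω) :
    JoinedIn {p : Lag ω × Lag ω | interDim p.1 p.2 = interDim A B} (A, B)
      (v.act 1 A, v.act 1 B) :=
  ⟨(v.path A rfl).prod (v.path B rfl), fun t => v.interDim_act t A B⟩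

namespace SympFrame

variable (Ψ : SympFrame ω n)

theorem joinedIn_torus {θ η : Fin n → ℝ} {d : ℕ}
    (h : ∀ t : I, interDim Ψ.base (Ψ.torus ((1 - (t : ℝ)) • θ + (t : ℝ) • η)) = d) :
    JoinedIn {N | interDim Ψ.base N = d} (Ψ.torus θ) (Ψ.torus η) :=
  ⟨⟨⟨fun t : I => Ψ.torus ((1 - (t : ℝ)) • θ + (t : ℝ) • η),
    Ψ.continuous_torus.comp (f := fun t : I => (1 - (t : ℝ)) • θ + (t : ℝ) • η) (by fun_prop)⟩,
    by simp, by simp⟩, h⟩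

/-- The angles of a representative of the stratum of dimension `d`. -/
noncomputable def stdAngle (n d : ℕ) (i : Fin n) : ℝ := if (i : ℕ) < d then 0 else Real.pi / 2

theorem joinedIn_std (N : Lag ω) : JoinedIn {N' | interDim Ψ.base N' = interDim Ψ.base N} N
    (Ψ.torus (stdAngle n (interDim Ψ.base N))) := by
  classical
  obtain ⟨M, hM⟩ := exists_transv {Ψ.base, N}
  have hMb : Ψ.base.1 ⊓ M.1 = ⊥ := inf_comm M.1 _ ▸ hM _ (by simp)
  have hMN : M.1 ⊓ N.1 = ⊥ := hM _ (by simp)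
  let v := SympPath.shear hMb (inf_comm Ψ.cobase.1 _ ▸ Ψ.cobase_inf_base)
  have hv : ∀ t, v.act t Ψ.base = Ψ.base := SympPath.shear_fix _ _
  have hN1 : Ψ.cobase.1 ⊓ (v.act 1 N).1 = ⊥ := by
    have := v.act_transv 1 hMN
    rwa [SympPath.shear_one] at this
  obtain ⟨w, hw, -, θ, hθ, hwN⟩ := Ψ.exists_torus_path hN1
  have e1 : interDim Ψ.base (v.act 1 N) = interDim Ψ.base N := (v.joinedIn hv N).mem.2
  have j2 := w.joinedIn hw (v.act 1 N)
  rw [hwN, e1] at j2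
  have e2 : interDim Ψ.base (Ψ.torus θ) = interDim Ψ.base N := j2.mem.2
  have hsin : ∀ x : ℝ, -Real.pi < x → x < Real.pi → (Real.sin x = 0 ↔ x = 0) := fun x h1 h2 =>
    Real.sin_eq_zero_iff_of_lt_of_lt h1 h2
  have hpi := Real.pi_pos
  let η : Fin n → ℝ := fun i => if θ i = 0 then 0 else if 0 < θ i then Real.pi / 2 else
    -(Real.pi / 2)
  have j3 : JoinedIn {N' | interDim Ψ.base N' = interDim Ψ.base N} (Ψ.torus θ) (Ψ.torus η) := by
    refine Ψ.joinedIn_torus fun t => ?_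
    rw [← e2, interDim_base_torus, interDim_base_torus]
    refine Fintype.card_congr (Equiv.subtypeEquivRight fun i => ?_)
    have h1 := (hθ i).1
    have h2 := (hθ i).2
    have ht := t.2.1
    have ht1 := t.2.2
    simp only [Pi.add_apply, Pi.smul_apply, smul_eq_mul, η]
    split_ifs with h3 h4
    · simp [h3]
    · have h5 : 0 < (1 - (t : ℝ)) * θ i + t * (Real.pi / 2) := by
        rcases eq_or_lt_of_le ht with h | h
        · rw [← h]; simpa using h4
        · have := mul_pos h (half_pos hpi)
          have := mul_nonneg (sub_nonneg.2 ht1) h4.le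
          linarith
      have h6 : (1 - (t : ℝ)) * θ i + t * (Real.pi / 2) < Real.pi := by nlinarith
      rw [hsin _ (by linarith) h6, hsin _ (by linarith) (by linarith)]
      exact ⟨fun h => absurd h h5.ne', fun h => absurd h h3⟩
    · have h4 : θ i < 0 := lt_of_le_of_ne (not_lt.1 h4) h3
      have h5 : (1 - (t : ℝ)) * θ i + t * -(Real.pi / 2) < 0 := by
        rcases eq_or_lt_of_le ht with h | h
        · rw [← h]; simpa using h4
        · have := mul_pos h (half_pos hpi)
          have := mul_nonneg (sub_nonneg.2 ht1) (neg_nonneg.2 h4.le)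
          linarith
      have h6 : -Real.pi < (1 - (t : ℝ)) * θ i + t * -(Real.pi / 2) := by nlinarith
      rw [hsin _ h6 (by linarith), hsin _ (by linarith) (by linarith)]
      exact ⟨fun h => absurd h h5.ne, fun h => absurd h h3⟩
  let ζ : Fin n → ℝ := fun i => if θ i = 0 then 0 else Real.pi / 2
  have hζ : Ψ.torus η = Ψ.torus ζ := by
    rw [← Ψ.torus_add_pi η fun i => if θ i < 0 then 1 else 0]
    congr 1
    ext i
    simp only [η, ζ]
    rcases lt_trichotomy (θ i) 0 with h | h | h
    · simp [h, h.ne, h.not_gt]; ring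
    · simp [h]
    · simp [h.ne', h.not_gt, h]
  have hcard : Fintype.card {i // θ i = 0} = interDim Ψ.base N := by
    rw [← e2, interDim_base_torus]
    refine Fintype.card_congr (Equiv.subtypeEquivRight fun i => ?_)
    rw [hsin _ (by linarith [(hθ i).1]) (by linarith [(hθ i).2])]
  have hle : interDim Ψ.base N ≤ n := by
    rw [← hcard]
    simpa using Fintype.card_subtype_le fun i => θ i = 0
  let e : {i : Fin n // (i : ℕ) < interDim Ψ.base N} ≃ {i // θ i = 0} :=
    Fintype.equivOfCardEq (by rw [Fintype.card_fin_lt_of_le hle, hcard])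
  obtain ⟨u, hu, hu1⟩ := Ψ.exists_perm_path e.extendSubtype
  have j4 := u.joinedIn hu (Ψ.torus ζ)
  rw [hu1, ← hζ, show interDim Ψ.base (Ψ.torus η) = _ from j3.mem.2] at j4
  have hstd : ζ ∘ e.extendSubtype = stdAngle n (interDim Ψ.base N) := by
    ext i
    simp only [Function.comp_apply, ζ, stdAngle]
    by_cases h : (i : ℕ) < interDim Ψ.base N
    · rw [if_pos (e.extendSubtype_mem i h), if_pos h]
    · rw [if_neg (e.extendSubtype_not_mem i h), if_neg h]
  rw [hstd] at j4
  exact (((v.joinedIn hv N).trans j2).trans j3).trans j4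

theorem joinedIn_std_pair (A B : Lag ω) :
    JoinedIn {p : Lag ω × Lag ω | interDim p.1 p.2 = interDim A B} (A, B)
      (Ψ.base, Ψ.torus (stdAngle n (interDim A B))) := by
  classical
  obtain ⟨M, hM⟩ := exists_transv {A, Ψ.base}
  let v := SympPath.shear (hM A (by simp)) (hM Ψ.base (by simp))
  have j1 := v.joinedIn_pair A B
  rw [SympPath.shear_one] at j1
  refine j1.trans ?_
  have e1 : interDim Ψ.base (v.act 1 B) = interDim A B := j1.mem.2
  obtain ⟨p, hp⟩ := Ψ.joinedIn_std (v.act 1 B)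
  rw [← e1]
  exact ⟨(Path.refl _).prod p, hp⟩

end SympFrame

end Strata

section Loops

open Filter Topology Module unitInterval
open Path.Homotopic (Quotient.mk)
open Path.Homotopic.Quotient

variable [FiniteDimensional ℝ E] {ω : BilinForm ℝ E} [hω : IsSymplForm ω] {n : ℕ}

namespace SympFrame

variable (Ψ : SympFrame ω n)

/-- The translation of angles by multiples of `π`. -/
noncomputable def shift (θ : Fin n → ℝ) (k : Fin n → ℤ) : Fin n → ℝ := fun i => θ i + k i * Real.pi

theorem shift_zero (θ : Fin n → ℝ) : shift θ 0 = θ := by ext i; simp [shift]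

theorem shift_add (θ : Fin n → ℝ) (k l : Fin n → ℤ) : shift θ (k + l) = shift (shift θ k) l := by
  ext i; simp only [shift, Pi.add_apply, Int.cast_add]; ring

theorem torus_shift (θ : Fin n → ℝ) (k : Fin n → ℤ) : Ψ.torus (shift θ k) = Ψ.torus θ :=
  Ψ.torus_add_pi θ k

theorem torus_shift' {x : Lag ω} {θ : Fin n → ℝ} (h : Ψ.torus θ = x) (k : Fin n → ℤ) :
    Ψ.torus (shift θ k) = x := (Ψ.torus_add_pi θ k).trans h

/-- The class of a path in the torus. -/
noncomputable def torusCls {x y : Lag ω} (θ η : Fin n → ℝ) (hx : Ψ.torus θ = x)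
    (hy : Ψ.torus η = y) : Path.Homotopic.Quotient x y :=
  simplyCls ⟨Ψ.torus, Ψ.continuous_torus⟩ θ η hx hy

variable {x y z : Lag ω} {θ η ζ : Fin n → ℝ}

theorem torusCls_self (hx : Ψ.torus θ = x) :
    Ψ.torusCls θ θ hx hx = Path.Homotopic.Quotient.refl x := simplyCls_self _ _ _

theorem torusCls_trans (hx : Ψ.torus θ = x) (hy : Ψ.torus η = y) (hz : Ψ.torus ζ = z) :
    (Ψ.torusCls θ η hx hy).trans (Ψ.torusCls η ζ hy hz) = Ψ.torusCls θ ζ hx hz :=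
  simplyCls_trans _ _ _ _ _ _ _

theorem torusCls_shift (hx : Ψ.torus θ = x) (hy : Ψ.torus η = y) (k : Fin n → ℤ) :
    Ψ.torusCls (shift θ k) (shift η k) (Ψ.torus_shift' hx k) (Ψ.torus_shift' hy k) =
      Ψ.torusCls θ η hx hy := by
  unfold torusCls
  refine (simplyCls_comp ⟨Ψ.torus, Ψ.continuous_torus⟩ ⟨fun θ => shift θ k, by
    unfold shift; fun_prop⟩ θ η (Ψ.torus_shift' hx k) (Ψ.torus_shift' hy k)).symm.trans ?_
  congr 1
  ext1 θ
  exact Ψ.torus_shift θ k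

theorem mk_eq_torusCls (hx : Ψ.torus θ = x) (hy : Ψ.torus η = y) (p : Path x y)
    (h : ∀ t : I, Ψ.torus (θ + (t : ℝ) • (η - θ)) = p t) : mk p = Ψ.torusCls θ η hx hy :=
  mk_eq_simplyCls _ _ _ p ⟨fun t : I => θ + (t : ℝ) • (η - θ), by fun_prop⟩ h
    (by simp) (by simp)

theorem chartCls_eq_torusCls {M : Lag ω} (hx : Ψ.torus θ = x) (hy : Ψ.torus η = y)
    (hMx : M.1 ⊓ x.1 = ⊥) (hMy : M.1 ⊓ y.1 = ⊥)
    (h : ∀ t : I, M.1 ⊓ (Ψ.torus (θ + (t : ℝ) • (η - θ))).1 = ⊥) :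
    chartCls M hMx hMy = Ψ.torusCls θ η hx hy := by
  subst hx hy
  let p : Path (Ψ.torus θ) (Ψ.torus η) := ⟨⟨fun t : I => Ψ.torus (θ + (t : ℝ) • (η - θ)),
    Ψ.continuous_torus.comp (f := fun t : I => θ + (t : ℝ) • (η - θ)) (by fun_prop)⟩,
    by simp, by simp⟩
  rw [← mk_eq_chartCls hMx hMy p h, ← Ψ.mk_eq_torusCls rfl rfl p fun _ => rfl]

theorem segment_mem_Ioo {a b u v : ℝ} (hu : u ∈ Set.Ioo a b) (hv : v ∈ Set.Ioo a b) (t : I) :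
    u + (t : ℝ) * (v - u) ∈ Set.Ioo a b := by
  have := (convex_Ioo a b).add_smul_sub_mem hu hv t.2
  simpa using this

theorem baseCls_eq_torusCls (hx : Ψ.torus θ = x) (hy : Ψ.torus η = y)
    (hMx : Ψ.base.1 ⊓ x.1 = ⊥) (hMy : Ψ.base.1 ⊓ y.1 = ⊥)
    (hθ : ∀ i, θ i ∈ Set.Ioo 0 Real.pi) (hη : ∀ i, η i ∈ Set.Ioo 0 Real.pi) :
    chartCls Ψ.base hMx hMy = Ψ.torusCls θ η hx hy :=
  Ψ.chartCls_eq_torusCls hx hy hMx hMy fun t => Ψ.base_inf_torus fun i =>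
    have h := segment_mem_Ioo (hθ i) (hη i) t
    (Real.sin_pos_of_pos_of_lt_pi h.1 h.2).ne'

theorem cobaseCls_eq_torusCls (hx : Ψ.torus θ = x) (hy : Ψ.torus η = y)
    (hMx : Ψ.cobase.1 ⊓ x.1 = ⊥) (hMy : Ψ.cobase.1 ⊓ y.1 = ⊥)
    (hθ : ∀ i, θ i ∈ Set.Ioo (-(Real.pi / 2)) (Real.pi / 2))
    (hη : ∀ i, η i ∈ Set.Ioo (-(Real.pi / 2)) (Real.pi / 2)) :
    chartCls Ψ.cobase hMx hMy = Ψ.torusCls θ η hx hy :=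
  Ψ.chartCls_eq_torusCls hx hy hMx hMy fun t => Ψ.cobase_inf_torus fun i =>
    (Real.cos_pos_of_mem_Ioo (segment_mem_Ioo (hθ i) (hη i) t)).ne'

/-- The angles of the base point. -/
noncomputable def diagAngle (n : ℕ) (_ : Fin n) : ℝ := Real.pi / 4

theorem diagAngle_mem (i : Fin n) : diagAngle n i ∈ Set.Ioo 0 Real.pi := by
  unfold diagAngle
  constructor <;> linarith [Real.pi_pos]

/-- The base point. -/
noncomputable def diag : Lag ω := Ψ.torus (diagAngle n)

theorem torus_diagAngle : Ψ.torus (diagAngle n) = Ψ.diag := rfl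

theorem base_inf_diag : Ψ.base.1 ⊓ Ψ.diag.1 = ⊥ := Ψ.base_inf_torus fun i =>
  (Real.sin_pos_of_pos_of_lt_pi (diagAngle_mem i).1 (diagAngle_mem i).2).ne'

/-- The class of the loop winding `k` times. -/
noncomputable def windCls (k : Fin n → ℤ) : Path.Homotopic.Quotient Ψ.diag Ψ.diag :=
  Ψ.torusCls (diagAngle n) (shift (diagAngle n) k) Ψ.torus_diagAngle
    (Ψ.torus_shift' Ψ.torus_diagAngle k)

theorem windCls_zero : Ψ.windCls 0 = Path.Homotopic.Quotient.refl _ := by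
  unfold windCls
  simp only [shift_zero]
  exact Ψ.torusCls_self _

theorem windCls_add (k l : Fin n → ℤ) :
    Ψ.windCls (k + l) = (Ψ.windCls k).trans (Ψ.windCls l) := by
  unfold windCls
  rw [← Ψ.torusCls_shift Ψ.torus_diagAngle (Ψ.torus_shift' Ψ.torus_diagAngle l) k,
    torusCls_trans]
  congr 1
  rw [add_comm, shift_add]

theorem windCls_comp (k : Fin n → ℤ) (e : Equiv.Perm (Fin n)) :
    Ψ.windCls (k ∘ e) = Ψ.windCls k := by
  obtain ⟨v, hv, h⟩ := Ψ.exists_perm_path e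
  let p : Path Ψ.diag Ψ.diag := ⟨⟨fun t : I => Ψ.torus (diagAngle n + (t : ℝ) •
    (shift (diagAngle n) k - diagAngle n)), Ψ.continuous_torus.comp (f := fun t : I =>
    diagAngle n + (t : ℝ) • (shift (diagAngle n) k - diagAngle n)) (by fun_prop)⟩,
    by simp [diag], by simp [diag, torus_shift]⟩
  have h1 : v.act 1 Ψ.diag = Ψ.diag := h _
  have hp : mk p = Ψ.windCls k := Ψ.mk_eq_torusCls _ _ p fun _ => rfl
  have hq : mk (v.mapPath p h1 h1) = Ψ.windCls (k ∘ e) := by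
    refine Ψ.mk_eq_torusCls _ _ _ fun t => ?_
    change _ = v.act 1 (Ψ.torus _)
    rw [h]
    rfl
  have hs : mk (v.path Ψ.diag h1) = Path.Homotopic.Quotient.refl _ := by
    rw [mk_eq_chartCls Ψ.base_inf_diag Ψ.base_inf_diag _ fun t => ?_, chartCls_self]
    have := v.act_transv t Ψ.base_inf_diag
    rwa [hv] at this
  have := v.mk_mapPath p h1 h1
  rwa [hs, trans_refl, refl_trans, hp, hq, eq_comm] at this

theorem exists_windCls_single (i₀ : Fin n) (k : Fin n → ℤ) :
    ∃ m : ℤ, Ψ.windCls k = Ψ.windCls (Pi.single i₀ m) := by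
  rw [← Finset.univ_sum_single k]
  refine Finset.sum_induction _
    (fun k => ∃ m : ℤ, Ψ.windCls k = Ψ.windCls (Pi.single i₀ m)) ?_ ?_ ?_
  · rintro k l ⟨m, hm⟩ ⟨m', hm'⟩
    exact ⟨m + m', by rw [windCls_add, hm, hm', ← windCls_add, Pi.single_add]⟩
  · exact ⟨0, by simp⟩
  · intro i _
    refine ⟨k i, ?_⟩
    rw [← Ψ.windCls_comp (Pi.single i₀ (k i)) (Equiv.swap i i₀)]
    congr 1
    ext j
    simp only [Function.comp_apply, Pi.single_apply, Equiv.swap_apply_eq_iff,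
      Equiv.swap_apply_right]

/-- Path classes which become torus classes when the ends are joined to the base point. -/
def IsWinding (hx : Ψ.base.1 ⊓ x.1 = ⊥) (hy : Ψ.base.1 ⊓ y.1 = ⊥)
    (q : Path.Homotopic.Quotient x y) : Prop :=
  ∃ k, ((chartCls Ψ.base Ψ.base_inf_diag hx).trans q).trans
    (chartCls Ψ.base hy Ψ.base_inf_diag) = Ψ.windCls k

variable {Ψ}

theorem IsWinding.trans {hx : Ψ.base.1 ⊓ x.1 = ⊥} {hy : Ψ.base.1 ⊓ y.1 = ⊥}
    {hz : Ψ.base.1 ⊓ z.1 = ⊥} {q : Path.Homotopic.Quotient x y} {r : Path.Homotopic.Quotient y z}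
    (hq : Ψ.IsWinding hx hy q) (hr : Ψ.IsWinding hy hz r) : Ψ.IsWinding hx hz (q.trans r) := by
  obtain ⟨k, hk⟩ := hq
  obtain ⟨l, hl⟩ := hr
  refine ⟨k + l, ?_⟩
  rw [windCls_add, ← hk, ← hl]
  simp only [trans_assoc]
  rw [← chartCls_symm Ψ.base_inf_diag hy, symm_trans_cancel]

theorem isWinding_base (hx : Ψ.base.1 ⊓ x.1 = ⊥) (hy : Ψ.base.1 ⊓ y.1 = ⊥) :
    Ψ.IsWinding hx hy (chartCls Ψ.base hx hy) :=
  ⟨0, by rw [chartCls_trans, chartCls_trans, chartCls_self, windCls_zero]⟩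

theorem isWinding_torusCls (hx : Ψ.base.1 ⊓ x.1 = ⊥) (hy : Ψ.base.1 ⊓ y.1 = ⊥)
    (hθ : ∀ i, θ i ∈ Set.Ioo (-(Real.pi / 2)) (Real.pi / 2))
    (hη : ∀ i, η i ∈ Set.Ioo (-(Real.pi / 2)) (Real.pi / 2)) (hx' : Ψ.torus θ = x)
    (hy' : Ψ.torus η = y) : Ψ.IsWinding hx hy (Ψ.torusCls θ η hx' hy') := by
  have key : ∀ {x : Lag ω} {θ : Fin n → ℝ}, Ψ.base.1 ⊓ x.1 = ⊥ →
      (∀ i, θ i ∈ Set.Ioo (-(Real.pi / 2)) (Real.pi / 2)) → Ψ.torus θ = x →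
      ∃ k : Fin n → ℤ, ∀ i, shift θ k i ∈ Set.Ioo 0 Real.pi := by
    rintro x θ hx hθ rfl
    refine ⟨fun i => if θ i < 0 then 1 else 0, fun i => ?_⟩
    have h0 : θ i ≠ 0 := fun h0 => by
      have h1 := Ψ.interDim_base_torus θ
      rw [interDim_eq_zero hx, eq_comm, Fintype.card_eq_zero_iff] at h1
      exact h1.1 ⟨i, by rw [h0, Real.sin_zero]⟩
    have h1 := (hθ i).1
    have h2 := (hθ i).2
    have hpi := Real.pi_pos
    simp only [shift]
    split_ifs with h
    · constructor <;> push_cast <;> linarith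
    · have := lt_of_le_of_ne (not_lt.1 h) h0.symm
      constructor <;> push_cast <;> linarith
  obtain ⟨k, hk⟩ := key hx hθ hx'
  obtain ⟨l, hl⟩ := key hy hη hy'
  refine ⟨k - l, ?_⟩
  rw [Ψ.baseCls_eq_torusCls Ψ.torus_diagAngle (Ψ.torus_shift' hx' k) _ _ diagAngle_mem hk,
    ← Ψ.torusCls_shift hx' hy' k, torusCls_trans,
    Ψ.baseCls_eq_torusCls (Ψ.torus_shift' hy' l) Ψ.torus_diagAngle _ _ hl diagAngle_mem,
    ← Ψ.torusCls_shift (Ψ.torus_shift' hy' l) Ψ.torus_diagAngle (k - l)]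
  simp only [← shift_add, add_sub_cancel]
  rw [torusCls_trans]
  rfl

theorem isWinding_cobase (hx : Ψ.base.1 ⊓ x.1 = ⊥) (hy : Ψ.base.1 ⊓ y.1 = ⊥)
    (hx' : Ψ.cobase.1 ⊓ x.1 = ⊥) (hy' : Ψ.cobase.1 ⊓ y.1 = ⊥) :
    Ψ.IsWinding hx hy (chartCls Ψ.cobase hx' hy') := by
  have key : ∀ {x : Lag ω} (hx : Ψ.base.1 ⊓ x.1 = ⊥) (hx' : Ψ.cobase.1 ⊓ x.1 = ⊥),
      ∃ θ : Fin n → ℝ, (∀ i, θ i ∈ Set.Ioo (-(Real.pi / 2)) (Real.pi / 2)) ∧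
        ∃ (h : Ψ.base.1 ⊓ (Ψ.torus θ).1 = ⊥) (h' : Ψ.cobase.1 ⊓ (Ψ.torus θ).1 = ⊥),
          chartCls Ψ.base hx h = chartCls Ψ.cobase hx' h' := by
    intro x hx hx'
    obtain ⟨v, hv, hv', θ, hθ, hvx⟩ := Ψ.exists_torus_path hx'
    have e1 : ∀ t, Ψ.base.1 ⊓ (v.act t x).1 = ⊥ := fun t => by
      have := v.act_transv t hx
      rwa [hv] at this
    have e2 : ∀ t, Ψ.cobase.1 ⊓ (v.act t x).1 = ⊥ := fun t => by
      have := v.act_transv t hx'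
      rwa [hv'] at this
    refine ⟨θ, hθ, hvx ▸ e1 1, hvx ▸ e2 1, ?_⟩
    rw [← mk_eq_chartCls hx _ (v.path x hvx) e1, ← mk_eq_chartCls hx' _ (v.path x hvx) e2]
  obtain ⟨θ, hθ, h1, h1', e1⟩ := key hx hx'
  obtain ⟨η, hη, h2, h2', e2⟩ := key hy hy'
  rw [← chartCls_trans hx' h2' hy', ← chartCls_trans hx' h1' h2', ← e1,
    ← chartCls_symm hy' h2', ← e2, chartCls_symm, Ψ.cobaseCls_eq_torusCls rfl rfl h1' h2' hθ hη]
  exact ((isWinding_base hx h1).trans (isWinding_torusCls h1 h2 hθ hη _ _)).trans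
    (isWinding_base h2 hy)

theorem isWinding_chartCls {M : Lag ω} (hM : Ψ.base.1 ⊓ M.1 = ⊥) (hx : Ψ.base.1 ⊓ x.1 = ⊥)
    (hy : Ψ.base.1 ⊓ y.1 = ⊥) (hx' : M.1 ⊓ x.1 = ⊥) (hy' : M.1 ⊓ y.1 = ⊥) :
    Ψ.IsWinding hx hy (chartCls M hx' hy') := by
  obtain ⟨p, hp⟩ := exists_chart_path hx' hy'
  let v := SympPath.shear hM (inf_comm Ψ.cobase.1 _ ▸ Ψ.cobase_inf_base)
  have hv : ∀ t, v.act t Ψ.base = Ψ.base := SympPath.shear_fix _ _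
  have hv1 : v.act 1 M = Ψ.cobase := SympPath.shear_one _ _
  have e1 : ∀ {x : Lag ω} (hx : Ψ.base.1 ⊓ x.1 = ⊥) (t), Ψ.base.1 ⊓ (v.act t x).1 = ⊥ :=
    fun hx t => by
      have := v.act_transv t hx
      rwa [hv] at this
  have e2 : ∀ {x : Lag ω} (hx : M.1 ⊓ x.1 = ⊥), Ψ.cobase.1 ⊓ (v.act 1 x).1 = ⊥ :=
    fun hx => by
      have := v.act_transv 1 hx
      rwa [hv1] at this
  rw [← mk_eq_chartCls hx' hy' p hp, v.mk_mapPath' p rfl rfl,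
    mk_eq_chartCls hx (e1 hx 1) _ (e1 hx), mk_eq_chartCls hy (e1 hy 1) _ (e1 hy), chartCls_symm,
    mk_eq_chartCls (e2 hx') (e2 hy') _ fun t => e2 (hp t)]
  exact ((isWinding_base _ _).trans (isWinding_cobase (e1 hx 1) (e1 hy 1) _ _)).trans
    (isWinding_base _ _)

variable (Ψ)

theorem exists_eq_windCls (q : Path.Homotopic.Quotient Ψ.diag Ψ.diag) :
    ∃ k, q = Ψ.windCls k := by
  classical
  induction q using Path.Homotopic.Quotient.ind with | _ p
  obtain ⟨t, ht0, htm, ⟨m, hm⟩, hM⟩ := exists_monotone_Icc_subset_open_cover_unitInterval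
    (c := fun (M : Lag ω) => {s : I | M.1 ⊓ (p s).1 = ⊥})
    (fun M => isOpen_transv.preimage (continuous_const.prodMk p.continuous))
    (fun s _ => by
      obtain ⟨M, hM⟩ := exists_transv {p s}
      exact Set.mem_iUnion.2 ⟨M, hM _ (by simp)⟩)
  choose M hM using hM
  obtain ⟨R, hR⟩ := exists_transv ({Ψ.diag} ∪ (Finset.range (m + 2)).image (fun j => p (t j)) ∪
    (Finset.range (m + 1)).image M)
  have hRd : Ψ.diag.1 ⊓ R.1 = ⊥ := inf_comm R.1 _ ▸ hR _ (by simp)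
  have hRp : ∀ j ≤ m + 1, R.1 ⊓ (p (t j)).1 = ⊥ := fun j hj => hR _ (by
    simp only [Finset.mem_union, Finset.mem_image, Finset.mem_range]
    exact Or.inl (Or.inr ⟨j, by omega, rfl⟩))
  have hRM : ∀ j ≤ m, R.1 ⊓ (M j).1 = ⊥ := fun j hj => hR _ (by
    simp only [Finset.mem_union, Finset.mem_image, Finset.mem_range]
    exact Or.inr ⟨j, by omega, rfl⟩)
  let v := SympPath.shear hRd (inf_comm Ψ.base.1 _ ▸ Ψ.base_inf_diag)
  have hv : ∀ t, v.act t Ψ.diag = Ψ.diag := SympPath.shear_fix _ _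
  have hv1 : v.act 1 R = Ψ.base := SympPath.shear_one _ _
  have hvx : ∀ {x : Lag ω}, R.1 ⊓ x.1 = ⊥ → Ψ.base.1 ⊓ (v.act 1 x).1 = ⊥ := fun hx => by
    have := v.act_transv 1 hx
    rwa [hv1] at this
  have hs : mk (v.path Ψ.diag (hv 1)) = Path.Homotopic.Quotient.refl _ := by
    rw [show v.path Ψ.diag (hv 1) = Path.refl _ from Path.ext (funext hv)]
    rfl
  have e := v.mk_mapPath p (hv 1) (hv 1)
  rw [hs, trans_refl, refl_trans] at e
  rw [e]
  have htm' : t (m + 1) = 1 := hm _ (Nat.le_succ m)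
  let p' := v.mapPath p (hv 1) (hv 1)
  let P : ∀ x y : Lag ω, Path.Homotopic.Quotient x y → Prop := fun x y q =>
    ∃ (hx : Ψ.base.1 ⊓ x.1 = ⊥) (hy : Ψ.base.1 ⊓ y.1 = ⊥), Ψ.IsWinding hx hy q
  have key : P _ _ (mk p') := by
    refine induction_subdivision P ?_ p' t m ht0 htm' fun j hj => ?_
    · rintro x y z q r ⟨hx, hy, hq⟩ ⟨_, hz, hr⟩
      exact ⟨hx, hz, hq.trans hr⟩
    · have hx : Ψ.base.1 ⊓ (p' (t j)).1 = ⊥ := hvx (hRp j (by omega))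
      have hy : Ψ.base.1 ⊓ (p' (t (j + 1))).1 = ⊥ := hvx (hRp (j + 1) (by omega))
      have hMp : ∀ s ∈ Set.Icc (t j) (t (j + 1)), (v.act 1 (M j)).1 ⊓ (p' s).1 = ⊥ :=
        fun s hs => v.act_transv 1 (hM j hs)
      have hle := htm (Nat.le_succ j)
      refine ⟨hx, hy, ?_⟩
      rw [mk_eq_chartCls (hMp _ ⟨le_rfl, hle⟩) (hMp _ ⟨hle, le_rfl⟩) _ fun s => ?_]
      · exact isWinding_chartCls (hvx (hRM j hj)) hx hy _ _
      · obtain ⟨s', hs', e'⟩ := p'.range_subpath_of_le _ _ hle ▸ Set.mem_range_self s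
        rw [← e']
        exact hMp _ hs'
  obtain ⟨hx, hy, k, hk⟩ := key
  rw [chartCls_self, refl_trans, trans_refl] at hk
  exact ⟨k, hk⟩

theorem exists_eq_torusCls (i₀ : Fin n) (hx : Ψ.torus θ = x) (hy : Ψ.torus η = y)
    (q : Path.Homotopic.Quotient x y) : ∃ m : ℤ, q =
      Ψ.torusCls θ (shift η (Pi.single i₀ m)) hx (Ψ.torus_shift' hy _) := by
  obtain ⟨k, hk⟩ := Ψ.exists_eq_windCls
    (((Ψ.torusCls (diagAngle n) θ Ψ.torus_diagAngle hx).trans q).trans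
    (Ψ.torusCls η (diagAngle n) hy Ψ.torus_diagAngle))
  obtain ⟨m, hm⟩ := Ψ.exists_windCls_single i₀ k
  refine ⟨m, ?_⟩
  have h1 : ∀ {x y : Lag ω} {θ η : Fin n → ℝ} (hx : Ψ.torus θ = x) (hy : Ψ.torus η = y),
      (Ψ.torusCls θ η hx hy).trans (Ψ.torusCls η θ hy hx) = Path.Homotopic.Quotient.refl _ :=
    fun hx hy => by rw [torusCls_trans, torusCls_self]
  have h2 := congrArg (fun c => ((Ψ.torusCls θ (diagAngle n) hx Ψ.torus_diagAngle).trans c).trans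
    (Ψ.torusCls (diagAngle n) η Ψ.torus_diagAngle hy)) (hk.trans hm)
  simp only [trans_assoc, h1, trans_refl] at h2
  rw [← trans_assoc, h1, refl_trans] at h2
  rw [h2, windCls, ← Ψ.torusCls_shift Ψ.torus_diagAngle hy (Pi.single i₀ m), torusCls_trans,
    torusCls_trans]

end SympFrame

end Loops

section TorusSignature

open Filter Topology Module unitInterval Matrix

variable [FiniteDimensional ℝ E] {ω : BilinForm ℝ E} [hω : IsSymplForm ω] {n : ℕ}

/-- The hyperbolic form `(a, m) ↦ -a ⬝ m`. -/
noncomputable def negDotForm (n : ℕ) : QuadraticForm ℝ ((Fin n → ℝ) × (Fin n → ℝ)) :=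
  LinearMap.BilinMap.toQuadraticMap ((-dotProductBilin ℝ ℝ).compl₁₂ (LinearMap.fst ℝ _ _)
    (LinearMap.snd ℝ _ _))

theorem negDotForm_apply (v : (Fin n → ℝ) × (Fin n → ℝ)) : negDotForm n v = -(v.1 ⬝ᵥ v.2) := by
  simp [negDotForm, dotProductBilin]

namespace SympFrame

variable (Ψ : SympFrame ω n)

theorem tripleSig_torus (θ : Fin n → ℝ) :
    tripleSig ω Ψ.base.1 (Ψ.torus θ).1 Ψ.cobase.1 =
      qsig (QuadraticMap.weightedSumSquares ℝ fun i => Real.sin (θ i) * Real.cos (θ i)) +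
        qsig (negDotForm n) := by
  let c : (Fin n → ℝ) →ₗ[ℝ] (Fin n → ℝ) := LinearMap.pi fun i => Real.cos (θ i) • LinearMap.proj i
  let s : (Fin n → ℝ) →ₗ[ℝ] (Fin n → ℝ) := LinearMap.pi fun i => Real.sin (θ i) • LinearMap.proj i
  have hcs (b : Fin n → ℝ) i : c b i = Real.cos (θ i) * b i := rfl
  have hss (b : Fin n → ℝ) i : s b i = Real.sin (θ i) * b i := rfl
  let b : (Fin n → ℝ) × (Fin n → ℝ) × (Fin n → ℝ) →ₗ[ℝ] (Fin n → ℝ) := LinearMap.fst ℝ _ _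
  let a : (Fin n → ℝ) × (Fin n → ℝ) × (Fin n → ℝ) →ₗ[ℝ] (Fin n → ℝ) :=
    LinearMap.fst ℝ _ _ ∘ₗ LinearMap.snd ℝ _ _
  let m : (Fin n → ℝ) × (Fin n → ℝ) × (Fin n → ℝ) →ₗ[ℝ] (Fin n → ℝ) :=
    LinearMap.snd ℝ _ _ ∘ₗ LinearMap.snd ℝ _ _
  let C : (Fin n → ℝ) × (Fin n → ℝ) →ₗ[ℝ] E := (Ψ.coord.symm : (Fin n → ℝ) × (Fin n → ℝ) →L[ℝ] E)
  have hC (x) : Ψ.coord (C x) = x := Ψ.coord.apply_symm_apply x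
  let f1 : (Fin n → ℝ) × (Fin n → ℝ) × (Fin n → ℝ) →ₗ[ℝ] Ψ.base.1 :=
    (C ∘ₗ (a + c ∘ₗ b).prod 0).codRestrict _ fun v => by
      rw [mem_base, LinearMap.comp_apply, hC]; rfl
  let f2 : (Fin n → ℝ) × (Fin n → ℝ) × (Fin n → ℝ) →ₗ[ℝ] (Ψ.torus θ).1 :=
    (C ∘ₗ (c ∘ₗ b).prod (s ∘ₗ b)).codRestrict _ fun v => by
      rw [mem_torus, LinearMap.comp_apply, hC]
      intro i
      change _ * s (b v) i = _ * c (b v) i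
      rw [hcs, hss]; ring
  let f3 : (Fin n → ℝ) × (Fin n → ℝ) × (Fin n → ℝ) →ₗ[ℝ] Ψ.cobase.1 :=
    (C ∘ₗ LinearMap.prod 0 (m + s ∘ₗ b)).codRestrict _ fun v => by
      rw [mem_cobase, LinearMap.comp_apply, hC]; rfl
  have hsurj : Function.Surjective (f1.prod (f2.prod f3)) := by
    rintro ⟨x, y, z⟩
    have hx := Ψ.mem_base.1 x.2
    have hy := Ψ.mem_torus.1 y.2
    have hz := Ψ.mem_cobase.1 z.2
    let B : Fin n → ℝ := fun i =>
      Real.cos (θ i) * (Ψ.coord y).1 i + Real.sin (θ i) * (Ψ.coord y).2 i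
    have hcB : c B = (Ψ.coord y).1 := by
      ext i
      rw [hcs]
      linear_combination (Ψ.coord y).1 i * Real.sin_sq_add_cos_sq (θ i) + Real.sin (θ i) * hy i
    have hsB : s B = (Ψ.coord y).2 := by
      ext i
      rw [hss]
      linear_combination (Ψ.coord y).2 i * Real.sin_sq_add_cos_sq (θ i) - Real.cos (θ i) * hy i
    have key {x : E} {v} (h : Ψ.coord x = v) : C v = x := by
      rw [← h]; exact Ψ.coord.symm_apply_apply x
    refine ⟨(B, (Ψ.coord x).1 - c B, (Ψ.coord z).2 - s B), Prod.ext (Subtype.ext (key ?_))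
      (Prod.ext (Subtype.ext (key ?_)) (Subtype.ext (key ?_)))⟩
    · refine Prod.ext ?_ hx
      change _ = (Ψ.coord x).1 - c B + c B
      rw [sub_add_cancel]
    · exact Prod.ext hcB.symm hsB.symm
    · refine Prod.ext hz ?_
      change _ = (Ψ.coord z).2 - s B + s B
      rw [sub_add_cancel]
  rw [tripleSig_eq_qsig, ← qsig_comp _ hsurj, ← qsig_prod]
  congr 1
  ext v
  rw [QuadraticMap.comp_apply, tripleForm_apply, QuadraticMap.prod_apply, negDotForm_apply,
    QuadraticMap.weightedSumSquares_apply]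
  change ω (C _) (C _) + ω (C _) (C _) + ω (C _) (C _) = _
  simp only [Ψ.form, hC]
  change (v.2.1 + c v.1) ⬝ᵥ s v.1 - 0 ⬝ᵥ c v.1 + (c v.1 ⬝ᵥ (v.2.2 + s v.1) - s v.1 ⬝ᵥ 0) +
    (0 ⬝ᵥ 0 - (v.2.2 + s v.1) ⬝ᵥ (v.2.1 + c v.1)) = _
  simp only [dotProduct, Pi.add_apply, hcs, hss]
  rw [← sub_eq_add_neg]
  simp only [← Finset.sum_add_distrib, ← Finset.sum_sub_distrib]
  refine Finset.sum_congr rfl fun i _ => ?_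
  simp only [smul_eq_mul, Pi.zero_apply]
  ring

end SympFrame

theorem qsig_weightedSumSquares (w : Fin n → ℝ) (hw : ∀ i, w i ≠ 0) :
    qsig (QuadraticMap.weightedSumSquares ℝ w) = n - 2 * ({i | w i < 0}.ncard : ℤ) := by
  rw [qsig, QuadraticForm.sigPos_weightedSumSquares, QuadraticForm.sigNeg_weightedSumSquares]
  have h := Set.ncard_add_ncard_compl {i | w i < 0}
  have hc : {i | w i < 0}ᶜ = {i | 0 < w i} := by
    ext i
    simp only [Set.mem_compl_iff, Set.mem_ofPred_eq, not_lt]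
    exact ⟨fun h => lt_of_le_of_ne h (hw i).symm, le_of_lt⟩
  rw [hc, Nat.card_fin] at h
  omega

end TorusSignature

section MaslovCharge

open Filter Topology Module unitInterval

variable [FiniteDimensional ℝ E] {ω : BilinForm ℝ E} [hω : IsSymplForm ω] {n : ℕ}

namespace SympFrame

variable (Ψ : SympFrame ω n)

/-- Along one period of a single angle, a primitive on the torus changes by a nonzero amount. -/
theorem exists_charge {φ : (Fin n → ℝ) → ℤ}
    (hφ : IsMaslovPrim (fun _ => Ψ.base) Ψ.torus φ) (i₀ : Fin n) :
    ∃ κ : ℤ, κ ≠ 0 ∧ ∀ θ (m : ℤ), φ (shift θ (Pi.single i₀ m)) = φ θ + m * κ := by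
  have hsh (k : Fin n → ℤ) (θ η : Fin n → ℝ) : φ (shift θ k) - φ θ = φ (shift η k) - φ η := by
    have hc : Continuous fun θ : Fin n → ℝ => shift θ k := by unfold shift; fun_prop
    have h := hφ.comp hc
    have e : Ψ.torus ∘ (fun θ : Fin n → ℝ => shift θ k) = Ψ.torus := by
      ext1 θ; exact Ψ.torus_shift θ k
    rw [e] at h
    have := h.sub_eq hφ θ η
    simp only [Function.comp_apply] at this
    linarith
  let α : Fin n → ℝ := diagAngle n
  let β : Fin n → ℝ := Function.update α i₀ (-(Real.pi / 4))
  have hα i : α i = Real.pi / 4 := rfl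
  have hβ i : β i = if i = i₀ then -(Real.pi / 4) else Real.pi / 4 := by
    simp only [β, Function.update_apply, hα]
  have hpi := Real.pi_pos
  have hone : shift β (Pi.single i₀ 1) = Function.update α i₀ (3 * Real.pi / 4) := by
    ext i
    simp only [shift, hβ, Function.update_apply, Pi.single_apply, hα]
    split_ifs
    · push_cast; ring
    · simp
  have h1 : φ (shift β (Pi.single i₀ 1)) = φ α := by
    rw [hone]
    have hg : Continuous fun t : Set.Ioo 0 Real.pi => Function.update α i₀ (t : ℝ) := by fun_prop
    have : PreconnectedSpace (Set.Ioo 0 Real.pi) := isPreconnected_iff_preconnectedSpace.1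
      isPreconnected_Ioo
    have := (hφ.comp hg).const_of_finrank (d := 0) continuous_const (Ψ.continuous_torus.comp hg)
      (fun t => ?_) ⟨3 * Real.pi / 4, by constructor <;> linarith⟩
      ⟨Real.pi / 4, by constructor <;> linarith⟩
    · exact this.trans (congrArg φ (Function.update_eq_self i₀ α))
    · refine interDim_eq_zero (Ψ.base_inf_torus fun i => (Real.sin_pos_of_pos_of_lt_pi ?_ ?_).ne')
      · simp only [Function.update_apply, hα]; split_ifs
        · exact t.2.1
        · linarith
      · simp only [Function.update_apply, hα]; split_ifs
        · exact t.2.2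
        · linarith
  have hw : ∀ θ : Fin n → ℝ, ∀ i, (θ i = Real.pi / 4 → Real.sin (θ i) * Real.cos (θ i) = 1 / 2) ∧
      (θ i = -(Real.pi / 4) → Real.sin (θ i) * Real.cos (θ i) = -(1 / 2)) := by
    intro θ i
    have h2 : √2 * √2 = 2 := Real.mul_self_sqrt zero_le_two
    constructor <;> intro h
    · rw [h, Real.sin_pi_div_four, Real.cos_pi_div_four]; linarith
    · rw [h, Real.sin_neg, Real.cos_neg, Real.sin_pi_div_four, Real.cos_pi_div_four]; linarith
  have hwα i : Real.sin (α i) * Real.cos (α i) = 1 / 2 := (hw α i).1 rfl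
  have hwβ i : Real.sin (β i) * Real.cos (β i) = if i = i₀ then -(1 / 2) else 1 / 2 := by
    by_cases h : i = i₀
    · rw [if_pos h]; exact (hw β i).2 (by rw [hβ, if_pos h])
    · rw [if_neg h]; exact (hw β i).1 (by rw [hβ, if_neg h])
  have h2 : φ α - φ β = 2 := by
    rw [hφ.sub_eq_of_transv Ψ.cobase
      (S := Set.pi Set.univ fun _ : Fin n => Set.Ioo (-(Real.pi / 2)) (Real.pi / 2))
      (convex_pi fun i _ => convex_Ioo _ _).isPreconnected (fun _ _ => Ψ.cobase_inf_base)
      (fun θ hθ => Ψ.cobase_inf_torus fun i => (Real.cos_pos_of_mem_Ioo (hθ i trivial)).ne')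
      (fun i _ => ?_) (fun i _ => ?_), Ψ.tripleSig_torus, Ψ.tripleSig_torus,
      qsig_weightedSumSquares _ (fun i => ?_), qsig_weightedSumSquares _ (fun i => ?_)]
    · have e1 : {i | Real.sin (α i) * Real.cos (α i) < 0} = ∅ := by
        ext i
        rw [Set.mem_ofPred_eq, hwα]
        norm_num
      have e2 : {i | Real.sin (β i) * Real.cos (β i) < 0} = {i₀} := by
        ext i
        rw [Set.mem_ofPred_eq, hwβ, Set.mem_singleton_iff]
        split_ifs with h <;> simp [h]
      rw [e1, e2, Set.ncard_empty, Set.ncard_singleton]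
      push_cast
      ring
    · rw [hwβ]; split_ifs <;> norm_num
    · rw [hwα]; norm_num
    · rw [hα]; constructor <;> linarith
    · rw [hβ]; split_ifs <;> constructor <;> linarith
  refine ⟨2, two_ne_zero, fun θ m => ?_⟩
  have step (θ : Fin n → ℝ) : φ (shift θ (Pi.single i₀ 1)) = φ θ + 2 := by
    have := hsh (Pi.single i₀ 1) θ β
    linarith
  have hstep (m : ℤ) : φ (shift θ (Pi.single i₀ (m + 1))) = φ (shift θ (Pi.single i₀ m)) + 2 := by
    rw [Pi.single_add, shift_add, step]
  induction m using Int.induction_on with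
  | zero => simp [shift_zero]
  | succ m ih => rw [hstep, ih]; ring
  | pred m ih =>
    have := hstep (-m - 1)
    rw [sub_add_cancel, ih] at this
    linarith

end SympFrame

end MaslovCharge

section Classification

open Filter Topology Module unitInterval
open Path.Homotopic (Quotient.mk)
open Path.Homotopic.Quotient

variable [FiniteDimensional ℝ E] {ω : BilinForm ℝ E} [hω : IsSymplForm ω] {n : ℕ}

/-- The class of a path of pairs of Lagrangian subspaces is represented by a path along which the
intersection has constant dimension `d`. -/
def IsLevel (d : ℕ) {x y : Lag ω × Lag ω} (c : Path.Homotopic.Quotient x y) : Prop :=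
  ∃ p : Path x y, mk p = c ∧ ∀ t, interDim (p t).1 (p t).2 = d

theorem IsLevel.symm {d : ℕ} {x y : Lag ω × Lag ω} {c : Path.Homotopic.Quotient x y}
    (h : IsLevel d c) : IsLevel d c.symm := by
  obtain ⟨p, rfl, hp⟩ := h
  exact ⟨p.symm, rfl, fun t => hp _⟩

theorem IsLevel.trans {d : ℕ} {x y z : Lag ω × Lag ω} {c : Path.Homotopic.Quotient x y}
    {c' : Path.Homotopic.Quotient y z} (h : IsLevel d c) (h' : IsLevel d c') :
    IsLevel d (c.trans c') := by
  obtain ⟨p, rfl, hp⟩ := h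
  obtain ⟨q, rfl, hq⟩ := h'
  refine ⟨p.trans q, rfl, fun t => ?_⟩
  rw [Path.trans_apply]
  split_ifs
  · exact hp _
  · exact hq _

theorem IsLevel.clsInd_eq {d : ℕ} {x y : Lag ω × Lag ω} {c : Path.Homotopic.Quotient x y}
    (h : IsLevel d c) : clsInd c = 0 := by
  obtain ⟨p, rfl, hp⟩ := h
  exact pathInd_eq_zero p hp

namespace SympFrame

variable (Ψ : SympFrame ω n)

/-- The segment between two points of the torus. -/
noncomputable def torusPath {x y : Lag ω} (θ η : Fin n → ℝ) (hx : Ψ.torus θ = x)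
    (hy : Ψ.torus η = y) : Path x y :=
  ⟨⟨fun t : I => Ψ.torus (θ + (t : ℝ) • (η - θ)),
    Ψ.continuous_torus.comp (f := fun t : I => θ + (t : ℝ) • (η - θ)) (by fun_prop)⟩,
    by simpa using hx, by simpa using hy⟩

theorem mk_torusPath {x y : Lag ω} {θ η : Fin n → ℝ} (hx : Ψ.torus θ = x)
    (hy : Ψ.torus η = y) : mk (Ψ.torusPath θ η hx hy) = Ψ.torusCls θ η hx hy :=
  Ψ.mk_eq_torusCls hx hy _ fun _ => rfl

theorem isLevel_rot {d : ℕ} {x : Lag ω} {θ : Fin n → ℝ} (hx : Ψ.torus θ = x)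
    (hd : interDim Ψ.base x = d) (k : Fin n → ℤ) :
    IsLevel d (Path.Homotopic.prod
      (Ψ.torusCls 0 (shift 0 k) Ψ.torus_zero (Ψ.torus_shift' Ψ.torus_zero k))
      (Ψ.torusCls θ (shift θ k) hx (Ψ.torus_shift' hx k))) := by
  rw [← mk_torusPath, ← mk_torusPath, Path.Homotopic.prod_lift]
  refine ⟨_, rfl, fun t => ?_⟩
  let η : Fin n → ℝ := fun i => (t : ℝ) * (k i * Real.pi)
  have e1 : (0 : Fin n → ℝ) + (t : ℝ) • (shift 0 k - 0) = η + 0 := by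
    ext i; simp [η, shift]
  have e2 : θ + (t : ℝ) • (shift θ k - θ) = η + θ := by
    ext i; simp [η, shift]; ring
  change interDim (Ψ.torus _) (Ψ.torus _) = d
  rw [e1, e2, ← rot_torus, ← rot_torus, torus_zero, hx, ← hd]
  exact (Ψ.isSymp_rot η).finrank_act_inf _ _

/-- The standard class of paths of pairs with given winding. -/
noncomputable def windPair {x y : Lag ω} (i₀ : Fin n) {θ η : Fin n → ℝ} (hx : Ψ.torus θ = x)
    (hy : Ψ.torus η = y) (m : ℤ) : Path.Homotopic.Quotient (Ψ.base, x) (Ψ.base, y) :=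
  Path.Homotopic.prod (Path.Homotopic.Quotient.refl Ψ.base)
    (Ψ.torusCls θ (shift η (Pi.single i₀ m)) hx (Ψ.torus_shift' hy _))

theorem clsInd_windPair {φ : (Fin n → ℝ) → ℤ} (hφ : IsMaslovPrim (fun _ => Ψ.base) Ψ.torus φ)
    {x y : Lag ω} (i₀ : Fin n) {θ η : Fin n → ℝ} (hx : Ψ.torus θ = x)
    (hy : Ψ.torus η = y) (m : ℤ) :
    clsInd (Ψ.windPair i₀ hx hy m) = φ θ - φ (shift η (Pi.single i₀ m)) := by
  rw [windPair, ← mk_torusPath, ← Path.Homotopic.Quotient.mk_refl, Path.Homotopic.prod_lift,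
    clsInd_mk, pathInd_eq_of_comp hφ _ (g := fun t : I =>
      θ + (t : ℝ) • (shift η (Pi.single i₀ m) - θ)) (by fun_prop) (fun t => rfl)]
  simp

theorem exists_eq_windPair {x y : Lag ω} (i₀ : Fin n) {θ η : Fin n → ℝ} (hx : Ψ.torus θ = x)
    (hy : Ψ.torus η = y) (c : Path.Homotopic.Quotient (Ψ.base, x) (Ψ.base, y)) :
    ∃ (l : Path.Homotopic.Quotient (Ψ.base, x) (Ψ.base, x)) (m : ℤ),
      IsLevel (interDim Ψ.base x) l ∧ c = l.trans (Ψ.windPair i₀ hx hy m) := by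
  obtain ⟨k, hk⟩ := Ψ.exists_eq_torusCls i₀ Ψ.torus_zero Ψ.torus_zero (Path.Homotopic.projLeft c)
  obtain ⟨m, hm⟩ := Ψ.exists_eq_torusCls i₀ hx hy (Path.Homotopic.projRight c)
  refine ⟨_, m - k, Ψ.isLevel_rot hx rfl (Pi.single i₀ k), ?_⟩
  rw [← Path.Homotopic.prod_projLeft_projRight c, hk, hm, windPair,
    Path.Homotopic.comp_prod_eq_prod_comp, trans_refl]
  congr 1
  have e : shift (shift η (Pi.single i₀ (m - k))) (Pi.single i₀ k) =
      shift η (Pi.single i₀ m) := by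
    rw [← shift_add, ← Pi.single_add, sub_add_cancel]
  have h := Ψ.torusCls_shift hx (Ψ.torus_shift' hy (Pi.single i₀ (m - k))) (Pi.single i₀ k)
  rw [← h]
  simp only [e]
  rw [torusCls_trans]

theorem exists_level_windPair (i₀ : Fin n) {x y : Lag ω × Lag ω} {d d' : ℕ}
    (hx : interDim x.1 x.2 = d) (hy : interDim y.1 y.2 = d') (c : Path.Homotopic.Quotient x y) :
    ∃ (p : Path.Homotopic.Quotient x (Ψ.base, Ψ.torus (stdAngle n d)))
      (q : Path.Homotopic.Quotient y (Ψ.base, Ψ.torus (stdAngle n d'))) (m : ℤ),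
      IsLevel d p ∧ IsLevel d' q ∧
        c = (p.trans (Ψ.windPair i₀ rfl rfl m)).trans q.symm := by
  subst hx hy
  obtain ⟨p, hp⟩ := Ψ.joinedIn_std_pair x.1 x.2
  obtain ⟨q, hq⟩ := Ψ.joinedIn_std_pair y.1 y.2
  obtain ⟨l, m, hl, hm⟩ := Ψ.exists_eq_windPair i₀ rfl rfl
    (((mk p).symm.trans c).trans (mk q))
  have hd : interDim Ψ.base (Ψ.torus (stdAngle n (interDim x.1 x.2))) = interDim x.1 x.2 := by
    simpa using hp 1
  rw [hd] at hl
  refine ⟨(mk p).trans l, mk q, m, IsLevel.trans ⟨p, rfl, hp⟩ hl, ⟨q, rfl, hq⟩, ?_⟩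
  rw [trans_assoc (mk p), ← hm]
  simp only [trans_assoc, trans_symm, trans_refl, trans_symm_cancel]

end SympFrame

theorem homotopicWith_of_pathInd_eq {x y x' y' : Lag ω × Lag ω} {d d' : ℕ}
    (hx : interDim x.1 x.2 = d) (hx' : interDim x'.1 x'.2 = d) (hy : interDim y.1 y.2 = d')
    (hy' : interDim y'.1 y'.2 = d') (γ : Path x y) (γ' : Path x' y')
    (h : pathInd γ = pathInd γ') :
    ContinuousMap.HomotopicWith γ.toContinuousMap γ'.toContinuousMap
      (fun f => interDim (f 0).1 (f 0).2 = d ∧ interDim (f 1).1 (f 1).2 = d') := by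
  classical
  obtain ⟨M, hM⟩ := exists_transv {x.1}
  obtain ⟨Ψ, -⟩ := exists_sympFrame (hM x.1 (by simp)) rfl
  rcases isEmpty_or_nonempty (Fin (finrank ℝ M.1)) with hn | ⟨⟨i₀⟩⟩
  · have : Subsingleton E := Ψ.coord.toEquiv.subsingleton
    have hL : Subsingleton (Lag ω) := ⟨fun a b => Subtype.ext (Subsingleton.elim _ _)⟩
    have e : γ.toContinuousMap = γ'.toContinuousMap := by
      ext1 t; exact Subsingleton.elim _ _
    rw [← e]
    refine ContinuousMap.HomotopicWith.refl _ ⟨?_, ?_⟩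
    · simpa using hx
    · simpa using hy
  · obtain ⟨φ, hφ⟩ := exists_isMaslovPrim (Y := Fin (finrank ℝ M.1) → ℝ)
      (continuous_const (y := Ψ.base)) Ψ.continuous_torus
    obtain ⟨κ, hκ, hshift⟩ := Ψ.exists_charge hφ i₀
    obtain ⟨p, q, m, hp, hq, hm⟩ := Ψ.exists_level_windPair i₀ hx hy (mk γ)
    obtain ⟨p', q', m', hp', hq', hm'⟩ := Ψ.exists_level_windPair i₀ hx' hy' (mk γ')
    rw [← clsInd_mk, ← clsInd_mk, hm, hm'] at h
    simp only [clsInd_trans, clsInd_symm, hp.clsInd_eq, hq.clsInd_eq, hp'.clsInd_eq,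
      hq'.clsInd_eq, Ψ.clsInd_windPair hφ, hshift] at h
    have hmm : m = m' := mul_right_cancel₀ hκ (by linarith)
    subst hmm
    obtain ⟨u, hu, hu'⟩ := hp.trans hp'.symm
    obtain ⟨v, hv, hv'⟩ := hq.trans hq'.symm
    refine homotopicWith_of_trans_eq γ γ' u v (S := {z | interDim z.1 z.2 = d})
      (T := {z | interDim z.1 z.2 = d'}) hu' hv' ?_
    have e : (q.trans q'.symm).symm = q'.trans q.symm := symm_eq_of_trans_eq_refl (by
      simp only [trans_assoc, symm_trans_cancel, trans_symm])
    rw [hu, hv, hm, hm', e]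
    simp only [trans_assoc, symm_trans_cancel]

end Classification

section IntersectionNumber

open Set Module unitInterval

variable [FiniteDimensional ℝ E] {ω : BilinForm ℝ E} [hω : IsSymplForm ω]

/-- The affine parametrization of `[a, b]` by the unit interval. -/
noncomputable def pairPath {A B : ℝ → Lag ω} (hA : Continuous A) (hB : Continuous B) (a b : ℝ) :
    Path (A a, B a) (A b, B b) :=
  ⟨⟨fun t : I => (A (a + (b - a) * t), B (a + (b - a) * t)),
    (hA.comp (f := fun t : I => a + (b - a) * (t : ℝ)) (by fun_prop)).prodMk
    (hB.comp (f := fun t : I => a + (b - a) * (t : ℝ)) (by fun_prop))⟩, by simp, by simp⟩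

theorem dataSum_eq_pathInd {A B : ℝ → Lag ω} (hA : Continuous A) (hB : Continuous B) {a b : ℝ}
    {L1 L2 : ℝ → Submodule ℝ E} (h1 : ∀ t ∈ Icc a b, (A t).1 = L1 t)
    (h2 : ∀ t ∈ Icc a b, (B t).1 = L2 t) (D : AdmissibleData ω a b L1 L2) :
    dataSum D = (1 / 2 : ℝ) * (pathInd (pairPath hA hB a b) : ℝ) := by
  obtain ⟨φ, hφ⟩ := exists_isMaslovPrim hA hB
  rw [dataSum_eq_prim hφ h1 h2 D, pathInd_eq_of_comp hφ (pairPath hA hB a b)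
    (g := fun t : I => a + (b - a) * (t : ℝ)) (by fun_prop) fun _ => rfl]
  simp

theorem exists_homotopy_of_dataSum_eq {a b : ℝ} (hab : a ≤ b)
    {L1 L2 L1' L2' : ℝ → Submodule ℝ E}
    (h1 : IsLagrangianPath ω a b L1) (h2 : IsLagrangianPath ω a b L2)
    (h1' : IsLagrangianPath ω a b L1') (h2' : IsLagrangianPath ω a b L2') {da db : ℕ}
    (hda : finrank ℝ ↥(L1 a ⊓ L2 a) = da) (hda' : finrank ℝ ↥(L1' a ⊓ L2' a) = da)
    (hdb : finrank ℝ ↥(L1 b ⊓ L2 b) = db) (hdb' : finrank ℝ ↥(L1' b ⊓ L2' b) = db)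
    (h : ∀ D : AdmissibleData ω a b L1 L2, ∀ D' : AdmissibleData ω a b L1' L2',
      dataSum D = dataSum D') :
    ∃ H1 H2 : ℝ → ℝ → Submodule ℝ E,
        IsLagrangianHomotopy ω a b H1 ∧ IsLagrangianHomotopy ω a b H2 ∧
        H1 0 = L1 ∧ H2 0 = L2 ∧ H1 1 = L1' ∧ H2 1 = L2' ∧
        (∀ s ∈ Icc (0 : ℝ) 1, IsLagrangianPath ω a b (H1 s) ∧ IsLagrangianPath ω a b (H2 s)) ∧
        (∀ s ∈ Icc (0 : ℝ) 1, finrank ℝ ↥(H1 s a ⊓ H2 s a) = da) ∧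
        (∀ s ∈ Icc (0 : ℝ) 1, finrank ℝ ↥(H1 s b ⊓ H2 s b) = db) := by
  obtain ⟨A, hA, hA1⟩ := h1.exists_continuous hab
  obtain ⟨B, hB, hB2⟩ := h2.exists_continuous hab
  obtain ⟨A', hA', hA1'⟩ := h1'.exists_continuous hab
  obtain ⟨B', hB', hB2'⟩ := h2'.exists_continuous hab
  have ha := left_mem_Icc.2 hab
  have hb := right_mem_Icc.2 hab
  obtain ⟨D⟩ := exists_admissibleData hA hB hab hA1 hB2
  obtain ⟨D'⟩ := exists_admissibleData hA' hB' hab hA1' hB2'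
  have hind := h D D'
  rw [dataSum_eq_pathInd hA hB hA1 hB2, dataSum_eq_pathInd hA' hB' hA1' hB2'] at hind
  replace hind : pathInd (pairPath hA hB a b) = pathInd (pairPath hA' hB' a b) := by
    have := mul_left_cancel₀ (by norm_num) hind
    exact_mod_cast this
  obtain ⟨F⟩ := homotopicWith_of_pathInd_eq (d := da) (d' := db)
    (by rw [← hda, ← hA1 a ha, ← hB2 a ha]; rfl) (by rw [← hda', ← hA1' a ha, ← hB2' a ha]; rfl)
    (by rw [← hdb, ← hA1 b hb, ← hB2 b hb]; rfl) (by rw [← hdb', ← hA1' b hb, ← hB2' b hb]; rfl)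
    _ _ hind
  let τ : ℝ → I := fun t => projIcc 0 1 zero_le_one ((t - a) / (b - a))
  have hτ : ∀ t ∈ Icc a b, a + (b - a) * (τ t : ℝ) = t := by
    intro t ht
    rcases hab.eq_or_lt with rfl | hlt
    · have : t = a := le_antisymm ht.2 ht.1
      simp [this]
    · have h0 : 0 < b - a := sub_pos.2 hlt
      have hmem : (t - a) / (b - a) ∈ Icc (0 : ℝ) 1 :=
        ⟨div_nonneg (sub_nonneg.2 ht.1) h0.le, (div_le_one h0).2 (by linarith [ht.2])⟩
      simp only [τ, projIcc_of_mem zero_le_one hmem]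
      rw [mul_div_cancel₀ _ h0.ne']
      ring
  let G : ℝ × ℝ → Lag ω × Lag ω := fun p => F (projIcc 0 1 zero_le_one p.1, τ p.2)
  have hG : Continuous G := by
    refine F.continuous.comp (Continuous.prodMk (continuous_projIcc.comp continuous_fst)
      (continuous_projIcc.comp ?_))
    fun_prop
  have hG0 : ∀ t ∈ Icc a b, G (0, t) = (A t, B t) := fun t ht => by
    simp only [G, projIcc_left]
    refine (F.apply_zero (τ t)).trans ?_
    change (A (a + (b - a) * (τ t : ℝ)), B (a + (b - a) * (τ t : ℝ))) = _
    rw [hτ t ht]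
  have hG1 : ∀ t ∈ Icc a b, G (1, t) = (A' t, B' t) := fun t ht => by
    simp only [G, projIcc_right]
    refine (F.apply_one (τ t)).trans ?_
    change (A' (a + (b - a) * (τ t : ℝ)), B' (a + (b - a) * (τ t : ℝ))) = _
    rw [hτ t ht]
  have hGa : ∀ s, interDim (G (s, a)).1 (G (s, a)).2 = da := fun s => by
    have e : τ a = 0 := by simp [τ]
    have := (F.prop (projIcc 0 1 zero_le_one s)).1
    simp only [G, e]
    exact this
  have hGb : ∀ s, interDim (G (s, b)).1 (G (s, b)).2 = db := fun s => by
    rcases hab.eq_or_lt with rfl | hlt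
    · rw [hGa, ← hda, hdb]
    · have e : τ b = 1 := by simp [τ, div_self (sub_pos.2 hlt).ne']
      have := (F.prop (projIcc 0 1 zero_le_one s)).2
      simp only [G, e]
      exact this
  let H (L L' : ℝ → Submodule ℝ E) (K : ℝ × ℝ → Lag ω) (s t : ℝ) : Submodule ℝ E :=
    if s = 0 then L t else if s = 1 then L' t else (K (s, t)).1
  have hH {L L' : ℝ → Submodule ℝ E} {K : ℝ × ℝ → Lag ω} (h0 : ∀ t ∈ Icc a b, (K (0, t)).1 = L t)
      (h1 : ∀ t ∈ Icc a b, (K (1, t)).1 = L' t) (s t : ℝ) (ht : t ∈ Icc a b) :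
      (K (s, t)).1 = H L L' K s t := by
    simp only [H]
    split_ifs with e e'
    · rw [e, h0 t ht]
    · rw [e', h1 t ht]
    · rfl
  have k1 := hH (L := L1) (L' := L1') (K := fun p => (G p).1)
    (fun t ht => by rw [hG0 t ht, hA1 t ht]) (fun t ht => by rw [hG1 t ht, hA1' t ht])
  have k2 := hH (L := L2) (L' := L2') (K := fun p => (G p).2)
    (fun t ht => by rw [hG0 t ht, hB2 t ht]) (fun t ht => by rw [hG1 t ht, hB2' t ht])
  refine ⟨H L1 L1' fun p => (G p).1, H L2 L2' fun p => (G p).2,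
    isLagrangianHomotopy_of_continuous hG.fst fun s _ t ht => k1 s t ht,
    isLagrangianHomotopy_of_continuous hG.snd fun s _ t ht => k2 s t ht, by ext1 t; simp [H],
    by ext1 t; simp [H], by ext1 t; simp [H], by ext1 t; simp [H], fun s _ => ⟨?_, ?_⟩, ?_, ?_⟩
  · exact isLagrangianPath_of_continuous (hG.fst.comp (g := fun p => (G p).1)
      (f := fun t : ℝ => (s, t)) (by fun_prop)) fun t ht => k1 s t ht
  · exact isLagrangianPath_of_continuous (hG.snd.comp (g := fun p => (G p).2)
      (f := fun t : ℝ => (s, t)) (by fun_prop)) fun t ht => k2 s t ht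
  · intro s _
    rw [← k1 s a ha, ← k2 s a ha]
    exact hGa s
  · intro s _
    rw [← k1 s b hb, ← k2 s b hb]
    exact hGb s

end IntersectionNumber

/-- the intersection number labels the connected components of the space of pairs
of paths of Lagrangian subspaces with given dimensions of the intersections at the endpoints:
two such pairs can be joined by a homotopy keeping those dimensions fixed if and only if they
have the same intersection number (computed from arbitrary admissible data). -/
theorem intersection_number_labels_components [FiniteDimensional ℝ E]
    (ω : BilinForm ℝ E) (halt : LinearMap.IsAlt ω)
    (hnd : LinearMap.BilinForm.Nondegenerate ω)
    (a b : ℝ) (hab : a ≤ b)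
    (L1 L2 L1' L2' : ℝ → Submodule ℝ E)
    (h1 : IsLagrangianPath ω a b L1) (h2 : IsLagrangianPath ω a b L2)
    (h1' : IsLagrangianPath ω a b L1') (h2' : IsLagrangianPath ω a b L2')
    (da db : ℕ)
    (hda : Module.finrank ℝ ↥(L1 a ⊓ L2 a) = da)
    (hda' : Module.finrank ℝ ↥(L1' a ⊓ L2' a) = da)
    (hdb : Module.finrank ℝ ↥(L1 b ⊓ L2 b) = db)
    (hdb' : Module.finrank ℝ ↥(L1' b ⊓ L2' b) = db) :
    (∃ H1 H2 : ℝ → ℝ → Submodule ℝ E,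
        IsLagrangianHomotopy ω a b H1 ∧ IsLagrangianHomotopy ω a b H2 ∧
        H1 0 = L1 ∧ H2 0 = L2 ∧ H1 1 = L1' ∧ H2 1 = L2' ∧
        (∀ s ∈ Set.Icc (0:ℝ) 1, IsLagrangianPath ω a b (H1 s) ∧ IsLagrangianPath ω a b (H2 s)) ∧
        (∀ s ∈ Set.Icc (0:ℝ) 1, Module.finrank ℝ ↥(H1 s a ⊓ H2 s a) = da) ∧
        (∀ s ∈ Set.Icc (0:ℝ) 1, Module.finrank ℝ ↥(H1 s b ⊓ H2 s b) = db)) ↔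
    (∀ D : AdmissibleData ω a b L1 L2, ∀ D' : AdmissibleData ω a b L1' L2',
      dataSum D = dataSum D') := by
  have hω : IsSymplForm ω := ⟨halt, hnd⟩
  constructor
  · rintro ⟨H1, H2, hH1, hH2, rfl, rfl, rfl, rfl, -, ha, hb⟩ D D'
    exact dataSum_eq_of_homotopy hab hH1 hH2 ha hb D D'
  · exact exists_homotopy_of_dataSum_eq hab h1 h2 h1' h2' hda hda' hdb hdb'
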